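/- Let A be a unital C*-algebra and let a, b ∈ A. Then the distance between D_A(a) and D_A(b) equals the minimum number r ≥ 0 satisfying both: (a) |τ(a − b)| ≤ r for all tracial states τ of A, and (b) d(W_{A/M}(q_M(a)), W_{A/M}(q_M(b))) ≤ r for all maximal closed two-sided ideals M of A. -/

import Mathlib

open scoped ComplexOrder

noncomputable section

variable {A : Type*} [CStarAlgebra A]

/-- The distance between two subsets of a (pseudo)metric space:
`d(D₁, D₂) = inf {dist x y : x ∈ D₁, y ∈ D₂}`. -/
def setDist {E : Type*} [PseudoMetricSpace E] (s t : Set E) : ℝ :=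
  sInf {r : ℝ | ∃ x ∈ s, ∃ y ∈ t, r = dist x y}

/-- A tracial state on a C*-algebra: a positive linear functional of norm 1 with the trace
property. -/
def IsTracialState (τ : A →L[ℂ] ℂ) : Prop :=
  ‖τ‖ = 1 ∧ (∀ a : A, 0 ≤ τ (star a * a)) ∧ ∀ a b : A, τ (a * b) = τ (b * a)

/-- A state on a C*-algebra: a positive linear functional of norm 1. -/
def IsState (ρ : A →L[ℂ] ℂ) : Prop :=
  ‖ρ‖ = 1 ∧ ∀ a : A, 0 ≤ ρ (star a * a)

/-- A closed two-sided ideal of a C*-algebra, regarded as a `ℂ`-submodule. -/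
def IsClosedTwoSidedIdeal (I : Submodule ℂ A) : Prop :=
  IsClosed (I : Set A) ∧ ∀ a b : A, b ∈ I → a * b ∈ I ∧ b * a ∈ I

/-- A maximal (proper, closed, two-sided) ideal of a C*-algebra. -/
def IsMaximalClosedIdeal (M : Submodule ℂ A) : Prop :=
  IsClosedTwoSidedIdeal M ∧ M ≠ ⊤ ∧
    ∀ J : Submodule ℂ A, IsClosedTwoSidedIdeal J → J ≠ ⊤ → M ≤ J → J = M

/-- The Dixmier set of `a`: the norm-closed convex hull of the unitary conjugates of `a`. -/
def dixmierSet (a : A) : Set A :=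
  closure (convexHull ℝ {b : A | ∃ u : unitary A, b = (u : A) * a * star (u : A)})

/-- The algebraic numerical range `W_{A/M}(q_M(a))` of the image of `a` in the quotient
`A/M`, identified with the set of values `ρ(a)` over states `ρ` of `A` vanishing on `M`. -/
def quotNumericalRange (M : Submodule ℂ A) (a : A) : Set ℂ :=
  {c : ℂ | ∃ ρ : A →L[ℂ] ℂ, IsState ρ ∧ (∀ x ∈ M, ρ x = 0) ∧ c = ρ a}

/-- A positive hermitian real-linear functional, as a bare function. -/
structure PosFun {B : Type*} [CStarAlgebra B] (F : B → ℝ) : Prop where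
  map_add : ∀ X Y, F (X + Y) = F X + F Y
  map_smul : ∀ (r : ℝ) X, F (r • X) = r * F X
  nonneg' : ∀ X, 0 ≤ F (star X * X)
  map_star : ∀ X, F (star X) = F X

namespace PosFun
variable {B : Type*} [CStarAlgebra B] {F F' : B → ℝ}

/-- The real-linear map underlying a positive functional. -/
def lin (hF : PosFun F) : B →ₗ[ℝ] ℝ where
  toFun := F
  map_add' := hF.map_add
  map_smul' := hF.map_smul

theorem map_zero (hF : PosFun F) : F 0 = 0 := _root_.map_zero hF.lin
theorem map_neg (hF : PosFun F) (X : B) : F (-X) = -F X := _root_.map_neg hF.lin X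
theorem map_sub (hF : PosFun F) (X Y : B) : F (X - Y) = F X - F Y := _root_.map_sub hF.lin X Y
theorem map_sum (hF : PosFun F) {ι : Type*} (s : Finset ι) (f : ι → B) :
    F (∑ i ∈ s, f i) = ∑ i ∈ s, F (f i) := _root_.map_sum hF.lin f s

theorem cauchy_schwarz (hF : PosFun F) (X Y : B) :
    F (star Y * X) ^ 2 ≤ F (star Y * Y) * F (star X * X) := by
  have h : ∀ t : ℝ, 0 ≤ F (star Y * Y) * (t * t) + (2 * F (star Y * X)) * t + F (star X * X) := by
    intro t
    have h1 := hF.nonneg' (X + t • Y)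
    have h2 : star (X + t • Y) * (X + t • Y) = star X * X + t • (star X * Y) + t • (star Y * X)
        + (t * t) • (star Y * Y) := by
      simp only [star_add, star_smul, star_trivial, mul_add, add_mul, smul_mul_assoc,
        mul_smul_comm, mul_smul, smul_add]
      abel
    have h3 : F (star X * Y) = F (star Y * X) := by
      rw [← hF.map_star (star X * Y)]; simp
    rw [h2, hF.map_add, hF.map_add, hF.map_add, hF.map_smul, hF.map_smul, hF.map_smul, h3] at h1
    linarith
  have := discrim_le_zero h
  simp only [discrim] at this
  nlinarith

theorem one_nonneg (hF : PosFun F) : 0 ≤ F 1 := by simpa using hF.nonneg' 1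

theorem zero : PosFun (0 : B → ℝ) := ⟨by simp, by simp, by simp, by simp⟩

theorem add (hF : PosFun F) (hF' : PosFun F') : PosFun (F + F') where
  map_add X Y := by simp [hF.map_add, hF'.map_add]; ring
  map_smul r X := by simp [hF.map_smul, hF'.map_smul]; ring
  nonneg' X := add_nonneg (hF.nonneg' X) (hF'.nonneg' X)
  map_star X := by simp [hF.map_star, hF'.map_star]

theorem smul (hF : PosFun F) {c : ℝ} (hc : 0 ≤ c) : PosFun (c • F) where
  map_add X Y := by simp [hF.map_add]; ring
  map_smul r X := by simp [hF.map_smul]; ring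
  nonneg' X := mul_nonneg hc (hF.nonneg' X)
  map_star X := by simp [hF.map_star]

theorem conj (hF : PosFun F) (y : B) : PosFun (fun X => F (star y * X * y)) where
  map_add X Y := by simp only [mul_add, add_mul, hF.map_add]
  map_smul r X := by simp only [mul_smul_comm, smul_mul_assoc, hF.map_smul]
  nonneg' X := by simpa [mul_assoc] using hF.nonneg' (X * y)
  map_star X := by simpa [mul_assoc] using hF.map_star (star y * X * y)

theorem conj' (hF : PosFun F) (y : B) : PosFun (fun X => F (y * X * star y)) := by
  simpa using hF.conj (star y)

/-- Pulling a positive functional back along a star homomorphism. -/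
theorem comp {C : Type*} [CStarAlgebra C] (hF : PosFun F) (φ : C →⋆ₐ[ℂ] B) :
    PosFun (fun x => F (φ x)) where
  map_add X Y := by simp [hF.map_add]
  map_smul r X := by
    rw [← hF.map_smul]; congr 1
    have := _root_.map_smul φ (r : ℂ) X
    simpa using this
  nonneg' X := by simpa [StarHomClass.map_star] using hF.nonneg' (φ X)
  map_star X := by simp [StarHomClass.map_star, hF.map_star]

theorem smul_one_apply (hF : PosFun F) (r : ℝ) : F (algebraMap ℝ B r) = r * F 1 := by
  rw [Algebra.algebraMap_eq_smul_one, hF.map_smul]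

section Order
variable [PartialOrder B] [StarOrderedRing B]

theorem nonneg (hF : PosFun F) {X : B} (hX : 0 ≤ X) : 0 ≤ F X := by
  obtain ⟨s, rfl⟩ := CStarAlgebra.nonneg_iff_eq_star_mul_self.mp hX
  exact hF.nonneg' s

theorem mono (hF : PosFun F) {X Y : B} (h : X ≤ Y) : F X ≤ F Y := by
  have := hF.nonneg (sub_nonneg.mpr h)
  rw [hF.map_sub] at this; linarith

end Order

theorem star_mul_le (hF : PosFun F) (X : B) : F (star X * X) ≤ ‖X‖ ^ 2 * F 1 := by
  let _ := CStarAlgebra.spectralOrder B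
  have _ := CStarAlgebra.spectralOrderedRing B
  rw [← hF.smul_one_apply]
  exact hF.mono (CStarAlgebra.star_mul_le_algebraMap_norm_sq)

theorem abs_le (hF : PosFun F) (X : B) : |F X| ≤ F 1 * ‖X‖ := by
  have h := hF.cauchy_schwarz X 1
  simp only [star_one, one_mul] at h
  have h2 := hF.star_mul_le X
  apply abs_le_of_sq_le_sq _ (mul_nonneg hF.one_nonneg (norm_nonneg X))
  nlinarith [hF.one_nonneg]

theorem le_norm (hF : PosFun F) (X : B) : F X ≤ F 1 * ‖X‖ := (le_abs_self _).trans (hF.abs_le X)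

/-- Mixed Cauchy–Schwarz bound with an operator in the middle. -/
theorem conj_le (hF : PosFun F) (X y : B) :
    F (star y * X * y) ≤ ‖X‖ * F (star y * y) := by
  have := (hF.conj y).le_norm X
  simp only [mul_one] at this
  linarith

theorem continuous (hF : PosFun F) : Continuous F := by
  have : Continuous (hF.lin.mkContinuous (F 1) fun X => hF.abs_le X) :=
    ContinuousLinearMap.continuous _
  exact this

theorem eq_zero (hF : PosFun F) (h : F 1 = 0) : F = 0 := by
  ext X
  have := hF.abs_le X
  rw [h, zero_mul] at this
  simpa using abs_nonpos_iff.mp this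

theorem isClosed_setOf : IsClosed {F : B → ℝ | PosFun F} := by
  have : {F : B → ℝ | PosFun F} = (⋂ X, ⋂ Y, {F : B → ℝ | F (X + Y) = F X + F Y}) ∩
    (⋂ r : ℝ, ⋂ X, {F : B → ℝ | F (r • X) = r * F X}) ∩
    (⋂ X, {F : B → ℝ | 0 ≤ F (star X * X)}) ∩ (⋂ X, {F : B → ℝ | F (star X) = F X}) := by
    ext F
    simp only [Set.mem_ofPred_eq, Set.mem_inter_iff, Set.mem_iInter]
    exact ⟨fun h => ⟨⟨⟨h.1, h.2⟩, h.3⟩, h.4⟩, fun h => ⟨h.1.1.1, h.1.1.2, h.1.2, h.2⟩⟩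
  rw [this]
  refine IsClosed.inter (IsClosed.inter (IsClosed.inter ?_ ?_) ?_) ?_
  · exact isClosed_iInter fun X => isClosed_iInter fun Y => isClosed_eq (by fun_prop) (by fun_prop)
  · exact isClosed_iInter fun X => isClosed_iInter fun Y => isClosed_eq (by fun_prop) (by fun_prop)
  · exact isClosed_iInter fun X => isClosed_le (by fun_prop) (by fun_prop)
  · exact isClosed_iInter fun X => isClosed_eq (by fun_prop) (by fun_prop)

theorem isCompact_of_isClosed {S : Set (B → ℝ)} (hS : IsClosed S) (C : ℝ)
    (h : ∀ F ∈ S, PosFun F ∧ F 1 ≤ C) : IsCompact S := by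
  have hK : IsCompact (Set.pi Set.univ fun X : B => Set.Icc (-(C * ‖X‖)) (C * ‖X‖)) :=
    isCompact_univ_pi fun X => isCompact_Icc
  refine hK.of_isClosed_subset hS fun F hF => ?_
  obtain ⟨h1, h2⟩ := h F hF
  intro X _
  have := h1.abs_le X
  have h3 := mul_le_mul_of_nonneg_right h2 (norm_nonneg X)
  exact _root_.abs_le.mp (this.trans h3)

end PosFun

section HahnBanach
variable {B : Type*} [CStarAlgebra B] [PartialOrder B] [StarOrderedRing B]

/-- Hahn–Banach for positive functionals dominated by a sublinear function. -/
theorem exists_posFun_le (N : B → ℝ)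
    (hadd : ∀ x y, IsSelfAdjoint x → IsSelfAdjoint y → N (x + y) ≤ N x + N y)
    (hsmul : ∀ (c : ℝ) x, 0 < c → IsSelfAdjoint x → N (c • x) = c * N x)
    (hneg : ∀ x, x ≤ 0 → N x ≤ 0) (x₀ : B) (hx₀ : IsSelfAdjoint x₀) :
    ∃ F : B → ℝ, PosFun F ∧ (∀ x, IsSelfAdjoint x → F x ≤ N x) ∧ F x₀ = N x₀ := by
  classical
  have h0 : N 0 = 0 := by
    have := hsmul 2 0 (by norm_num) (IsSelfAdjoint.zero B)
    simp only [smul_zero] at this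
    linarith
  let R : B → B := fun X => (2⁻¹ : ℝ) • (X + star X)
  have hRsa : ∀ X, IsSelfAdjoint (R X) := fun X =>
    IsSelfAdjoint.smul (IsSelfAdjoint.all _) (IsSelfAdjoint.add_star_self X)
  have hR : ∀ X, IsSelfAdjoint X → R X = X := by
    intro X hX
    simp only [R, hX.star_eq, ← two_smul ℝ X, smul_smul]
    norm_num
  have hRadd : ∀ X Y, R (X + Y) = R X + R Y := by
    intro X Y; simp only [R, star_add, ← smul_add]; congr 1; abel
  have hRsmul : ∀ (c : ℝ) X, R (c • X) = c • R X := by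
    intro c X; simp only [R, star_smul, star_trivial, ← smul_add]; rw [smul_comm]
  have hneg0 : 0 ≤ N x₀ + N (-x₀) := by
    have := hadd x₀ (-x₀) hx₀ hx₀.neg
    rwa [add_neg_cancel, h0] at this
  have hdom : ∀ t : ℝ, t * N x₀ ≤ N (t • x₀) := by
    intro t
    rcases lt_trichotomy t 0 with ht | rfl | ht
    · have := hsmul (-t) (-x₀) (by linarith) hx₀.neg
      rw [smul_neg, neg_smul, neg_neg] at this
      rw [this]
      nlinarith
    · simp [h0]
    · rw [hsmul t x₀ ht hx₀]
  let f : B →ₗ.[ℝ] ℝ :=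
    if h : x₀ = 0 then ⊥ else LinearPMap.mkSpanSingleton x₀ (N x₀) h
  have hf1 : x₀ ≠ 0 → ∃ h : x₀ ∈ f.domain, f ⟨x₀, h⟩ = N x₀ := by
    intro h
    have hfe : f = LinearPMap.mkSpanSingleton x₀ (N x₀) h := by simp only [f, dif_neg h]
    rw [hfe]
    refine ⟨Submodule.mem_span_singleton_self x₀, ?_⟩
    exact LinearPMap.mkSpanSingleton_apply ℝ _ h (N x₀)
  have hf2 : ∀ x : f.domain, f x ≤ N (R x) := by
    by_cases h : x₀ = 0
    · have hfe : f = ⊥ := by simp only [f, dif_pos h]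
      rw [hfe]
      rintro ⟨x, hx⟩
      have : x = 0 := (Submodule.mem_bot ℝ).mp hx
      subst this
      have : (⊥ : B →ₗ.[ℝ] ℝ) ⟨0, hx⟩ = 0 := LinearPMap.map_zero _
      rw [this]
      simp [R, h0]
    · have hfe : f = LinearPMap.mkSpanSingleton x₀ (N x₀) h := by simp only [f, dif_neg h]
      rw [hfe]
      rintro ⟨x, hx⟩
      obtain ⟨t, rfl⟩ := Submodule.mem_span_singleton.mp hx
      have : (LinearPMap.mkSpanSingleton x₀ (N x₀) h) ⟨t • x₀, hx⟩ = t • N x₀ :=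
        LinearPMap.mkSpanSingleton'_apply _ _ _ _ _
      rw [this]
      simp only [hRsmul, hR x₀ hx₀]
      exact hdom t
  obtain ⟨g, hg1, hg2⟩ := exists_extension_of_le_sublinear f (fun X => N (R X))
    (fun c hc X => by simp only [hRsmul]; exact hsmul c _ hc (hRsa X))
    (fun X Y => by simp only [hRadd]; exact hadd _ _ (hRsa X) (hRsa Y)) hf2
  have hstar : ∀ X, g (star X) = g X := by
    intro X
    have e1 : R (star X - X) = 0 := by simp only [R, star_sub, star_star]; simp
    have e2 : R (X - star X) = 0 := by simp only [R, star_sub, star_star]; simp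
    have h1 := hg2 (star X - X)
    have h2 := hg2 (X - star X)
    rw [e1, h0, map_sub] at h1
    rw [e2, h0, map_sub] at h2
    linarith
  have hgsa : ∀ x, IsSelfAdjoint x → g x ≤ N x := by
    intro x hx; have := hg2 x; rwa [hR x hx] at this
  refine ⟨g, ⟨fun X Y => map_add g X Y, fun r X => by simp, ?_, hstar⟩, hgsa, ?_⟩
  · intro X
    have h1 := hgsa (-(star X * X)) (IsSelfAdjoint.star_mul_self X).neg
    have h2 := hneg (-(star X * X)) (by simp)
    rw [map_neg] at h1
    linarith
  · by_cases h : x₀ = 0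
    · rw [h, h0, map_zero]
    · obtain ⟨h1, h2⟩ := hf1 h
      rw [← h2, ← hg1]

end HahnBanach

section Action
variable {B : Type*} [CStarAlgebra B]

/-- The action of a unitary on functionals by conjugation. -/
def uact (u : unitary B) (F : B → ℝ) : B → ℝ := fun X => F ((u : B) * X * star (u : B))

theorem uact_apply (u : unitary B) (F : B → ℝ) (X : B) :
    uact u F X = F ((u : B) * X * star (u : B)) := rfl

theorem uact_mul (u w : unitary B) (F : B → ℝ) : uact (w * u) F = uact u (uact w F) := by
  ext X; simp [uact, mul_assoc]

theorem uact_one (F : B → ℝ) : uact (1 : unitary B) F = F := by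
  ext X; simp [uact]

theorem uact_add (u : unitary B) (F F' : B → ℝ) : uact u (F + F') = uact u F + uact u F' := rfl

theorem uact_smul (u : unitary B) (c : ℝ) (F : B → ℝ) : uact u (c • F) = c • uact u F := rfl

theorem PosFun.uact {F : B → ℝ} (hF : PosFun F) (u : unitary B) : PosFun (uact u F) :=
  hF.conj' (u : B)

theorem uact_apply_one (u : unitary B) (F : B → ℝ) : uact u F 1 = F 1 := by simp [uact]

theorem continuous_uact (u : unitary B) : Continuous (uact u) :=
  continuous_pi fun _ => continuous_apply _

/-- `F` is fixed by conjugation by the elements of `G`. -/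
def UInvariant (G : Subgroup (unitary B)) (F : B → ℝ) : Prop := ∀ u ∈ G, uact u F = F

/-- The set `S` is stable under conjugation by the elements of `G`. -/
def UStable (G : Subgroup (unitary B)) (S : Set (B → ℝ)) : Prop :=
  ∀ u ∈ G, ∀ F ∈ S, uact u F ∈ S

/-- Domination of positive functionals. -/
def FunLE (F T : B → ℝ) : Prop := ∀ X, F (star X * X) ≤ T (star X * X)

theorem FunLE.one {F T : B → ℝ} (h : FunLE F T) : F 1 ≤ T 1 := by simpa using h 1

theorem FunLE.trans {F T T' : B → ℝ} (h : FunLE F T) (h' : FunLE T T') : FunLE F T' :=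
  fun X => (h X).trans (h' X)

theorem FunLE.uact {F T : B → ℝ} (h : FunLE F T) (u : unitary B) :
    FunLE (uact u F) (uact u T) := by
  intro X
  have := h (X * star (u : B))
  simpa [_root_.uact, mul_assoc] using this

theorem FunLE.posFun_sub {F T : B → ℝ} (h : FunLE F T) (hF : PosFun F) (hT : PosFun T) :
    PosFun (T - F) where
  map_add X Y := by simp [hF.map_add, hT.map_add]; ring
  map_smul r X := by simp [hF.map_smul, hT.map_smul]; ring
  nonneg' X := sub_nonneg.mpr (h X)
  map_star X := by simp [hF.map_star, hT.map_star]

theorem isClosed_funLE (T : B → ℝ) : IsClosed {F | FunLE F T} := by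
  simp only [FunLE, Set.ofPred_forall]
  exact isClosed_iInter fun X => isClosed_le (by fun_prop) (by fun_prop)

/-- A fixed point theorem: a nonempty compact convex stable set of positive functionals dominated
by an invariant positive functional contains an invariant one. -/
theorem exists_uInvariant_mem {G : Subgroup (unitary B)} {T : B → ℝ} (hT : PosFun T)
    (hTG : UInvariant G T) {S : Set (B → ℝ)} (hne : S.Nonempty) (hcomp : IsCompact S)
    (hconv : Convex ℝ S) (hst : UStable G S) (hS : ∀ F ∈ S, PosFun F ∧ FunLE F T) :
    ∃ F ∈ S, UInvariant G F := by
  let K : Set ((B → ℝ) × ℝ) := (S ×ˢ Set.Icc 0 (T 1)) ∩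
    {p | ∀ X, p.1 X ^ 2 ≤ p.2 * T (star X * X)}
  have hKcl : IsClosed {p : (B → ℝ) × ℝ | ∀ X, p.1 X ^ 2 ≤ p.2 * T (star X * X)} := by
    simp only [Set.ofPred_forall]
    exact isClosed_iInter fun X => isClosed_le (by fun_prop) (by fun_prop)
  have hK : IsCompact K := (hcomp.prod isCompact_Icc).inter_right hKcl
  have hKne : K.Nonempty := by
    obtain ⟨F, hF⟩ := hne
    obtain ⟨h1, h2⟩ := hS F hF
    refine ⟨(F, T 1), ⟨hF, hT.one_nonneg, le_rfl⟩, fun X => ?_⟩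
    have := h1.cauchy_schwarz X 1
    simp only [star_one, one_mul] at this
    calc F X ^ 2 ≤ F 1 * F (star X * X) := this
      _ ≤ T 1 * T (star X * X) := mul_le_mul h2.one (h2 X) (h1.nonneg' X) hT.one_nonneg
  obtain ⟨⟨F, c⟩, ⟨⟨hFS, hc⟩, hFc⟩, hmin⟩ := hK.exists_isMinOn hKne continuous_snd.continuousOn
  simp only [Set.mem_ofPred_eq] at hFc hc hFS
  refine ⟨F, hFS, fun u hu => ?_⟩
  set F' := uact u F with hF'
  have hF'S : F' ∈ S := hst u hu F hFS
  have hF'c : ∀ X, F' X ^ 2 ≤ c * T (star X * X) := by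
    intro X
    have := hFc ((u : B) * X * star (u : B))
    have h2 : T (star ((u : B) * X * star (u : B)) * ((u : B) * X * star (u : B)))
        = T (star X * X) := by
      have := congrFun (hTG u hu) (star X * X)
      rw [← this, uact_apply]
      congr 1
      simp only [star_mul, star_star, mul_assoc]
      rw [← mul_assoc (star (u : B)) (u : B)]; simp
    rwa [h2] at this
  by_contra hne'
  obtain ⟨Y, hY⟩ : ∃ Y, F' Y < F Y := by
    by_contra! hcon
    apply hne'
    ext X
    have h1 := hcon X
    have h2 := hcon (-X)
    rw [(hS F hFS).1.map_neg, (hS F' hF'S).1.map_neg] at h2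
    linarith
  have hFp := (hS F hFS).1
  have hFp' := (hS F' hF'S).1
  set m := (F Y - F' Y) / 2 with hm
  have hm0 : 0 < m := by simp only [hm]; linarith
  set t := T (star Y * Y)
  have ht : 0 ≤ t := hT.nonneg' Y
  have hct : 0 < c * t := by
    by_contra! hle
    have h0 : c * t = 0 := le_antisymm hle (mul_nonneg hc.1 ht)
    have h1 := hFc Y
    have h2 := hF'c Y
    rw [h0] at h1 h2
    have h3 : F Y = 0 := by nlinarith
    have h4 : F' Y = 0 := by nlinarith
    linarith
  set l := m / (c * t) with hl
  have hl0 : 0 < l := by positivity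
  have hlm : l * (c * t) = m := by rw [hl]; exact div_mul_cancel₀ m hct.ne'
  set P : B → ℝ := (2⁻¹ : ℝ) • F + (2⁻¹ : ℝ) • F' with hP
  have hPS : P ∈ S := hconv hFS hF'S (by norm_num) (by norm_num) (by norm_num)
  have hPX : ∀ X, P X = (F X + F' X) / 2 := by intro X; simp [hP]; ring
  have key : ∀ X, P X ^ 2 * (1 + l * m) ≤ c * T (star X * X) := by
    intro X
    set s := l * P X with hs
    have h1 := hFc (X + s • Y)
    have h2 := hF'c (X - s • Y)
    have e1 : T (star (X + s • Y) * (X + s • Y)) + T (star (X - s • Y) * (X - s • Y))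
        = 2 * T (star X * X) + 2 * (s ^ 2 * t) := by
      have : star (X + s • Y) * (X + s • Y) + star (X - s • Y) * (X - s • Y)
          = (2 : ℝ) • (star X * X) + (2 * s ^ 2 : ℝ) • (star Y * Y) := by
        simp only [star_add, star_sub, star_smul, star_trivial, mul_add, add_mul, mul_sub, sub_mul,
          smul_mul_assoc, mul_smul_comm]
        module
      rw [← hT.map_add, this, hT.map_add, hT.map_smul, hT.map_smul]; ring
    rw [hFp.map_add, hFp.map_smul] at h1
    rw [hFp'.map_sub, hFp'.map_smul] at h2
    have h3 : (P X + s * m) ^ 2 ≤ c * (T (star X * X) + s ^ 2 * t) := by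
      rw [hPX, hm]
      have : c * (T (star X * X) + s ^ 2 * t) =
        (c * T (star (X + s • Y) * (X + s • Y)) + c * T (star (X - s • Y) * (X - s • Y))) / 2 := by
        rw [← mul_add, e1]; ring
      rw [this]
      nlinarith [sq_nonneg ((F X + s * F Y) - (F' X - s * F' Y))]
    have h4 : (P X + s * m) ^ 2 - c * (s ^ 2 * t) = P X ^ 2 * (1 + l * m) + (s * m) ^ 2 := by
      have : c * (s ^ 2 * t) = P X ^ 2 * l * (l * (c * t)) := by rw [hs]; ring
      rw [this, hlm, hs]; ring
    nlinarith [sq_nonneg (s * m)]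
  have hlm0 : 0 < l * m := by positivity
  have hmem : (P, c / (1 + l * m)) ∈ K := by
    refine ⟨⟨hPS, div_nonneg hc.1 (by positivity), ?_⟩, fun X => ?_⟩
    · exact (div_le_self hc.1 (by linarith)).trans hc.2
    · have := key X
      show P X ^ 2 ≤ c / (1 + l * m) * T (star X * X)
      rw [div_mul_eq_mul_div, le_div_iff₀ (by positivity)]
      exact this
  have hle : c ≤ c / (1 + l * m) := hmin hmem
  have hc0 : 0 < c := by
    rcases hc.1.lt_or_eq with h | h
    · exact h
    · rw [← h] at hct; simp at hct
  rw [le_div_iff₀ (by positivity)] at hle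
  nlinarith

end Action

section ExpGroup
variable {A : Type*} [CStarAlgebra A] {B : Type*} [CStarAlgebra B]

/-- The group of unitaries generated by exponentials. -/
def expGroup (A : Type*) [CStarAlgebra A] : Subgroup (unitary A) :=
  Subgroup.closure (Set.range selfAdjoint.expUnitary)

/-- The image of the exponential group under a star homomorphism. -/
def imGroup (φ : A →⋆ₐ[ℂ] B) : Subgroup (unitary B) :=
  (expGroup A).map (Unitary.map (⟨⟨⟨φ, map_one φ⟩, map_mul φ⟩, StarHomClass.map_star φ⟩ : A →⋆* B) :
    unitary A →* unitary B)

theorem mem_imGroup {φ : A →⋆ₐ[ℂ] B} {u : unitary A} (hu : u ∈ expGroup A) :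
    ∃ w ∈ imGroup φ, (w : B) = φ u :=
  ⟨_, Subgroup.mem_map_of_mem _ hu, rfl⟩

theorem exists_of_mem_imGroup {φ : A →⋆ₐ[ℂ] B} {w : unitary B} (hw : w ∈ imGroup φ) :
    ∃ u ∈ expGroup A, (w : B) = φ u := by
  obtain ⟨u, hu, rfl⟩ := Subgroup.mem_map.mp hw
  exact ⟨u, hu, rfl⟩

theorem mem_expGroup_of_norm_lt {u : unitary A} (hu : ‖(u - 1 : A)‖ < 2) : u ∈ expGroup A := by
  rw [← expUnitary_argSelfAdjoint hu]
  exact Subgroup.subset_closure ⟨_, rfl⟩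

theorem mem_span_expGroup_of_isSelfAdjoint (c : A) (hc : IsSelfAdjoint c) (hn : ‖c‖ ≤ 2⁻¹) :
    c ∈ Submodule.span ℂ ((fun u : unitary A => (u : A)) '' (expGroup A : Set (unitary A))) := by
  let _ := CStarAlgebra.spectralOrder A
  have _ := CStarAlgebra.spectralOrderedRing A
  have hn1 : ‖(⟨c, hc⟩ : selfAdjoint A)‖ ≤ 1 := by
    show ‖c‖ ≤ 1
    linarith
  let u := selfAdjoint.unitarySelfAddISMul ⟨c, hc⟩ hn1
  set s : A := CFC.sqrt (1 - c ^ 2)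
  have hu : (u : A) = c + Complex.I • s := rfl
  have hsu : star (u : A) = c - Complex.I • s := selfAdjoint.star_coe_unitarySelfAddISMul ⟨c, hc⟩ hn1
  have hvmem : (-Complex.I) • (u : A) ∈ unitary A := by
    rw [Unitary.mem_iff]
    constructor
    · simp only [star_smul, smul_mul_smul_comm, Unitary.coe_star_mul_self]; simp
    · simp only [star_smul, smul_mul_smul_comm]; simp
  let v : unitary A := ⟨_, hvmem⟩
  have hv : (v : A) = s - Complex.I • c := by
    show (-Complex.I) • (u : A) = _
    rw [hu, smul_add, smul_smul]
    simp only [neg_mul, Complex.I_mul_I, neg_neg, one_smul, neg_smul]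
    abel
  have hs0 : 0 ≤ s := CFC.sqrt_nonneg _
  have hc2 : 0 ≤ c ^ 2 := by
    have := star_mul_self_nonneg c
    rwa [hc.star_eq, ← sq] at this
  have hs1 : s ≤ 1 := by
    have : CFC.sqrt (1 - c ^ 2) ≤ CFC.sqrt (1 : A) :=
      CFC.sqrt_le_sqrt _ _ (by simpa using hc2)
    simpa using this
  have h1s : ‖(1 : A) - s‖ ≤ 1 := by
    rw [CStarAlgebra.norm_le_one_iff_of_nonneg _ (sub_nonneg.mpr hs1)]
    simpa using hs0
  have hvG : v ∈ expGroup A := by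
    apply mem_expGroup_of_norm_lt
    have : (v : A) - 1 = -((1 : A) - s) - Complex.I • c := by rw [hv]; abel
    rw [this]
    calc _ ≤ ‖-((1 : A) - s)‖ + ‖Complex.I • c‖ := norm_sub_le _ _
      _ ≤ 1 + 2⁻¹ := by rw [norm_neg, norm_smul, Complex.norm_I, one_mul]; exact add_le_add h1s hn
      _ < 2 := by norm_num
  have hvG' : v⁻¹ ∈ expGroup A := inv_mem hvG
  have e : c = (Complex.I / 2) • (v : A) + (-Complex.I / 2) • ((v⁻¹ : unitary A) : A) := by
    have : ((v⁻¹ : unitary A) : A) = s + Complex.I • c := by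
      show star (v : A) = _
      rw [hv]
      simp only [star_sub, star_smul, hc.star_eq, hs0.isSelfAdjoint.star_eq]
      simp
    rw [this, hv]
    have h2 : (Complex.I / 2) • (s - Complex.I • c) + (-Complex.I / 2) • (s + Complex.I • c)
      = (-(Complex.I * Complex.I)) • c := by module
    rw [h2]; simp
  rw [e]
  exact add_mem (Submodule.smul_mem _ _ (Submodule.subset_span ⟨v, hvG, rfl⟩))
    (Submodule.smul_mem _ _ (Submodule.subset_span ⟨_, hvG', rfl⟩))

theorem mem_span_expGroup (c : A) :
    c ∈ Submodule.span ℂ ((fun u : unitary A => (u : A)) '' (expGroup A : Set (unitary A))) := by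
  have sa : ∀ c : A, IsSelfAdjoint c →
      c ∈ Submodule.span ℂ ((fun u : unitary A => (u : A)) '' (expGroup A : Set (unitary A))) := by
    intro c hc
    set n : ℝ := 2 * (‖c‖ + 1)
    have hn : 0 < n := by positivity
    have h := mem_span_expGroup_of_isSelfAdjoint ((n⁻¹ : ℝ) • c)
      (IsSelfAdjoint.smul (IsSelfAdjoint.all _) hc) (by
        rw [norm_smul, Real.norm_of_nonneg (by positivity), inv_mul_le_iff₀ hn]
        simp only [n]
        linarith)
    have h2 := Submodule.smul_mem _ (n : ℂ) h
    convert h2 using 1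
    rw [Complex.coe_smul, smul_smul, mul_inv_cancel₀ hn.ne', one_smul]
  rw [← realPart_add_I_smul_imaginaryPart c]
  exact add_mem (sa _ (realPart c).2) (Submodule.smul_mem _ _ (sa _ (imaginaryPart c).2))

/-- Elements are finite combinations of unitaries in the exponential group. -/
theorem exists_expGroup_sum (c : A) : ∃ (n : ℕ) (z : Fin n → ℂ) (u : Fin n → unitary A),
    (∀ i, u i ∈ expGroup A) ∧ c = ∑ i, z i • (u i : A) := by
  obtain ⟨n, f, g, h⟩ := Submodule.mem_span_set'.mp (mem_span_expGroup c)
  choose u hu1 hu2 using fun i => (g i).2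
  refine ⟨n, f, u, hu1, ?_⟩
  rw [← h]
  exact Finset.sum_congr rfl fun i _ => by rw [← hu2 i]

/-- An invariant functional commutes with the image. -/
theorem UInvariant.comm {φ : A →⋆ₐ[ℂ] B} {F : B → ℝ} (hF : PosFun F)
    (h : UInvariant (imGroup φ) F) (x : A) (X : B) : F (φ x * X) = F (X * φ x) := by
  obtain ⟨n, z, u, hu, rfl⟩ := exists_expGroup_sum x
  simp only [map_sum, Finset.sum_mul, Finset.mul_sum, hF.map_sum]
  refine Finset.sum_congr rfl fun i _ => ?_
  obtain ⟨w, hw, hwu⟩ := mem_imGroup (φ := φ) (hu i)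
  rw [map_smul, ← hwu]
  have := congrFun (h w hw) (z i • (X * (w : B)))
  rw [uact_apply] at this
  simp only [smul_mul_assoc, mul_smul_comm, mul_assoc] at this ⊢
  simpa using this

end ExpGroup

section SquareSums
variable {A : Type*} [CStarAlgebra A]

/-- `∑ z* z` over a list. -/
def sqL (l : List A) : A := (l.map fun z => star z * z).sum
/-- `∑ z z*` over a list. -/
def sqR (l : List A) : A := (l.map fun z => z * star z).sum

@[simp] theorem sqL_nil : sqL ([] : List A) = 0 := rfl
@[simp] theorem sqR_nil : sqR ([] : List A) = 0 := rfl
@[simp] theorem sqL_cons (z : A) (l : List A) : sqL (z :: l) = star z * z + sqL l := by simp [sqL]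
@[simp] theorem sqR_cons (z : A) (l : List A) : sqR (z :: l) = z * star z + sqR l := by simp [sqR]
theorem sqL_append (l l' : List A) : sqL (l ++ l') = sqL l + sqL l' := by simp [sqL]
theorem sqR_append (l l' : List A) : sqR (l ++ l') = sqR l + sqR l' := by simp [sqR]

theorem sqL_map_mul_right (y : A) (l : List A) :
    sqL (l.map fun z => z * y) = star y * sqL l * y := by
  induction l with
  | nil => simp
  | cons z l ih => simp [ih, mul_add, add_mul, mul_assoc]

theorem sqR_map_mul_left (y : A) (l : List A) :
    sqR (l.map fun z => y * z) = y * sqR l * star y := by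
  induction l with
  | nil => simp
  | cons z l ih => simp [ih, mul_add, add_mul, mul_assoc]

theorem sqR_map_mul_right (y : A) (l : List A) :
    sqR (l.map fun z => z * y) = (l.map fun z => z * (y * star y) * star z).sum := by
  simp only [sqR, List.map_map]
  congr 1
  refine List.map_congr_left fun z _ => ?_
  simp [mul_assoc]

variable [PartialOrder A] [StarOrderedRing A]

theorem sqL_nonneg (l : List A) : 0 ≤ sqL l := by
  induction l with
  | nil => simp
  | cons z l ih => rw [sqL_cons]; exact add_nonneg (star_mul_self_nonneg z) ih

theorem sqR_nonneg (l : List A) : 0 ≤ sqR l := by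
  induction l with
  | nil => simp
  | cons z l ih => rw [sqR_cons]; exact add_nonneg (mul_star_self_nonneg z) ih

theorem list_conj_mono (l : List A) {x y : A} (h : x ≤ y) :
    (l.map fun z => z * x * star z).sum ≤ (l.map fun z => z * y * star z).sum := by
  induction l with
  | nil => simp
  | cons z l ih =>
    simp only [List.map_cons, List.sum_cons]
    exact add_le_add (star_right_conjugate_le_conjugate h z) ih

/-- A positive inverse square root. -/
theorem exists_inv_sqrt {S : A} (hS : 1 ≤ S) :
    ∃ T : A, IsSelfAdjoint T ∧ T * S * T = 1 ∧ T * T ≤ 1 ∧ Commute T S := by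
  have hS0 : 0 ≤ S := zero_le_one.trans hS
  have hu : IsUnit S := CStarAlgebra.isUnit_of_le (1 : A) hS isStrictlyPositive_one
  have hT0 : 0 ≤ S ^ (-(1 / 2) : ℝ) := CFC.rpow_nonneg
  have e1 : S ^ (-(1 / 2) : ℝ) * S = S ^ (1 / 2 : ℝ) := by
    conv_lhs => rw [← CFC.rpow_one S hS0]
    rw [CFC.rpow_one S hS0]
    nth_rewrite 2 [← CFC.rpow_one S hS0]
    rw [← CFC.rpow_add hu]; norm_num
  have e2 : S * S ^ (-(1 / 2) : ℝ) = S ^ (1 / 2 : ℝ) := by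
    nth_rewrite 1 [← CFC.rpow_one S hS0]
    rw [← CFC.rpow_add hu]; norm_num
  refine ⟨S ^ (-(1 / 2) : ℝ), hT0.isSelfAdjoint, ?_, ?_, ?_⟩
  · rw [e1, ← CFC.rpow_add hu]
    norm_num
    exact CFC.rpow_zero S hS0
  · rw [← CFC.rpow_add hu]
    norm_num
    exact CStarAlgebra.rpow_neg_one_le_one hS
  · rw [commute_iff_eq, e1, e2]

end SquareSums

section TraceFree
variable {A : Type*} [CStarAlgebra A] [PartialOrder A] [StarOrderedRing A]

/-- The values `γ(∑ z z*)` over finite families with `x ≤ ∑ z* z`. -/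
def traceGaugeSet (γ : A → ℝ) (x : A) : Set ℝ := {t | ∃ l : List A, x ≤ sqL l ∧ t = γ (sqR l)}

/-- The largest unitarily invariant sublinear minorant of `γ`. -/
def traceGauge (γ : A → ℝ) (x : A) : ℝ := sInf (traceGaugeSet γ x)

variable {γ : A → ℝ}

theorem exists_sqrt_of_nonneg {x : A} (hx : 0 ≤ x) : ∃ s : A, IsSelfAdjoint s ∧ s * s = x :=
  ⟨CFC.sqrt x, (CFC.sqrt_nonneg x).isSelfAdjoint, CFC.sqrt_mul_sqrt_self x hx⟩

theorem traceGauge_le (hγ : PosFun γ) {x : A} {l : List A} (h : x ≤ sqL l) :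
    traceGauge γ x ≤ γ (sqR l) :=
  csInf_le ⟨0, by rintro _ ⟨l, _, rfl⟩; exact hγ.nonneg (sqR_nonneg l)⟩ ⟨l, h, rfl⟩

theorem traceGauge_le_of_nonneg (hγ : PosFun γ) {x : A} (hx : 0 ≤ x) : traceGauge γ x ≤ γ x := by
  obtain ⟨s, hs, hsx⟩ := exists_sqrt_of_nonneg hx
  have := traceGauge_le hγ (x := x) (l := [s]) (by simp [hs.star_eq, hsx])
  simpa [hs.star_eq, hsx] using this

theorem exists_list_lt {x : A} (hx : IsSelfAdjoint x) {c : ℝ} (h : traceGauge γ x < c) :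
    ∃ l : List A, x ≤ sqL l ∧ γ (sqR l) < c := by
  have hne : (traceGaugeSet γ x).Nonempty := by
    obtain ⟨s, hs, hsx⟩ := exists_sqrt_of_nonneg (A := A) (x := algebraMap ℝ A ‖x‖)
      (algebraMap_nonneg A (norm_nonneg x))
    refine ⟨_, [s], ?_, rfl⟩
    simpa [hs.star_eq, hsx] using hx.le_algebraMap_norm_self
  obtain ⟨_, ⟨l, hl, rfl⟩, h2⟩ := exists_lt_of_csInf_lt hne h
  exact ⟨l, hl, h2⟩

theorem le_traceGauge {x : A} (hx : IsSelfAdjoint x) {c : ℝ}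
    (h : ∀ l : List A, x ≤ sqL l → c ≤ γ (sqR l)) : c ≤ traceGauge γ x := by
  by_contra! hc
  obtain ⟨l, hl, h2⟩ := exists_list_lt hx hc
  exact absurd (h l hl) (not_le.mpr h2)

theorem traceGauge_add_le (hγ : PosFun γ) {x y : A} (hx : IsSelfAdjoint x) (hy : IsSelfAdjoint y) :
    traceGauge γ (x + y) ≤ traceGauge γ x + traceGauge γ y := by
  refine le_of_forall_pos_le_add fun ε hε => ?_
  obtain ⟨l, hl, h1⟩ := exists_list_lt (γ := γ) hx (c := traceGauge γ x + ε / 2) (by linarith)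
  obtain ⟨l', hl', h2⟩ := exists_list_lt (γ := γ) hy (c := traceGauge γ y + ε / 2) (by linarith)
  have := traceGauge_le hγ (x := x + y) (l := l ++ l') (by rw [sqL_append]; exact add_le_add hl hl')
  rw [sqR_append, hγ.map_add] at this
  linarith

theorem traceGauge_smul_le (hγ : PosFun γ) {x : A} (hx : IsSelfAdjoint x) {c : ℝ} (hc : 0 < c) :
    traceGauge γ (c • x) ≤ c * traceGauge γ x := by
  rw [← div_le_iff₀' hc]
  refine le_traceGauge hx fun l hl => ?_
  rw [div_le_iff₀' hc]
  have e : ((Real.sqrt c : ℝ) • (1 : A)) * star ((Real.sqrt c : ℝ) • (1 : A)) = c • 1 := by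
    simp [smul_smul, Real.mul_self_sqrt hc.le]
  have e' : star ((Real.sqrt c : ℝ) • (1 : A)) = (Real.sqrt c : ℝ) • (1 : A) := by simp
  have := traceGauge_le hγ (x := c • x) (l := l.map fun z => ((Real.sqrt c : ℝ) • (1 : A)) * z) (by
    have : sqL (l.map fun z => ((Real.sqrt c : ℝ) • (1 : A)) * z) = c • sqL l := by
      clear hl
      induction l with
      | nil => simp
      | cons z l ih =>
        simp only [List.map_cons, sqL_cons, ih, smul_add]
        simp [smul_smul, Real.mul_self_sqrt hc.le]
    rw [this]
    exact smul_le_smul_of_nonneg_left hl hc.le)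
  rw [sqR_map_mul_left, e'] at this
  simpa [smul_smul, Real.mul_self_sqrt hc.le, hγ.map_smul] using this

theorem traceGauge_smul (hγ : PosFun γ) {x : A} (hx : IsSelfAdjoint x) {c : ℝ} (hc : 0 < c) :
    traceGauge γ (c • x) = c * traceGauge γ x := by
  refine le_antisymm (traceGauge_smul_le hγ hx hc) ?_
  have := traceGauge_smul_le hγ (x := c • x) (IsSelfAdjoint.smul (IsSelfAdjoint.all _) hx)
    (inv_pos.mpr hc)
  rw [smul_smul, inv_mul_cancel₀ hc.ne', one_smul] at this
  rwa [← inv_mul_le_iff₀ (inv_pos.mpr hc), inv_inv] at this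

theorem traceGauge_neg (hγ : PosFun γ) {x : A} (hx : x ≤ 0) : traceGauge γ x ≤ 0 := by
  have := traceGauge_le hγ (x := x) (l := []) (by simpa using hx)
  simpa [hγ.map_zero] using this

theorem traceGauge_conj_le (hγ : PosFun γ) {x : A} (hx : IsSelfAdjoint x) (u : unitary A) :
    traceGauge γ ((u : A) * x * star (u : A)) ≤ traceGauge γ x := by
  refine le_traceGauge hx fun l hl => ?_
  have := traceGauge_le hγ (x := (u : A) * x * star (u : A)) (l := l.map fun z => z * star (u : A))
    (by rw [sqL_map_mul_right, star_star]; exact star_right_conjugate_le_conjugate hl _)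
  rw [sqR_map_mul_right] at this
  simpa [sqR] using this

theorem traceGauge_conj (hγ : PosFun γ) {x : A} (hx : IsSelfAdjoint x) (u : unitary A) :
    traceGauge γ ((u : A) * x * star (u : A)) = traceGauge γ x := by
  refine le_antisymm (traceGauge_conj_le hγ hx u) ?_
  have := traceGauge_conj_le hγ (x := (u : A) * x * star (u : A)) (hx.conjugate _) (star u)
  have e : (star u : A) * ((u : A) * x * star (u : A)) * star (star u : A) = x := by
    simp only [star_star, mul_assoc, Unitary.coe_star_mul_self, mul_one]
    rw [← mul_assoc]; simp
  rw [Unitary.coe_star, e] at this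
  exact this

theorem traceGauge_add_one_sub_le (hγ : PosFun γ) {x : A} (hx0 : 0 ≤ x) (hx1 : x ≤ 1) :
    traceGauge γ x + traceGauge γ (1 - x) ≤ traceGauge γ 1 := by
  refine le_traceGauge (IsSelfAdjoint.one A) fun l hl => ?_
  obtain ⟨T, hT, h1, h2, -⟩ := exists_inv_sqrt hl
  have key : ∀ y : A, 0 ≤ y →
      traceGauge γ y ≤ γ (l.map fun z => z * (T * y * T) * star z).sum := by
    intro y hy
    obtain ⟨s, hs, rfl⟩ := exists_sqrt_of_nonneg hy
    have := traceGauge_le hγ (x := s * s) (l := l.map fun z => z * (T * s)) (by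
      rw [sqL_map_mul_right, star_mul, hs.star_eq, hT.star_eq]
      have : s * T * sqL l * (T * s) = s * (T * sqL l * T) * s := by simp only [mul_assoc]
      rw [this, h1, mul_one])
    rw [sqR_map_mul_right, star_mul, hs.star_eq, hT.star_eq] at this
    simpa only [mul_assoc] using this
  have k1 := key x hx0
  have k2 := key (1 - x) (sub_nonneg.mpr hx1)
  have e : (l.map fun z => z * (T * x * T) * star z).sum
      + (l.map fun z => z * (T * (1 - x) * T) * star z).sum
      = (l.map fun z => z * (T * T) * star z).sum := by
    rw [← List.sum_map_add]
    congr 1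
    refine List.map_congr_left fun z _ => ?_
    noncomm_ring
  have h3 := hγ.mono (list_conj_mono l h2)
  rw [← e, hγ.map_add] at h3
  simp only [mul_one] at h3
  have : (l.map fun z => z * star z).sum = sqR l := rfl
  rw [this] at h3
  linarith

/-- If `γ` dominates no nonzero trace, some partition `∑ x* x = 1` makes `γ(∑ x x*)` small. -/
theorem exists_list_of_no_trace (hγ : PosFun γ)
    (h : ∀ τ : A → ℝ, PosFun τ → (∀ x y, τ (x * y) = τ (y * x)) → FunLE τ γ → τ = 0)
    {ε : ℝ} (hε : 0 < ε) : ∃ l : List A, sqL l = 1 ∧ γ (sqR l) ≤ ε := by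
  obtain ⟨F, hF, hFle, hF1⟩ := exists_posFun_le (traceGauge γ)
    (fun x y hx hy => traceGauge_add_le hγ hx hy) (fun c x hc hx => traceGauge_smul hγ hx hc)
    (fun x hx => traceGauge_neg hγ hx) 1 (IsSelfAdjoint.one A)
  have heq : ∀ x : A, 0 ≤ x → x ≤ 1 → F x = traceGauge γ x := by
    intro x h0 h1
    have a1 := hFle x h0.isSelfAdjoint
    have a2 := hFle (1 - x) (sub_nonneg.mpr h1).isSelfAdjoint
    have a3 := traceGauge_add_one_sub_le hγ h0 h1
    rw [hF.map_sub, hF1] at a2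
    linarith
  have inv1 : ∀ (u : unitary A) (x : A), 0 ≤ x → x ≤ 1 → F ((u : A) * x * star (u : A)) = F x := by
    intro u x h0 h1
    rw [heq x h0 h1, heq _ (star_right_conjugate_nonneg h0 _), traceGauge_conj hγ h0.isSelfAdjoint]
    simpa using star_right_conjugate_le_conjugate h1 (u : A)
  have inv2 : ∀ (u : unitary A) (x : A), 0 ≤ x → F ((u : A) * x * star (u : A)) = F x := by
    intro u x h0
    have hn : 0 < ‖x‖ + 1 := by positivity
    have := inv1 u ((‖x‖ + 1)⁻¹ • x) (smul_nonneg (by positivity) h0) (by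
      have h2 : x ≤ (‖x‖ + 1) • (1 : A) := by
        refine (h0.isSelfAdjoint.le_algebraMap_norm_self).trans ?_
        rw [Algebra.algebraMap_eq_smul_one]
        exact smul_le_smul_of_nonneg_right (by linarith) zero_le_one
      have h3 := smul_le_smul_of_nonneg_left h2 (inv_nonneg.mpr hn.le)
      rwa [smul_smul, inv_mul_cancel₀ hn.ne', one_smul] at h3)
    rw [mul_smul_comm, smul_mul_assoc, hF.map_smul, hF.map_smul] at this
    exact mul_left_cancel₀ (inv_pos.mpr hn).ne' this
  have inv3 : ∀ (u : unitary A) (x : A), IsSelfAdjoint x →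
      F ((u : A) * x * star (u : A)) = F x := by
    intro u x hx
    have := inv2 u (x + algebraMap ℝ A ‖x‖) (by
      have := hx.neg_algebraMap_norm_le_self
      rwa [neg_le_iff_add_nonneg] at this)
    rw [Algebra.algebraMap_eq_smul_one, mul_add, add_mul, hF.map_add, hF.map_add] at this
    simpa using this
  have inv : UInvariant (imGroup (StarAlgHom.id ℂ A)) F := by
    intro u _
    ext X
    have e1 : ∀ X, F X = F ((2⁻¹ : ℝ) • (X + star X)) := by
      intro X
      rw [hF.map_smul, hF.map_add, hF.map_star]; ring
    rw [uact_apply, e1, e1 X, ← inv3 u ((2⁻¹ : ℝ) • (X + star X))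
      (IsSelfAdjoint.smul (IsSelfAdjoint.all _) (IsSelfAdjoint.add_star_self X))]
    congr 1
    simp only [star_mul, star_star, mul_smul_comm, smul_mul_assoc, mul_add, add_mul, mul_assoc]
  have hF0 : F = 0 := h F hF (fun x y => inv.comm hF x y) fun X =>
    (hFle _ (IsSelfAdjoint.star_mul_self X)).trans
      (traceGauge_le_of_nonneg hγ (star_mul_self_nonneg X))
  have hQ : traceGauge γ 1 < ε := by rw [← hF1, hF0]; exact hε
  obtain ⟨l, hl, h1⟩ := exists_list_lt (IsSelfAdjoint.one A) hQ
  obtain ⟨T, hT, h2, h3, -⟩ := exists_inv_sqrt hl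
  refine ⟨l.map fun z => z * T, ?_, ?_⟩
  · rw [sqL_map_mul_right, hT.star_eq, h2]
  · rw [sqR_map_mul_right, hT.star_eq]
    have := hγ.mono (list_conj_mono l h3)
    simp only [mul_one] at this
    exact this.trans h1.le

end TraceFree

section States
variable {A : Type*} [CStarAlgebra A]

/-- The complexification of a real functional. -/
def PosFun.toComplex {F : A → ℝ} (hF : PosFun F) : A →ₗ[ℂ] ℂ where
  toFun x := ⟨F x, -F (Complex.I • x)⟩
  map_add' x y := by
    apply Complex.ext <;> simp [hF.map_add]; ring
  map_smul' z x := by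
    have h : ∀ y : A, F (z • y) = z.re * F y + z.im * F (Complex.I • y) := by
      intro y
      have : z • y = z.re • y + z.im • (Complex.I • y) := by
        conv_lhs => rw [← Complex.re_add_im z]
        rw [add_smul, mul_smul, Complex.coe_smul, Complex.coe_smul]
      rw [this, hF.map_add, hF.map_smul, hF.map_smul]
    have h2 : F (Complex.I • (Complex.I • x)) = -F x := by
      rw [smul_smul, Complex.I_mul_I, neg_one_smul, hF.map_neg]
    apply Complex.ext
    · simp [h]
    · have : Complex.I • z • x = z • Complex.I • x := smul_comm _ _ _
      simp only [this, h, h2, RingHom.id_apply, smul_eq_mul, Complex.mul_im]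
      ring

theorem PosFun.norm_toComplex_le {F : A → ℝ} (hF : PosFun F) (x : A) :
    ‖hF.toComplex x‖ ≤ F 1 * ‖x‖ := by
  set w := hF.toComplex x
  by_cases hw : w = 0
  · rw [hw, norm_zero]; exact mul_nonneg hF.one_nonneg (norm_nonneg x)
  set z : ℂ := (starRingEnd ℂ w) / ‖w‖
  have hn : (‖w‖ : ℂ) ≠ 0 := by simpa using hw
  have hz : ‖z‖ = 1 := by
    simp only [z, norm_div, RCLike.norm_conj, Complex.norm_real, norm_norm]
    exact div_self (by simpa using hw)
  have h1 : hF.toComplex (z • x) = ‖w‖ := by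
    rw [_root_.map_smul, smul_eq_mul]
    show z * w = _
    simp only [z]
    rw [div_mul_eq_mul_div, mul_comm, Complex.mul_conj, Complex.normSq_eq_norm_sq, div_eq_iff hn]
    push_cast; ring
  have h2 : F (z • x) = ‖w‖ := by
    have : (hF.toComplex (z • x)).re = F (z • x) := rfl
    rw [← this, h1]; simp
  rw [← h2]
  refine (hF.le_norm _).trans ?_
  rw [norm_smul, hz, one_mul]

/-- A normalized positive functional is the real part of a state. -/
theorem PosFun.exists_state {F : A → ℝ} (hF : PosFun F) (h1 : F 1 = 1) :
    ∃ ρ : A →L[ℂ] ℂ, IsState ρ ∧ ∀ x, ρ x = ⟨F x, -F (Complex.I • x)⟩ := by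
  let ρ : A →L[ℂ] ℂ := hF.toComplex.mkContinuous 1 fun x => by
    have := hF.norm_toComplex_le x; rwa [h1] at this
  have hsa : ∀ y : A, IsSelfAdjoint y → F (Complex.I • y) = 0 := by
    intro y hy
    have := hF.map_star (Complex.I • y)
    rw [star_smul, hy.star_eq] at this
    simp only [RCLike.star_def, Complex.conj_I, neg_smul, hF.map_neg] at this
    linarith
  refine ⟨ρ, ⟨le_antisymm ?_ ?_, fun a => ?_⟩, fun x => rfl⟩
  · exact LinearMap.mkContinuous_norm_le _ zero_le_one _
  · have h2 : ρ 1 = 1 := by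
      show (⟨F 1, -F (Complex.I • 1)⟩ : ℂ) = 1
      rw [h1, hsa 1 (IsSelfAdjoint.one A)]; simp [Complex.ext_iff]
    have hnt : Nontrivial A := by
      refine ⟨⟨1, 0, fun h => ?_⟩⟩
      rw [h, _root_.map_zero] at h2; exact zero_ne_one h2
    have := ρ.le_opNorm 1
    rw [h2] at this
    simpa using this
  · show (0 : ℂ) ≤ ⟨F (star a * a), -F (Complex.I • (star a * a))⟩
    rw [hsa _ (IsSelfAdjoint.star_mul_self a), Complex.le_def]
    exact ⟨hF.nonneg' a, by simp⟩

/-- A normalized tracial positive functional is the real part of a tracial state. -/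
theorem PosFun.exists_tracialState {F : A → ℝ} (hF : PosFun F) (h1 : F 1 = 1)
    (ht : ∀ x y, F (x * y) = F (y * x)) :
    ∃ τ : A →L[ℂ] ℂ, IsTracialState τ ∧ ∀ x, τ x = ⟨F x, -F (Complex.I • x)⟩ := by
  obtain ⟨ρ, hρ, h⟩ := hF.exists_state h1
  refine ⟨ρ, ⟨hρ.1, hρ.2, fun a b => ?_⟩, h⟩
  rw [h, h, ht a b, ← smul_mul_assoc, ht (Complex.I • a) b, mul_smul_comm]

theorem IsState.star_apply {ρ : A →L[ℂ] ℂ} (hρ : IsState ρ) (x : A) :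
    ρ (star x) = star (ρ x) := by
  have hsa : ∀ y : A, IsSelfAdjoint y → (ρ y).im = 0 := by
    intro y hy
    have e : y = (4⁻¹ : ℂ) • (star (y + 1) * (y + 1)) - (4⁻¹ : ℂ) • (star (y - 1) * (y - 1)) := by
      simp only [star_add, star_sub, hy.star_eq, star_one, mul_add, add_mul, mul_sub, sub_mul,
        mul_one, one_mul]
      module
    have h1 := (Complex.le_def.mp (hρ.2 (y + 1))).2
    have h2 := (Complex.le_def.mp (hρ.2 (y - 1))).2
    have e4 : (4⁻¹ : ℂ) = ((4⁻¹ : ℝ) : ℂ) := by norm_num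
    rw [e, map_sub, map_smul, map_smul, e4]
    simp only [smul_eq_mul, Complex.sub_im, Complex.im_ofReal_mul]
    simp only [Complex.zero_im] at h1 h2
    rw [← h1, ← h2]; ring
  have h1 := hsa _ (realPart x).2
  have h2 := hsa _ (imaginaryPart x).2
  have hx := realPart_add_I_smul_imaginaryPart x
  have hsx : star x = (realPart x : A) - Complex.I • (imaginaryPart x : A) := by
    conv_lhs => rw [← hx]
    rw [star_add, star_smul, (realPart x).2.star_eq, (imaginaryPart x).2.star_eq]
    simp [sub_eq_add_neg]
  rw [hsx]
  conv_rhs => rw [← hx]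
  simp only [map_sub, map_add, map_smul, smul_eq_mul]
  apply Complex.ext <;> simp [h1, h2]

theorem IsState.posFun {ρ : A →L[ℂ] ℂ} (hρ : IsState ρ) : PosFun (fun x => (ρ x).re) where
  map_add X Y := by simp
  map_smul r X := by
    have : ρ (r • X) = r * ρ X := by
      rw [← Complex.coe_smul, map_smul, smul_eq_mul]
    rw [this]; simp
  nonneg' X := (Complex.le_def.mp (hρ.2 X)).1
  map_star X := by rw [hρ.star_apply]; simp

theorem eq_re_sub_re_I_smul (ρ : A →L[ℂ] ℂ) (x : A) :
    ρ x = ⟨(ρ x).re, -(ρ (Complex.I • x)).re⟩ := by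
  apply Complex.ext <;> simp

theorem IsState.apply_one {ρ : A →L[ℂ] ℂ} (hρ : IsState ρ) : ρ 1 = 1 := by
  have him : (ρ 1).im = 0 := by
    have := hρ.star_apply 1
    rw [star_one] at this
    have := congrArg Complex.im this
    simp at this
    linarith
  have h0 : 0 ≤ (ρ 1).re := hρ.posFun.one_nonneg
  have hle : ‖ρ‖ ≤ (ρ 1).re := by
    refine ρ.opNorm_le_bound h0 fun x => ?_
    have := hρ.posFun.norm_toComplex_le x
    have e : hρ.posFun.toComplex x = ρ x := (eq_re_sub_re_I_smul ρ x).symm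
    rwa [e] at this
  have hge : (ρ 1).re ≤ 1 := by
    have h2 := ρ.le_opNorm 1
    rw [hρ.1, one_mul] at h2
    have h3 : ‖(1 : A)‖ ≤ 1 := by
      rcases subsingleton_or_nontrivial A with h | h
      · rw [Subsingleton.elim (1 : A) 0, norm_zero]; exact zero_le_one
      · rw [CStarRing.norm_one]
    exact ((le_abs_self _).trans (Complex.abs_re_le_norm _)).trans (h2.trans h3)
  rw [hρ.1] at hle
  apply Complex.ext
  · simp; linarith
  · simpa using him

end States

section TraceLemma
variable {A : Type*} [CStarAlgebra A] {B : Type*} [CStarAlgebra B]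

/-- `e` is the off-diagonal matrix unit of a copy of `M₂` commuting with the image of `φ`. -/
structure IsMatUnit (φ : A →⋆ₐ[ℂ] B) (e : B) : Prop where
  sq : e * e = 0
  one : e * star e + star e * e = 1
  comm : ∀ x, φ x * e = e * φ x

/-- The self-adjoint dilation of `y`. -/
def hat (φ : A →⋆ₐ[ℂ] B) (e : B) (y : A) : B := e * φ y + star e * φ (star y)

variable {φ : A →⋆ₐ[ℂ] B} {e : B}

theorem IsMatUnit.comm' (he : IsMatUnit φ e) (x : A) : φ x * star e = star e * φ x := by
  have := congrArg star (he.comm (star x))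
  simpa [StarHomClass.map_star] using this.symm

theorem IsMatUnit.sq' (he : IsMatUnit φ e) : star e * star e = 0 := by
  rw [← star_mul, he.sq, star_zero]

theorem hat_add (φ : A →⋆ₐ[ℂ] B) (e : B) (x y : A) : hat φ e (x + y) = hat φ e x + hat φ e y := by
  simp only [hat, map_add, star_add, mul_add]; abel

theorem hat_neg (φ : A →⋆ₐ[ℂ] B) (e : B) (x : A) : hat φ e (-x) = -hat φ e x := by
  simp only [hat, map_neg, star_neg, mul_neg]; abel

theorem hat_sub (φ : A →⋆ₐ[ℂ] B) (e : B) (x y : A) : hat φ e (x - y) = hat φ e x - hat φ e y := by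
  rw [sub_eq_add_neg, hat_add, hat_neg, sub_eq_add_neg]

theorem hat_smul_real (φ : A →⋆ₐ[ℂ] B) (e : B) (r : ℝ) (x : A) :
    hat φ e (r • x) = r • hat φ e x := by
  simp only [hat, ← Complex.coe_smul, map_smul, star_smul, mul_smul_comm, smul_add]
  simp

theorem IsMatUnit.isSelfAdjoint_hat (he : IsMatUnit φ e) (y : A) : IsSelfAdjoint (hat φ e y) := by
  rw [IsSelfAdjoint, hat]
  simp only [star_add, star_mul, ← StarHomClass.map_star, star_star, he.comm, he.comm']
  abel

theorem IsMatUnit.hat_conj (he : IsMatUnit φ e) (w y : A) :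
    φ w * hat φ e y * star (φ w) = hat φ e (w * y * star w) := by
  simp only [hat, mul_add, add_mul, star_mul, star_star, map_mul, ← StarHomClass.map_star]
  simp only [← mul_assoc, he.comm', he.comm]

/-- The convex set of normalized functionals invariant under the image group. -/
def centralStates (φ : A →⋆ₐ[ℂ] B) : Set (B → ℝ) :=
  {f | PosFun f ∧ UInvariant (imGroup φ) f ∧ f 1 = 1}

theorem isClosed_uInvariant (G : Subgroup (unitary B)) : IsClosed {f : B → ℝ | UInvariant G f} := by
  simp only [UInvariant, Set.ofPred_forall]
  exact isClosed_iInter fun u => isClosed_iInter fun _ =>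
    isClosed_eq (continuous_uact u) continuous_id

theorem isCompact_centralStates : IsCompact (centralStates φ) := by
  refine PosFun.isCompact_of_isClosed ?_ 1 fun F hF => ⟨hF.1, hF.2.2.le⟩
  exact PosFun.isClosed_setOf.inter ((isClosed_uInvariant _).inter
    (isClosed_eq (continuous_apply _) continuous_const))

theorem UInvariant.smul {G : Subgroup (unitary B)} {f : B → ℝ} (hf : UInvariant G f)
    (c : ℝ) : UInvariant G (c • f) := fun u hu => by
  rw [uact_smul, hf u hu]

theorem UInvariant.sub {G : Subgroup (unitary B)} {f g : B → ℝ} (hf : UInvariant G f)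
    (hg : UInvariant G g) : UInvariant G (f - g) := fun u hu => by
  show uact u f - uact u g = f - g
  rw [hf u hu, hg u hu]

/-- Elements commuting with the image of `φ`. -/
def IsComm (φ : A →⋆ₐ[ℂ] B) (w : B) : Prop := ∀ x, φ x * w = w * φ x

theorem IsComm.uact_apply {w : B} (hw : IsComm φ w) {u : unitary B} (hu : u ∈ imGroup φ)
    (F : B → ℝ) : uact u F w = F w := by
  obtain ⟨v, -, hv⟩ := exists_of_mem_imGroup hu
  rw [_root_.uact_apply, hv, hw, mul_assoc, ← hv]; simp

theorem extremal_mul_aux {f : B → ℝ} (hf : f ∈ centralStates φ)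
    (hext : ∀ g ∈ centralStates φ, ∀ h ∈ centralStates φ, f ∈ openSegment ℝ g h → g = f)
    {F : B → ℝ} (hF : PosFun F) (hFi : UInvariant (imGroup φ) F) (hle : FunLE F f) :
    F = F 1 • f := by
  obtain ⟨hf0, hf1, hf2⟩ := hf
  have hD := hle.posFun_sub hF hf0
  have hDi := hf1.sub hFi
  have ht0 := hF.one_nonneg
  have ht1 := hD.one_nonneg
  have hDone : (f - F) 1 = 1 - F 1 := by simp [hf2]
  rw [hDone] at ht1
  rcases ht0.eq_or_lt with h0 | h0
  · rw [← h0, zero_smul, hF.eq_zero h0.symm]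
  rcases ht1.eq_or_lt with h1 | h1
  · have := hD.eq_zero (by rw [hDone, ← h1])
    have h2 : F 1 = 1 := by linarith
    rw [h2, one_smul]
    exact (sub_eq_zero.mp this).symm
  have := hext ((F 1)⁻¹ • F) ⟨hF.smul (by positivity), hFi.smul _, by
      simp [inv_mul_cancel₀ h0.ne']⟩ ((1 - F 1)⁻¹ • (f - F))
    ⟨hD.smul (by positivity), hDi.smul _, by
      rw [Pi.smul_apply, hDone, smul_eq_mul, inv_mul_cancel₀ h1.ne']⟩
    ⟨F 1, 1 - F 1, h0, h1, by ring, by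
      rw [smul_smul, smul_smul, mul_inv_cancel₀ h0.ne', mul_inv_cancel₀ h1.ne']; simp⟩
  rw [← this, smul_smul, mul_inv_cancel₀ h0.ne', one_smul]

theorem extremal_mul {f : B → ℝ} (hf : f ∈ centralStates φ)
    (hext : ∀ g ∈ centralStates φ, ∀ h ∈ centralStates φ, f ∈ openSegment ℝ g h → g = f)
    {x : A} (hx : IsSelfAdjoint x) {w : B} (hw : IsComm φ w) : f (φ x * w) = f (φ x) * f w := by
  let _ := CStarAlgebra.spectralOrder A
  have _ := CStarAlgebra.spectralOrderedRing A
  obtain ⟨hf0, hf1, hf2⟩ := id hf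
  have unit : ∀ x : A, 0 ≤ x → x ≤ 1 → f (φ x * w) = f (φ x) * f w := by
    intro x h0 h1
    obtain ⟨s, hs, hsx⟩ := exists_sqrt_of_nonneg h0
    obtain ⟨s', hs', hsx'⟩ := exists_sqrt_of_nonneg (sub_nonneg.mpr h1)
    have central : ∀ s : A, ∀ X, f (φ s * X * φ s) = f (X * φ (s * s)) := by
      intro s X
      rw [mul_assoc, hf1.comm hf0, mul_assoc, ← map_mul]
    have hsφ : star (φ s) = φ s := by rw [← StarHomClass.map_star, hs.star_eq]
    have hsφ' : star (φ s') = φ s' := by rw [← StarHomClass.map_star, hs'.star_eq]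
    let S : Set (B → ℝ) := {F | PosFun F ∧ FunLE F f ∧ ∀ v, IsComm φ v → F v = f (φ x * v)}
    have hne : S.Nonempty := by
      refine ⟨fun X => f (φ s * X * φ s), ?_, ?_, ?_⟩
      · have := hf0.conj (φ s); rwa [hsφ] at this
      · intro X
        show f (φ s * (star X * X) * φ s) ≤ _
        have := (hf0.conj (φ s')).nonneg' X
        simp only [hsφ'] at this
        rw [central, hsx', map_sub, map_one, mul_sub, mul_one, hf0.map_sub] at this
        rw [central, hsx]
        linarith
      · intro v hv
        show f (φ s * v * φ s) = _
        rw [central, hsx, hv]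
    have hcl : IsClosed S := by
      have h3 : IsClosed {F : B → ℝ | ∀ v, IsComm φ v → F v = f (φ x * v)} := by
        simp only [Set.ofPred_forall]
        exact isClosed_iInter fun v => isClosed_iInter fun _ =>
          isClosed_eq (continuous_apply _) continuous_const
      exact PosFun.isClosed_setOf.inter ((isClosed_funLE f).inter h3)
    have hcomp : IsCompact S := PosFun.isCompact_of_isClosed hcl (f 1)
      fun F hF => ⟨hF.1, hF.2.1.one⟩
    have hconv : Convex ℝ S := by
      rintro F ⟨a1, a2, a3⟩ F' ⟨b1, b2, b3⟩ p q hp hq hpq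
      refine ⟨(a1.smul hp).add (b1.smul hq), fun X => ?_, fun v hv => ?_⟩
      · have := a2 X
        have := b2 X
        simp only [Pi.add_apply, Pi.smul_apply, smul_eq_mul]
        calc _ ≤ p * f (star X * X) + q * f (star X * X) := by gcongr
          _ = _ := by rw [← add_mul, hpq, one_mul]
      · simp only [Pi.add_apply, Pi.smul_apply, smul_eq_mul, a3 v hv, b3 v hv]
        rw [← add_mul, hpq, one_mul]
    have hst : UStable (imGroup φ) S := by
      rintro u hu F ⟨a1, a2, a3⟩
      refine ⟨a1.uact u, ?_, fun v hv => ?_⟩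
      · have := a2.uact u; rwa [hf1 u hu] at this
      · rw [hv.uact_apply hu, a3 v hv]
    obtain ⟨F, ⟨a1, a2, a3⟩, hFi⟩ := exists_uInvariant_mem hf0 hf1 hne hcomp hconv hst
      fun F hF => ⟨hF.1, hF.2.1⟩
    have hF := extremal_mul_aux hf hext a1 hFi a2
    have h1' : F 1 = f (φ x) := by
      rw [a3 1 (fun x => by simp), mul_one]
    rw [← a3 w hw, hF, ← h1']
    rfl
  have pos : ∀ x : A, 0 ≤ x → f (φ x * w) = f (φ x) * f w := by
    intro x h0
    have hn : 0 < ‖x‖ + 1 := by positivity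
    have := unit ((‖x‖ + 1)⁻¹ • x) (smul_nonneg (by positivity) h0) (by
      have h2 : x ≤ (‖x‖ + 1) • (1 : A) := by
        refine (h0.isSelfAdjoint.le_algebraMap_norm_self).trans ?_
        rw [Algebra.algebraMap_eq_smul_one]
        exact smul_le_smul_of_nonneg_right (by linarith) zero_le_one
      have h3 := smul_le_smul_of_nonneg_left h2 (inv_nonneg.mpr hn.le)
      rwa [smul_smul, inv_mul_cancel₀ hn.ne', one_smul] at h3)
    rw [← Complex.coe_smul, map_smul, Complex.coe_smul, smul_mul_assoc, hf0.map_smul,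
      hf0.map_smul, mul_assoc] at this
    exact mul_left_cancel₀ (inv_pos.mpr hn).ne' this
  have h1 := pos (x + algebraMap ℝ A ‖x‖) (by
      have := hx.neg_algebraMap_norm_le_self
      rwa [neg_le_iff_add_nonneg] at this)
  rw [Algebra.algebraMap_eq_smul_one, ← Complex.coe_smul, map_add, map_smul, Complex.coe_smul,
    map_one, add_mul, hf0.map_add, hf0.map_add, smul_mul_assoc, hf0.map_smul, hf0.map_smul,
    hf2, one_mul] at h1
  linarith

end TraceLemma

section TraceLemma
variable {A : Type*} [CStarAlgebra A] {B : Type*} [CStarAlgebra B] {φ : A →⋆ₐ[ℂ] B} {e : B}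

theorem extremal_hat_ge (he : IsMatUnit φ e) {r : ℝ} {c : A}
    (h : ∀ τ : A →L[ℂ] ℂ, IsTracialState τ → ‖τ c‖ ≤ r) {f : B → ℝ} (hf : f ∈ centralStates φ)
    (hext : ∀ g ∈ centralStates φ, ∀ h ∈ centralStates φ, f ∈ openSegment ℝ g h → g = f) :
    -r ≤ f (hat φ e c) := by
  obtain ⟨hf0, hf1, hf2⟩ := id hf
  set m₁ : B := e + star e
  set m₂ : B := Complex.I • (e - star e)
  have hm₁ : IsComm φ m₁ := fun x => by simp only [m₁, mul_add, add_mul, he.comm, he.comm']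
  have hm₂ : IsComm φ m₂ := fun x => by
    simp only [m₂, mul_sub, sub_mul, mul_smul_comm, smul_mul_assoc, he.comm, he.comm']
  set c₁ : A := (realPart c : A)
  set c₂ : A := (imaginaryPart c : A)
  have hc₁ : IsSelfAdjoint c₁ := (realPart c).2
  have hc₂ : IsSelfAdjoint c₂ := (imaginaryPart c).2
  have hc : c = c₁ + Complex.I • c₂ := (realPart_add_I_smul_imaginaryPart c).symm
  have hhat : hat φ e c = φ c₁ * m₁ + φ c₂ * m₂ := by
    rw [hm₁, hm₂, hc, hat]
    simp only [star_add, star_smul, hc₁.star_eq, hc₂.star_eq, map_add, map_smul, m₁, m₂,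
      mul_add, add_mul, sub_mul, smul_mul_assoc, mul_smul_comm, RCLike.star_def, Complex.conj_I]
    module
  have hval : f (hat φ e c) = f (φ c₁) * f m₁ + f (φ c₂) * f m₂ := by
    rw [hhat, hf0.map_add, extremal_mul hf hext hc₁ hm₁, extremal_mul hf hext hc₂ hm₂]
  set p := f m₁
  set q := f m₂
  have hpq : p ^ 2 + q ^ 2 ≤ 1 := by
    have hs₁ : star m₁ = m₁ := by simp only [m₁, star_add, star_star, add_comm]
    have hs₂ : star m₂ = m₂ := by
      simp only [m₂, star_smul, star_sub, star_star, RCLike.star_def, Complex.conj_I]; module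
    have h11 : m₁ * m₁ = 1 := by
      simp only [m₁, mul_add, add_mul, he.sq, he.sq', zero_add, add_zero]
      rw [add_comm, he.one]
    have h22 : m₂ * m₂ = 1 := by
      simp only [m₂, smul_mul_smul_comm, Complex.I_mul_I, mul_sub, sub_mul, he.sq, he.sq']
      rw [← he.one]; module
    have h12 : m₁ * m₂ + m₂ * m₁ = 0 := by
      simp only [m₁, m₂, smul_mul_assoc, mul_smul_comm, mul_add, add_mul, mul_sub, sub_mul,
        he.sq, he.sq']
      module
    have hsq : star (p • m₁ + q • m₂) * (p • m₁ + q • m₂) = (p ^ 2 + q ^ 2) • (1 : B) := by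
      have : star (p • m₁ + q • m₂) * (p • m₁ + q • m₂) = (p ^ 2) • (m₁ * m₁) + (q ^ 2) • (m₂ * m₂)
          + (p * q) • (m₁ * m₂ + m₂ * m₁) := by
        simp only [star_add, star_smul, star_trivial, hs₁, hs₂, mul_add, add_mul,
          smul_mul_smul_comm]
        module
      rw [this, h11, h22, h12]; module
    have hcs := hf0.cauchy_schwarz (p • m₁ + q • m₂) 1
    simp only [star_one, one_mul, mul_one] at hcs
    rw [hsq, hf0.map_smul, hf2, hf0.map_add, hf0.map_smul, hf0.map_smul] at hcs
    have e1 : (p * f m₁ + q * f m₂) = p ^ 2 + q ^ 2 := by simp only [p, q]; ring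
    rw [e1] at hcs
    by_contra! hcon
    nlinarith
  have hφ : PosFun fun x => f (φ x) := hf0.comp φ
  obtain ⟨τ, hτ, hτv⟩ := hφ.exists_tracialState (by simpa using hf2) fun x y => by
    simp only [map_mul]; exact hf1.comm hf0 x (φ y)
  have hsa : ∀ y : A, IsSelfAdjoint y → f (φ (Complex.I • y)) = 0 := by
    intro y hy
    have := hφ.map_star (Complex.I • y)
    rw [star_smul, hy.star_eq] at this
    simp only [RCLike.star_def, Complex.conj_I, neg_smul, hφ.map_neg] at this
    linarith
  have hre : (τ c).re = f (φ c₁) := by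
    rw [hτv, hc]
    simp only [map_add, hf0.map_add, hsa c₂ hc₂, add_zero]
  have him : (τ c).im = f (φ c₂) := by
    rw [hτv, hc]
    simp only [smul_add, smul_smul, Complex.I_mul_I, map_add, hf0.map_add, hsa c₁ hc₁, zero_add,
      neg_smul, one_smul, map_neg, hf0.map_neg, neg_neg]
  have hn := h τ hτ
  have hr0 : 0 ≤ r := (norm_nonneg _).trans hn
  have hsum : f (φ c₁) ^ 2 + f (φ c₂) ^ 2 ≤ r ^ 2 := by
    rw [← hre, ← him]
    have e2 : (τ c).re ^ 2 + (τ c).im ^ 2 = ‖τ c‖ ^ 2 := by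
      rw [← Complex.normSq_eq_norm_sq, Complex.normSq_apply]; ring
    rw [e2]
    exact pow_le_pow_left₀ (norm_nonneg _) hn 2
  rw [hval]
  have hcs2 : (f (φ c₁) * p + f (φ c₂) * q) ^ 2 ≤ r ^ 2 := by
    nlinarith [sq_nonneg (f (φ c₁) * q - f (φ c₂) * p), sq_nonneg p, sq_nonneg q,
      sq_nonneg (f (φ c₁)), sq_nonneg (f (φ c₂))]
  exact (abs_le.mp (abs_le_of_sq_le_sq hcs2 hr0)).1

/-- Central functionals are controlled by tracial states. -/
theorem central_hat_ge (he : IsMatUnit φ e) {r : ℝ} {c : A}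
    (h : ∀ τ : A →L[ℂ] ℂ, IsTracialState τ → ‖τ c‖ ≤ r) {f : B → ℝ} (hf : PosFun f)
    (hfi : UInvariant (imGroup φ) f) : -(r * f 1) ≤ f (hat φ e c) := by
  rcases hf.one_nonneg.eq_or_lt with h0 | h0
  · simp [hf.eq_zero h0.symm]
  have hmem : (f 1)⁻¹ • f ∈ centralStates φ :=
    ⟨hf.smul (by positivity), hfi.smul _, by simp [inv_mul_cancel₀ h0.ne']⟩
  obtain ⟨f₀, hf₀, hmin⟩ := (isCompact_centralStates (φ := φ)).exists_isMinOn ⟨_, hmem⟩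
    (continuous_apply (hat φ e c)).continuousOn
  have hcl : IsClosed {g : B → ℝ | g (hat φ e c) = f₀ (hat φ e c)} :=
    isClosed_eq (continuous_apply _) continuous_const
  have hK : IsCompact (centralStates φ ∩ {g | g (hat φ e c) = f₀ (hat φ e c)}) :=
    isCompact_centralStates.inter_right hcl
  obtain ⟨g, hg⟩ := hK.extremePoints_nonempty ⟨f₀, hf₀, rfl⟩
  obtain ⟨⟨hgC, hgv⟩, hgext⟩ := mem_extremePoints.mp hg
  have hgv' : g (hat φ e c) = f₀ (hat φ e c) := hgv
  have key : -r ≤ g (hat φ e c) := by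
    refine extremal_hat_ge he h hgC fun g₁ h₁ g₂ h₂ hseg => ?_
    obtain ⟨p, q, hp, hq, hpq, heq⟩ := id hseg
    have m₁ : f₀ (hat φ e c) ≤ g₁ (hat φ e c) := hmin h₁
    have m₂ : f₀ (hat φ e c) ≤ g₂ (hat φ e c) := hmin h₂
    have := congrFun heq (hat φ e c)
    simp only [Pi.add_apply, Pi.smul_apply, smul_eq_mul, hgv'] at this
    have v₁ : g₁ (hat φ e c) = f₀ (hat φ e c) := by
      refine le_antisymm (not_lt.mp fun hlt => ?_) m₁
      have := mul_pos hp (sub_pos.mpr hlt)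
      have := mul_nonneg hq.le (sub_nonneg.mpr m₂)
      have : p * f₀ (hat φ e c) + q * f₀ (hat φ e c) = f₀ (hat φ e c) := by
        rw [← add_mul, hpq, one_mul]
      linarith
    have v₂ : g₂ (hat φ e c) = f₀ (hat φ e c) := by
      refine le_antisymm (not_lt.mp fun hlt => ?_) m₂
      have := mul_pos hq (sub_pos.mpr hlt)
      have := mul_nonneg hp.le (sub_nonneg.mpr m₁)
      have : p * f₀ (hat φ e c) + q * f₀ (hat φ e c) = f₀ (hat φ e c) := by
        rw [← add_mul, hpq, one_mul]
      linarith
    exact (hgext g₁ ⟨h₁, v₁⟩ g₂ ⟨h₂, v₂⟩ hseg).1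
  have hle : f₀ (hat φ e c) ≤ ((f 1)⁻¹ • f) (hat φ e c) := hmin hmem
  rw [← hgv', Pi.smul_apply, smul_eq_mul] at hle
  have h3 := key.trans hle
  rw [le_inv_mul_iff₀ h0] at h3
  linarith

end TraceLemma

section HahnBanachRel
variable {B : Type*} [CStarAlgebra B] [PartialOrder B] [StarOrderedRing B]

/-- Hahn–Banach for positive functionals, with the dominating sublinear function given as the
infimum of the values allowed by a relation. -/
theorem exists_posFun_of_rel (R : B → ℝ → Prop)
    (hadd : ∀ x y s t, R x s → R y t → R (x + y) (s + t))
    (hsmul : ∀ (c : ℝ) x t, 0 < c → R x t → R (c • x) (c * t))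
    (hneg : ∀ x, x ≤ 0 → R x 0) (hne : ∀ x, IsSelfAdjoint x → ∃ t, R x t)
    (hlow : ∀ t, R 0 t → 0 ≤ t) (x₀ : B) (hx₀ : IsSelfAdjoint x₀) :
    ∃ F : B → ℝ, PosFun F ∧ (∀ x t, IsSelfAdjoint x → R x t → F x ≤ t) ∧
      ∀ c, (∀ t, R x₀ t → c ≤ t) → c ≤ F x₀ := by
  have hbdd : ∀ x, IsSelfAdjoint x → BddBelow {t | R x t} := by
    intro x hx
    obtain ⟨s, hs⟩ := hne (-x) hx.neg
    refine ⟨-s, fun t ht => ?_⟩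
    have h1 := hadd _ _ _ _ ht hs
    rw [add_neg_cancel] at h1
    have := hlow _ h1
    linarith
  have hle : ∀ c x, 0 < c → IsSelfAdjoint x → sInf {t | R (c • x) t} ≤ c * sInf {t | R x t} := by
    intro c x hc hx
    rw [← div_le_iff₀' hc]
    refine le_csInf (hne x hx) fun t ht => ?_
    rw [div_le_iff₀' hc]
    exact csInf_le (hbdd _ (IsSelfAdjoint.smul (IsSelfAdjoint.all _) hx)) (hsmul c x t hc ht)
  refine Exists.elim (exists_posFun_le (fun x => sInf {t | R x t}) ?_ ?_ ?_ x₀ hx₀) ?_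
  · intro x y hx hy
    refine le_of_forall_pos_lt_add fun ε hε => ?_
    obtain ⟨s, hs, hs'⟩ := exists_lt_of_csInf_lt (hne x hx)
      (show sInf {t | R x t} < sInf {t | R x t} + ε / 2 by linarith)
    obtain ⟨t, ht, ht'⟩ := exists_lt_of_csInf_lt (hne y hy)
      (show sInf {t | R y t} < sInf {t | R y t} + ε / 2 by linarith)
    have := csInf_le (hbdd _ (hx.add hy)) (hadd _ _ _ _ hs ht)
    linarith
  · intro c x hc hx
    refine le_antisymm (hle c x hc hx) ?_
    have := hle c⁻¹ (c • x) (inv_pos.mpr hc) (IsSelfAdjoint.smul (IsSelfAdjoint.all _) hx)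
    rw [smul_smul, inv_mul_cancel₀ hc.ne', one_smul] at this
    rwa [← inv_mul_le_iff₀ (inv_pos.mpr hc), inv_inv] at this
  · intro x hx
    exact csInf_le (hbdd x (by simpa using (IsSelfAdjoint.of_nonneg (neg_nonneg.mpr hx)).neg))
      (hneg x hx)
  · rintro F ⟨hF, h1, h2⟩
    refine ⟨F, hF, fun x t hx ht => (h1 x hx).trans (csInf_le (hbdd x hx) ht), fun c hc => ?_⟩
    rw [h2]
    exact le_csInf (hne x₀ hx₀) hc

end HahnBanachRel

section Quotient
variable {A : Type*} [CStarAlgebra A]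

/-- Real parts of the states vanishing on `M`. -/
def quotStates (M : Submodule ℂ A) : Set (A → ℝ) :=
  {F | PosFun F ∧ F 1 = 1 ∧ ∀ x ∈ M, F x = 0}

/-- The complex value at `a` of the functional with real part `F`. -/
def cval (F : A → ℝ) (a : A) : ℂ := ⟨F a, -F (Complex.I • a)⟩

theorem mem_quotNumericalRange {M : Submodule ℂ A} {a : A} {c : ℂ} :
    c ∈ quotNumericalRange M a ↔ ∃ F ∈ quotStates M, c = cval F a := by
  constructor
  · rintro ⟨ρ, hρ, hM, rfl⟩
    refine ⟨fun x => (ρ x).re, ⟨hρ.posFun, by simp [hρ.apply_one], fun x hx => by simp [hM x hx]⟩, ?_⟩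
    apply Complex.ext <;> simp [cval]
  · rintro ⟨F, ⟨hF, h1, hM⟩, rfl⟩
    obtain ⟨ρ, hρ, h⟩ := hF.exists_state h1
    refine ⟨ρ, hρ, fun x hx => ?_, (h a).symm⟩
    rw [h, hM x hx, hM _ (M.smul_mem _ hx), neg_zero]
    rfl

theorem isCompact_quotStates (M : Submodule ℂ A) : IsCompact (quotStates M) := by
  refine PosFun.isCompact_of_isClosed ?_ 1 fun F hF => ⟨hF.1, hF.2.1.le⟩
  refine PosFun.isClosed_setOf.inter ((isClosed_eq (continuous_apply _) continuous_const).inter ?_)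
  have : {F : A → ℝ | ∀ x ∈ M, F x = 0} = ⋂ x ∈ M, {F : A → ℝ | F x = 0} := by
    ext; simp
  show IsClosed {F : A → ℝ | ∀ x ∈ M, F x = 0}
  rw [this]
  exact isClosed_biInter fun x _ => isClosed_eq (continuous_apply _) continuous_const

theorem continuous_cval (a : A) : Continuous fun F : A → ℝ => cval F a := by
  have : (fun F : A → ℝ => cval F a) = fun F => ((F a : ℂ) + (-F (Complex.I • a) : ℝ) * Complex.I) := by
    ext F
    apply Complex.ext <;> simp [cval]
  rw [this]
  fun_prop

theorem PosFun.smul_complex {F : A → ℝ} (hF : PosFun F) (z : ℂ) (x : A) :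
    F (z • x) = (z * cval F x).re := by
  have : z • x = z.re • x + z.im • (Complex.I • x) := by
    rw [← Complex.coe_smul, ← Complex.coe_smul, smul_smul, ← add_smul, Complex.re_add_im]
  rw [this, hF.map_add, hF.map_smul, hF.map_smul, Complex.mul_re]
  simp [cval]

theorem PosFun.cval_smul {F : A → ℝ} (hF : PosFun F) (z : ℂ) (x : A) :
    cval F (z • x) = z * cval F x := by
  apply Complex.ext
  · exact hF.smul_complex z x
  · simp only [cval]
    rw [smul_smul, hF.smul_complex]
    simp [cval, Complex.mul_re, Complex.mul_im]

theorem PosFun.cval_sub {F : A → ℝ} (hF : PosFun F) (x y : A) :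
    cval F (x - y) = cval F x - cval F y := by
  apply Complex.ext <;> simp [cval, smul_sub, hF.map_sub]
  ring

theorem PosFun.cval_one {F : A → ℝ} (hF : PosFun F) : cval F 1 = F 1 := by
  have : F (Complex.I • (1 : A)) = 0 := by
    have := hF.map_star (Complex.I • (1 : A))
    rw [star_smul, star_one] at this
    simp only [RCLike.star_def, Complex.conj_I, neg_smul, hF.map_neg] at this
    linarith
  apply Complex.ext <;> simp [cval, this]

theorem PosFun.norm_cval_le {F : A → ℝ} (hF : PosFun F) (x : A) : ‖cval F x‖ ≤ F 1 * ‖x‖ := by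
  have h := hF.smul_complex (starRingEnd ℂ (cval F x)) x
  rw [← Complex.normSq_eq_conj_mul_self, Complex.ofReal_re, Complex.normSq_eq_norm_sq] at h
  have h2 := hF.le_norm (starRingEnd ℂ (cval F x) • x)
  rw [h, norm_smul, RCLike.norm_conj] at h2
  rcases (norm_nonneg (cval F x)).eq_or_lt with h0 | h0
  · rw [← h0]; exact mul_nonneg hF.one_nonneg (norm_nonneg _)
  · have : ‖cval F x‖ * ‖cval F x‖ ≤ ‖cval F x‖ * (F 1 * ‖x‖) := by nlinarith
    exact le_of_mul_le_mul_left this h0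

theorem IsClosedTwoSidedIdeal.eq_top_of_isUnit {M : Submodule ℂ A} (hM : IsClosedTwoSidedIdeal M)
    {m : A} (hm : m ∈ M) (hu : IsUnit m) : M = ⊤ := by
  obtain ⟨u, rfl⟩ := hu
  rw [eq_top_iff]
  intro x _
  have := (hM.2 (x * ↑u⁻¹) _ hm).1
  simpa using this

variable [PartialOrder A] [StarOrderedRing A]

/-- Functionals on the quotient: if all states killing `M` are at most `c` at `x₀`, then
`x₀ ≤ c + δ + m` for some self-adjoint `m ∈ M`. -/
theorem exists_mem_of_quotStates_le {M : Submodule ℂ A} (hM : IsClosedTwoSidedIdeal M)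
    (hMt : M ≠ ⊤) {x₀ : A} (hx₀ : IsSelfAdjoint x₀) {c : ℝ} (h : ∀ F ∈ quotStates M, F x₀ ≤ c)
    {δ : ℝ} (hδ : 0 < δ) : ∃ m ∈ M, IsSelfAdjoint m ∧ x₀ ≤ algebraMap ℝ A (c + δ) + m := by
  by_contra! hcon
  have hunit : ∀ (t : ℝ) (m : A), m ∈ M → 0 ≤ algebraMap ℝ A t + m → 0 ≤ t := by
    intro t m hm hle
    by_contra! ht
    refine hMt (hM.eq_top_of_isUnit hm ?_)
    refine CStarAlgebra.isUnit_of_le (algebraMap ℝ A (-t)) ?_ ?_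
    · rw [map_neg]; rwa [neg_le_iff_add_nonneg']
    · exact IsStrictlyPositive.iff_of_unital.mpr ⟨algebraMap_nonneg A (by linarith),
        (IsUnit.mk0 (-t) (by linarith)).map (algebraMap ℝ A)⟩
  refine Exists.elim (exists_posFun_of_rel
    (fun x t => ∃ m ∈ M, IsSelfAdjoint m ∧ x ≤ algebraMap ℝ A t + m) ?_ ?_ ?_ ?_ ?_ x₀ hx₀) ?_
  · rintro x y s t ⟨m, hm, hms, hle⟩ ⟨m', hm', hms', hle'⟩
    refine ⟨m + m', M.add_mem hm hm', hms.add hms', (add_le_add hle hle').trans ?_⟩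
    rw [map_add]; exact le_of_eq (by abel)
  · rintro d x t hd ⟨m, hm, hms, hle⟩
    refine ⟨d • m, ?_, IsSelfAdjoint.smul (IsSelfAdjoint.all _) hms, ?_⟩
    · rw [← Complex.coe_smul]; exact M.smul_mem _ hm
    · refine (smul_le_smul_of_nonneg_left hle hd.le).trans ?_
      rw [smul_add, map_mul, Algebra.smul_def]
  · exact fun x hx => ⟨0, M.zero_mem, IsSelfAdjoint.zero A, by simpa using hx⟩
  · exact fun x hx => ⟨‖x‖, 0, M.zero_mem, IsSelfAdjoint.zero A, by
      simpa using hx.le_algebraMap_norm_self⟩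
  · rintro t ⟨m, hm, -, hle⟩
    exact hunit t m hm hle
  · rintro F ⟨hF, h1, h2⟩
    have hone : F 1 = 1 := by
      refine le_antisymm (h1 1 1 (IsSelfAdjoint.one A) ⟨0, M.zero_mem, IsSelfAdjoint.zero A, by simp⟩) ?_
      have := h1 (-1) (-1) (IsSelfAdjoint.one A).neg ⟨0, M.zero_mem, IsSelfAdjoint.zero A, by simp⟩
      rw [hF.map_neg] at this
      linarith
    have hsa : ∀ m ∈ M, IsSelfAdjoint m → F m = 0 := by
      intro m hm hms
      have e1 := h1 m 0 hms ⟨m, hm, hms, by simp⟩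
      have e2 := h1 (-m) 0 hms.neg ⟨-m, M.neg_mem hm, hms.neg, by simp⟩
      rw [hF.map_neg] at e2
      linarith
    have hmem : F ∈ quotStates M := by
      refine ⟨hF, hone, fun x hx => ?_⟩
      have := hF.cauchy_schwarz x 1
      rw [hsa _ (hM.2 (star x) x hx).1 (IsSelfAdjoint.star_mul_self x)] at this
      simp only [star_one, one_mul, mul_zero] at this
      nlinarith
    have := h2 (c + δ) fun t ⟨m, hm, hms, hle⟩ => by
      by_contra! ht
      exact hcon m hm hms (hle.trans (add_le_add_left (algebraMap_mono A ht.le) m))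
    linarith [h F hmem]

theorem quotStates_nonempty {M : Submodule ℂ A} (hM : IsClosedTwoSidedIdeal M)
    (hMt : M ≠ ⊤) : (quotStates M).Nonempty := by
  by_contra hne
  obtain ⟨m, hm, hms, hle⟩ := exists_mem_of_quotStates_le hM hMt (x₀ := 1) (IsSelfAdjoint.one A)
    (c := -1) (fun F hF => absurd ⟨F, hF⟩ hne) one_pos
  refine hMt (hM.eq_top_of_isUnit hm ?_)
  refine CStarAlgebra.isUnit_of_le 1 (by simpa using hle) ?_
  exact isStrictlyPositive_one

end Quotient

section Excision
variable {A : Type*} [CStarAlgebra A]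

/-- An approximately optimal point of the numerical range that is cut out by a small slice. -/
theorem exists_slice {M : Submodule ℂ A} {F₀ : A → ℝ} (hF₀ : F₀ ∈ quotStates M) (a : A) (ω : ℂ)
    {ε : ℝ} (hε : 0 < ε) : ∃ F' ∈ quotStates M, ∃ ζ : ℂ,
      (ω * cval F₀ a).re - ε ≤ (ω * cval F' a).re ∧
      ∀ F ∈ quotStates M, (ζ * cval F' a).re - ε ^ 2 / 2 ≤ (ζ * cval F a).re →
        ‖cval F a - cval F' a‖ ≤ ε := by
  set N : ℝ := ‖a‖ ^ 2 / (2 * ε) + 1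
  have hN : 0 < N := by positivity
  obtain ⟨F', hF', hmax⟩ := (isCompact_quotStates M).exists_isMaxOn ⟨F₀, hF₀⟩
    (f := fun F => ‖cval F a + N * (starRingEnd ℂ) ω‖)
    (((continuous_cval a).add continuous_const).norm).continuousOn
  have hsq : ∀ z : ℂ, ‖z + N * (starRingEnd ℂ) ω‖ ^ 2 =
      ‖z‖ ^ 2 + 2 * N * (ω * z).re + N ^ 2 * ‖ω‖ ^ 2 := by
    intro z
    simp only [← Complex.normSq_eq_norm_sq, Complex.normSq_apply]
    simp
    ring
  have hmax' : ∀ F ∈ quotStates M, ‖cval F a + N * (starRingEnd ℂ) ω‖ ^ 2 ≤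
      ‖cval F' a + N * (starRingEnd ℂ) ω‖ ^ 2 :=
    fun F hF => pow_le_pow_left₀ (norm_nonneg _) (hmax hF) 2
  refine ⟨F', hF', (starRingEnd ℂ) (cval F' a + N * (starRingEnd ℂ) ω), ?_, fun F hF h => ?_⟩
  · have h1 := hmax' F₀ hF₀
    rw [hsq, hsq] at h1
    have h2 : ‖cval F' a‖ ^ 2 ≤ ‖a‖ ^ 2 := by
      have := hF'.1.norm_cval_le a
      rw [hF'.2.1, one_mul] at this
      exact pow_le_pow_left₀ (norm_nonneg _) this 2
    have h3 : 2 * N * ε = ‖a‖ ^ 2 + 2 * ε := by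
      simp only [N]; field_simp
    have h4 := sq_nonneg ‖cval F₀ a‖
    have h5 : 2 * N * ((ω * cval F₀ a).re - ε) ≤ 2 * N * (ω * cval F' a).re := by
      rw [mul_sub, h3]; linarith
    exact le_of_mul_le_mul_left h5 (by positivity)
  · have h1 := hmax' F hF
    refine abs_le_of_sq_le_sq' ?_ hε.le |>.2
    simp only [← Complex.normSq_eq_norm_sq, Complex.normSq_apply] at h1 ⊢
    simp at h1 h ⊢
    nlinarith

variable [PartialOrder A] [StarOrderedRing A]

theorem IsSelfAdjoint.norm_le_of_le {X : A} (hX : IsSelfAdjoint X) {c : ℝ} (hc : 0 ≤ c)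
    (h1 : X ≤ algebraMap ℝ A c) (h2 : -X ≤ algebraMap ℝ A c) : ‖X‖ ≤ c := by
  have h3 : 0 ≤ (algebraMap ℝ A c - X) * (algebraMap ℝ A c + X) := by
    refine Commute.mul_nonneg (sub_nonneg.mpr h1) (by rwa [neg_le_iff_add_nonneg] at h2) ?_
    have := Algebra.commutes (R := ℝ) c X
    simp only [Commute, SemiconjBy, mul_add, add_mul, mul_sub, sub_mul, this]
    abel
  have h4 : (algebraMap ℝ A c - X) * (algebraMap ℝ A c + X) = algebraMap ℝ A (c ^ 2) - star X * X := by
    have := Algebra.commutes (R := ℝ) c X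
    rw [hX.star_eq, mul_add, sub_mul, sub_mul, this, ← map_mul, sq]
    abel
  rw [h4] at h3
  have h5 := (CStarAlgebra.norm_le_iff_le_algebraMap (star X * X) (sq_nonneg c)
    (star_mul_self_nonneg X)).mpr (sub_nonneg.mp h3)
  rw [CStarRing.norm_star_mul_self, ← sq] at h5
  exact abs_le_of_sq_le_sq' h5 hc |>.2

/-- An element of a closed proper ideal dominated by a regularised inverse. -/
theorem exists_ideal_cutoff {M : Submodule ℂ A} (hM : IsClosedTwoSidedIdeal M) {m : A}
    (hm : m ∈ M) (hm0 : 0 ≤ m) {δ : ℝ} (hδ : 0 < δ) : ∃ r : A, IsSelfAdjoint r ∧ r - 1 ∈ M ∧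
      r * r ≤ 1 ∧ r * m * r ≤ algebraMap ℝ A δ := by
  have hS : (1 : A) ≤ 1 + δ⁻¹ • m := le_add_of_nonneg_right (smul_nonneg (by positivity) hm0)
  obtain ⟨T, hT, h1, h2, -⟩ := exists_inv_sqrt hS
  have hTT : 0 ≤ T * T := by simpa [hT.star_eq] using star_mul_self_nonneg T
  have h3 : T * T + δ⁻¹ • (T * m * T) = 1 := by
    rw [← h1]; simp [mul_add, add_mul]
  have hconj : ∀ {x y : A}, x ≤ y → T * x * T ≤ T * y * T := fun h => by
    simpa [hT.star_eq] using star_right_conjugate_le_conjugate h T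
  have h4 : T * m * T ≤ algebraMap ℝ A δ := by
    have : δ⁻¹ • (T * m * T) ≤ 1 := by rw [← h3]; exact le_add_of_nonneg_left hTT
    have := smul_le_smul_of_nonneg_left this hδ.le
    rwa [smul_smul, mul_inv_cancel₀ hδ.ne', one_smul, ← Algebra.algebraMap_eq_smul_one] at this
  refine ⟨T * T, by simpa [hT.star_eq] using IsSelfAdjoint.star_mul_self T, ?_, ?_, ?_⟩
  · have : T * T - 1 = (-(δ⁻¹ : ℝ) : ℂ) • (T * m * T) := by
      rw [← Complex.ofReal_neg, Complex.coe_smul, neg_smul, ← h3]; abel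
    rw [this]
    exact M.smul_mem _ (hM.2 T _ (hM.2 T _ hm).1).2
  · have := hconj h2
    simp only [mul_one] at this
    calc T * T * (T * T) = T * (T * T) * T := by simp only [mul_assoc]
      _ ≤ T * T := this
      _ ≤ 1 := h2
  · have := hconj h4
    calc T * T * m * (T * T) = T * (T * m * T) * T := by simp only [mul_assoc]
      _ ≤ T * algebraMap ℝ A δ * T := this
      _ = δ • (T * T) := by rw [Algebra.algebraMap_eq_smul_one]; simp
      _ ≤ δ • 1 := smul_le_smul_of_nonneg_left h2 hδ.le
      _ = _ := (Algebra.algebraMap_eq_smul_one δ).symm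

end Excision

section Excision
variable {A : Type*} [CStarAlgebra A] [PartialOrder A] [StarOrderedRing A]

omit [PartialOrder A] [StarOrderedRing A] in
theorem quotStates_compress {M : Submodule ℂ A} (hM : IsClosedTwoSidedIdeal M) {ρ : A → ℝ}
    (hρ : ρ ∈ quotStates M) {p : A} (hp : IsSelfAdjoint p) (h0 : 0 < ρ (p * p)) :
    (ρ (p * p))⁻¹ • (fun X => ρ (p * X * p)) ∈ quotStates M := by
  refine ⟨?_, ?_, fun x hx => ?_⟩
  · have := hρ.1.conj p
    rw [hp.star_eq] at this
    exact this.smul (by positivity)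
  · simp [inv_mul_cancel₀ h0.ne']
  · have := hρ.2.2 _ ((hM.2 p _ (hM.2 p x hx).1).2)
    simp [this]

/-- If the slice `Re (ζ ·) ≥ t` of the numerical range lies in a ball around `μ`, the spectral part
of `Re (ζ a) - t` compresses `a` to approximately `μ`. -/
theorem quotStates_compress_le {M : Submodule ℂ A} (hM : IsClosedTwoSidedIdeal M) {a p : A}
    {ζ μ : ℂ} {t ε : ℝ}
    (hs : ∀ F ∈ quotStates M, t ≤ (ζ * cval F a).re → ‖cval F a - μ‖ ≤ ε)
    (hp : p = (ζ • a + star (ζ • a) - algebraMap ℝ A (2 * t))⁺) {θ : ℂ} (hθ : ‖θ‖ = 1)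
    {ρ : A → ℝ} (hρ : ρ ∈ quotStates M) :
    ρ (p * (θ • (a - μ • 1) + star (θ • (a - μ • 1))) * p) ≤ 2 * ε * ρ (p * p) := by
  set c : A := ζ • a + star (ζ • a) - algebraMap ℝ A (2 * t) with hc
  have hcs : IsSelfAdjoint c := (IsSelfAdjoint.add_star_self _).sub (IsSelfAdjoint.algebraMap A (IsSelfAdjoint.all _))
  have hp0 : 0 ≤ p := hp ▸ CFC.posPart_nonneg c
  have hps : IsSelfAdjoint p := IsSelfAdjoint.of_nonneg hp0
  have hpp : 0 ≤ ρ (p * p) := by simpa [hps.star_eq] using hρ.1.nonneg' p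
  rcases hpp.eq_or_lt with h0 | h0
  · have := hρ.1.cauchy_schwarz ((θ • (a - μ • 1) + star (θ • (a - μ • 1))) * p) p
    rw [hps.star_eq, ← h0, zero_mul, ← mul_assoc] at this
    rw [← h0, mul_zero]
    nlinarith
  have hF := quotStates_compress hM hρ hps h0
  set F := (ρ (p * p))⁻¹ • (fun X => ρ (p * X * p)) with hFdef
  have hFv : ∀ x, ρ (p * x * p) = ρ (p * p) * F x := by
    intro x
    simp [hFdef, mul_inv_cancel_left₀ h0.ne']
  have hpc : p * c = p * p := by
    have h1 : p * c⁻ = 0 := by rw [hp]; exact CFC.posPart_mul_negPart c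
    conv_lhs => rw [← CFC.posPart_sub_negPart c hcs, ← hp, mul_sub, h1, sub_zero]
  have hFc : 0 ≤ F c := by
    refine mul_nonneg (inv_nonneg.mpr h0.le) ?_
    show 0 ≤ ρ (p * c * p)
    rw [hpc]
    have := hρ.1.nonneg (star_right_conjugate_nonneg hp0 p)
    rwa [hps.star_eq] at this
  have hFs : t ≤ (ζ * cval F a).re := by
    rw [hc, hF.1.map_sub, hF.1.map_add, hF.1.map_star, hF.1.smul_one_apply, hF.2.1,
      hF.1.smul_complex] at hFc
    linarith
  have h1 := hs F hF hFs
  have h2 : F (θ • (a - μ • 1)) ≤ ε := by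
    rw [hF.1.smul_complex, hF.1.cval_sub, hF.1.cval_smul, hF.1.cval_one, hF.2.1]
    refine (Complex.re_le_norm _).trans ?_
    simpa [hθ] using h1
  rw [hFv, hF.1.map_add, hF.1.map_star]
  nlinarith

/-- Excision: near an approximately extremal value `μ` of the numerical range of `a` modulo `M`
there is `h ∉ M` such that `a - μ` is uniformly small on the right of `h`. -/
theorem exists_excision {M : Submodule ℂ A} (hM : IsClosedTwoSidedIdeal M) (hMt : M ≠ ⊤)
    {F₀ : A → ℝ} (hF₀ : F₀ ∈ quotStates M) (a : A) (ω : ℂ) {ε : ℝ} (hε : 0 < ε) :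
    ∃ μ : ℂ, ‖μ‖ ≤ ‖a‖ ∧ (ω * cval F₀ a).re - ε ≤ (ω * μ).re ∧ ∃ h : A, h ∉ M ∧
      ∀ θ : ℂ, θ = 1 ∨ θ = -1 ∨ θ = Complex.I ∨ θ = -Complex.I →
        star h * (θ • (a - μ • 1) + star (θ • (a - μ • 1))) * h ≤ (3 * ε) • (star h * h) := by
  obtain ⟨F', hF', ζ, hω, hs⟩ := exists_slice hF₀ a ω hε
  set μ := cval F' a with hμ
  refine ⟨μ, by simpa [hF'.2.1] using hF'.1.norm_cval_le a, hω, ?_⟩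
  set t := (ζ * μ).re - ε ^ 2 / 2 with ht
  set c : A := ζ • a + star (ζ • a) - algebraMap ℝ A (2 * t) with hc
  have hcs : IsSelfAdjoint c := (IsSelfAdjoint.add_star_self _).sub (IsSelfAdjoint.algebraMap A (IsSelfAdjoint.all _))
  set p := c⁺ with hp
  have hp0 : 0 ≤ p := CFC.posPart_nonneg c
  have hps : IsSelfAdjoint p := IsSelfAdjoint.of_nonneg hp0
  have hFp : 0 < F' p := by
    have h1 : F' c = ε ^ 2 := by
      rw [hc, hF'.1.map_sub, hF'.1.map_add, hF'.1.map_star, hF'.1.smul_one_apply, hF'.2.1,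
        hF'.1.smul_complex, ht]
      ring
    have h2 : F' c ≤ F' p := hF'.1.mono (CFC.le_posPart (a := c) hcs)
    have : 0 < ε ^ 2 := by positivity
    linarith
  have hsq : ∀ {x : A}, IsSelfAdjoint x → 0 < F' x → 0 < F' (x * x) := by
    intro x hx h
    have := hF'.1.cauchy_schwarz x 1
    simp only [star_one, one_mul, hF'.2.1, hx.star_eq] at this
    nlinarith
  have hFpp := hsq hps hFp
  set κ := F' (p * p) / 2 with hκ
  have hκ0 : 0 < κ := by positivity
  set δ := ε * κ / 3 with hδ
  have hδ0 : 0 < δ := by positivity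
  let Θ : Fin 4 → ℂ := ![1, -1, Complex.I, -Complex.I]
  have hΘ : ∀ i, ‖Θ i‖ = 1 := by intro i; fin_cases i <;> simp [Θ]
  let H : ℂ → A := fun θ => θ • (a - μ • 1) + star (θ • (a - μ • 1))
  have hH : ∀ θ, IsSelfAdjoint (H θ) := fun θ => IsSelfAdjoint.add_star_self _
  have hx : ∀ i, IsSelfAdjoint (p * H (Θ i) * p - (2 * ε) • (p * p)) := by
    intro i
    have h1 := (hH (Θ i)).conjugate p
    have h2 := IsSelfAdjoint.star_mul_self p
    rw [hps.star_eq] at h1 h2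
    exact h1.sub (IsSelfAdjoint.smul (IsSelfAdjoint.all _) h2)
  have hex : ∀ i, ∃ m ∈ M, IsSelfAdjoint m ∧
      p * H (Θ i) * p - (2 * ε) • (p * p) ≤ algebraMap ℝ A (0 + δ) + m := fun i => by
    refine exists_mem_of_quotStates_le hM hMt (hx i) (fun ρ hρ => ?_) hδ0
    have := quotStates_compress_le hM hs rfl (hΘ i) hρ
    rw [hρ.1.map_sub, hρ.1.map_smul]
    linarith
  choose m hmM hms hmle using hex
  have hmm : ∀ i, 0 ≤ m i * m i := fun i => by
    simpa [(hms i).star_eq] using star_mul_self_nonneg (m i)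
  set m₀ : A := (4 * δ)⁻¹ • ∑ i, m i * m i with hm₀
  have hm₀0 : 0 ≤ m₀ := smul_nonneg (by positivity) (Finset.sum_nonneg fun i _ => hmm i)
  have hm₀M : m₀ ∈ M := by
    rw [hm₀, ← Complex.coe_smul]
    exact M.smul_mem _ (M.sum_mem fun i _ => (hM.2 _ _ (hmM i)).1)
  have hm_le : ∀ i, m i ≤ algebraMap ℝ A δ + m₀ := by
    intro i
    have h1 : 0 ≤ (m i - algebraMap ℝ A (2 * δ)) * (m i - algebraMap ℝ A (2 * δ)) := by
      have := star_mul_self_nonneg (m i - algebraMap ℝ A (2 * δ))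
      rwa [((hms i).sub (IsSelfAdjoint.algebraMap A (IsSelfAdjoint.all _))).star_eq] at this
    have h2 := smul_nonneg (a := (4 * δ)⁻¹) (by positivity) h1
    have h3 : (4 * δ)⁻¹ • ((m i - algebraMap ℝ A (2 * δ)) * (m i - algebraMap ℝ A (2 * δ))) =
        (4 * δ)⁻¹ • (m i * m i) - m i + algebraMap ℝ A δ := by
      simp only [Algebra.algebraMap_eq_smul_one, mul_sub, sub_mul, smul_mul_assoc, mul_smul_comm,
        one_mul, mul_one, smul_sub, smul_smul]
      have e1 : (4 * δ)⁻¹ * (2 * δ) = 1 / 2 := by field_simp; norm_num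
      have e2 : (4 * δ)⁻¹ * (2 * δ * (2 * δ)) = δ := by field_simp; norm_num
      rw [e1, e2]
      module
    rw [h3] at h2
    have h4 : (4 * δ)⁻¹ • (m i * m i) ≤ m₀ :=
      smul_le_smul_of_nonneg_left (Finset.single_le_sum (f := fun i => m i * m i)
        (fun j _ => hmm j) (Finset.mem_univ i)) (by positivity)
    calc m i ≤ algebraMap ℝ A δ + (4 * δ)⁻¹ • (m i * m i) := by
          rw [← sub_nonneg]; convert h2 using 1; abel
      _ ≤ _ := by gcongr
  obtain ⟨r, hr, hrM, hrr, hrm⟩ := exists_ideal_cutoff hM hm₀M hm₀0 hδ0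
  have hconj : ∀ {z : A} (_ : IsSelfAdjoint z) {x y : A}, x ≤ y → z * x * z ≤ z * y * z :=
    fun {z} hz _ _ h => by simpa [hz.star_eq] using star_right_conjugate_le_conjugate h z
  set q := r * (p * p) * r with hq
  have hq0 : 0 ≤ q := by
    have := star_right_conjugate_nonneg (by simpa [hps.star_eq] using star_mul_self_nonneg p : 0 ≤ p * p) r
    rwa [hr.star_eq] at this
  have hHr : ∀ i, r * (p * H (Θ i) * p) * r ≤ (2 * ε) • q + algebraMap ℝ A (3 * δ) := by
    intro i
    have h1 := (hmle i).trans (add_le_add_right (hm_le i) _)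
    have h2 := hconj hr h1
    have h3 : r * (algebraMap ℝ A (0 + δ) + (algebraMap ℝ A δ + m₀)) * r ≤
        algebraMap ℝ A (3 * δ) := by
      have e : r * (algebraMap ℝ A (0 + δ) + (algebraMap ℝ A δ + m₀)) * r =
          (2 * δ) • (r * r) + r * m₀ * r := by
        simp only [Algebra.algebraMap_eq_smul_one, mul_add, add_mul, mul_smul_comm, smul_mul_assoc,
          mul_one, zero_add]
        module
      rw [e]
      calc _ ≤ (2 * δ) • (1 : A) + algebraMap ℝ A δ := by gcongr
        _ = _ := by rw [← Algebra.algebraMap_eq_smul_one, ← map_add]; congr 1; ring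
    have h4 := h2.trans h3
    rw [mul_sub, sub_mul, mul_smul_comm, smul_mul_assoc, sub_le_iff_le_add'] at h4
    exact h4
  have hFq : F' q = F' (p * p) := by
    have h1 : q - p * p ∈ M := by
      have : q - p * p = (r - 1) * (p * p * r) + p * p * (r - 1) := by
        rw [hq]; noncomm_ring
      rw [this]
      exact M.add_mem (hM.2 _ _ hrM).2 (hM.2 _ _ hrM).1
    have := hF'.2.2 _ h1
    rw [hF'.1.map_sub] at this
    linarith
  have hqs : IsSelfAdjoint (q - algebraMap ℝ A κ) :=
    (IsSelfAdjoint.of_nonneg hq0).sub (IsSelfAdjoint.algebraMap A (IsSelfAdjoint.all _))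
  set g := (q - algebraMap ℝ A κ)⁺ with hg
  have hg0 : 0 ≤ g := CFC.posPart_nonneg _
  have hgs : IsSelfAdjoint g := IsSelfAdjoint.of_nonneg hg0
  have hFg : 0 < F' g := by
    have h1 : F' (q - algebraMap ℝ A κ) ≤ F' g := hF'.1.mono (CFC.le_posPart hqs)
    rw [hF'.1.map_sub, hF'.1.smul_one_apply, hF'.2.1, hFq] at h1
    linarith
  have hgq : κ • (g * g) ≤ g * q * g := by
    have h1 : g * (q - algebraMap ℝ A κ) = g * g := by
      have h1 : g * (q - algebraMap ℝ A κ)⁻ = 0 := CFC.posPart_mul_negPart _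
      conv_lhs => rw [← CFC.posPart_sub_negPart (q - algebraMap ℝ A κ) hqs, ← hg, mul_sub, h1, sub_zero]
    have h2 : g * q = g * g + κ • g := by
      rw [← h1, Algebra.algebraMap_eq_smul_one, mul_sub]; simp
    rw [h2, add_mul, smul_mul_assoc]
    refine le_add_of_nonneg_left ?_
    have := star_right_conjugate_nonneg hg0 g
    rwa [hgs.star_eq] at this
  set h := p * r * g with hh
  have hhh : star h * h = g * q * g := by
    rw [hh, hq]; simp only [star_mul, hps.star_eq, hr.star_eq, hgs.star_eq, mul_assoc]
  refine ⟨h, fun hmem => ?_, fun θ hθ => ?_⟩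
  · have h1 := hF'.2.2 _ (hM.2 (star h) _ hmem).1
    rw [hhh] at h1
    have h2 := hF'.1.mono hgq
    rw [hF'.1.map_smul, h1] at h2
    have := mul_pos hκ0 (hsq hgs hFg)
    linarith
  · obtain ⟨i, rfl⟩ : ∃ i, θ = Θ i := by
      rcases hθ with h | h | h | h
      exacts [⟨0, h⟩, ⟨1, h⟩, ⟨2, h⟩, ⟨3, h⟩]
    have e : star h * H (Θ i) * h = g * (r * (p * H (Θ i) * p) * r) * g := by
      rw [hh]; simp only [star_mul, hps.star_eq, hr.star_eq, hgs.star_eq, mul_assoc]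
    calc star h * H (Θ i) * h = _ := e
      _ ≤ g * ((2 * ε) • q + algebraMap ℝ A (3 * δ)) * g := hconj hgs (hHr i)
      _ = (2 * ε) • (g * q * g) + ε • (κ • (g * g)) := by
          have : 3 * δ = ε * κ := by rw [hδ]; ring
          rw [Algebra.algebraMap_eq_smul_one, this]
          simp only [mul_add, add_mul, mul_smul_comm, smul_mul_assoc, mul_one, smul_smul]
      _ ≤ (2 * ε) • (g * q * g) + ε • (g * q * g) := by gcongr
      _ = (3 * ε) • (star h * h) := by rw [hhh]; module

/-- The norm form of excision. -/
theorem norm_excision_le {a h : A} {μ : ℂ} {ε : ℝ} (hε : 0 ≤ ε)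
    (hh : ∀ θ : ℂ, θ = 1 ∨ θ = -1 ∨ θ = Complex.I ∨ θ = -Complex.I →
        star h * (θ • (a - μ • 1) + star (θ • (a - μ • 1))) * h ≤ ε • (star h * h))
    (l : List A) (hl : sqL (l.map fun y => h * y) ≤ 1) :
    ‖(l.map fun y => star (h * y) * (a - μ • 1) * (h * y)).sum‖ ≤ ε := by
  set Z : A := (l.map fun y => star (h * y) * (a - μ • 1) * (h * y)).sum
  have key : ∀ θ : ℂ, θ = 1 ∨ θ = -1 ∨ θ = Complex.I ∨ θ = -Complex.I →
      θ • Z + star (θ • Z) ≤ algebraMap ℝ A ε := by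
    intro θ hθ
    have h1 : θ • Z + star (θ • Z) ≤ ε • sqL (l.map fun y => h * y) := by
      simp only [Z]
      clear hl
      clear Z
      induction l with
      | nil => simp
      | cons y l ih =>
        simp only [List.map_cons, List.sum_cons, sqL_cons, smul_add, star_add]
        have h2 := star_left_conjugate_le_conjugate (hh θ hθ) y
        have e1 : star y * (star h * (θ • (a - μ • 1) + star (θ • (a - μ • 1))) * h) * y =
            θ • (star (h * y) * (a - μ • 1) * (h * y)) +
              star (θ • (star (h * y) * (a - μ • 1) * (h * y))) := by
          simp only [star_mul, star_smul, star_star, mul_add, add_mul, mul_smul_comm,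
            smul_mul_assoc, mul_assoc]
        have e2 : star y * (ε • (star h * h)) * y = ε • (star (h * y) * (h * y)) := by
          simp only [star_mul, mul_smul_comm, smul_mul_assoc, mul_assoc]
        rw [e1, e2] at h2
        convert add_le_add h2 ih using 1
        abel
    refine h1.trans ?_
    rw [Algebra.algebraMap_eq_smul_one]
    exact smul_le_smul_of_nonneg_left hl hε
  have b1 : ‖Z + star Z‖ ≤ ε := by
    refine (IsSelfAdjoint.add_star_self Z).norm_le_of_le hε ?_ ?_
    · simpa using key 1 (by simp)
    · have := key (-1) (by simp)
      simpa [neg_add, add_comm] using this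
  have b2 : ‖Complex.I • Z + star (Complex.I • Z)‖ ≤ ε := by
    refine (IsSelfAdjoint.add_star_self _).norm_le_of_le hε ?_ ?_
    · simpa using key Complex.I (by simp)
    · have := key (-Complex.I) (by simp)
      simpa [neg_add, add_comm] using this
  have e : Z = (2⁻¹ : ℂ) • (Z + star Z) - (2⁻¹ * Complex.I) • (Complex.I • Z + star (Complex.I • Z)) := by
    simp only [star_smul, RCLike.star_def, Complex.conj_I, smul_add, smul_smul, mul_neg, neg_smul, smul_neg,
      mul_assoc, Complex.I_mul_I]
    module
  rw [e]
  refine (norm_sub_le _ _).trans ?_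
  rw [norm_smul, norm_smul]
  have n1 : ‖(2⁻¹ : ℂ)‖ = 1 / 2 := by norm_num
  have n2 : ‖(2⁻¹ * Complex.I : ℂ)‖ = 1 / 2 := by rw [norm_mul, n1]; simp
  rw [n1, n2]
  linarith

end Excision

section DoubleCommutator
variable {A : Type*} [CStarAlgebra A] {B : Type*} [CStarAlgebra B] {φ : A →⋆ₐ[ℂ] B}

theorem hasDerivAt_conj_exp {g : B → ℝ} (hg : PosFun g) (s X : B) (t : ℝ) :
    HasDerivAt (fun t : ℝ => g (NormedSpace.exp (t • s) * X * NormedSpace.exp (t • (-s))))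
      (g (NormedSpace.exp (t • s) * (s * X - X * s) * NormedSpace.exp (t • (-s)))) t := by
  have h1 := hasDerivAt_exp_smul_const (𝕂 := ℝ) s t
  have h2 := hasDerivAt_exp_smul_const' (𝕂 := ℝ) (-s) t
  have h3 := (h1.mul_const X).mul h2
  let L : B →L[ℝ] ℝ := hg.lin.mkContinuous (g 1) fun X => hg.abs_le X
  have h4 := L.hasFDerivAt.comp_hasDerivAt t h3
  have e : L (NormedSpace.exp (t • s) * s * X * NormedSpace.exp (t • -s) +
      NormedSpace.exp (t • s) * X * (-s * NormedSpace.exp (t • -s))) =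
      g (NormedSpace.exp (t • s) * (s * X - X * s) * NormedSpace.exp (t • (-s))) := by
    show g _ = g _
    congr 1
    noncomm_ring
  rw [e] at h4
  exact h4

/-- At a functional maximal along its orbit, double commutators are nonpositive. -/
theorem double_commutator_le {g : B → ℝ} (hg : PosFun g) {X : B}
    (h : ∀ u ∈ imGroup φ, g ((u : B) * X * star (u : B)) ≤ g X) {x : A} (hx : IsSelfAdjoint x) :
    2 * g (φ x * X * φ x) ≤ g (φ (x * x) * X) + g (X * φ (x * x)) := by
  set s : B := Complex.I • φ x
  have hmax : ∀ t : ℝ, g (NormedSpace.exp (t • s) * X * NormedSpace.exp (t • (-s))) ≤ g X := by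
    intro t
    have hy : IsSelfAdjoint (t • x) := IsSelfAdjoint.smul (IsSelfAdjoint.all _) hx
    set u := selfAdjoint.expUnitary (⟨t • x, hy⟩ : selfAdjoint A)
    obtain ⟨w, hw, hwu⟩ := mem_imGroup (φ := φ) (u := u) (Subgroup.subset_closure ⟨_, rfl⟩)
    have e1 : (w : B) = NormedSpace.exp (t • s) := by
      rw [hwu]
      have hφ : Continuous φ := AddMonoidHomClass.continuous_of_bound φ 1 fun x => by
        simpa using NonUnitalStarAlgHom.norm_apply_le φ x
      let +nondep : NormedAlgebra ℚ A := .restrictScalars ℚ ℂ A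
      let +nondep : NormedAlgebra ℚ B := .restrictScalars ℚ ℂ B
      have := NormedSpace.map_exp φ hφ (Complex.I • t • x)
      show φ (NormedSpace.exp (Complex.I • t • x)) = _
      rw [this]
      congr 1
      rw [map_smul, ← Complex.coe_smul, map_smul, ← Complex.coe_smul, smul_comm]
    have e2 : star (w : B) = NormedSpace.exp (t • -s) := by
      rw [e1, NormedSpace.star_exp]
      congr 1
      simp only [s, star_smul, ← StarHomClass.map_star, hx.star_eq, RCLike.star_def, Complex.conj_I,
        neg_smul, star_trivial]
    have := h w hw
    rwa [e1, ← e1, e2, e1] at this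
  set f := fun t : ℝ => g (NormedSpace.exp (t • s) * X * NormedSpace.exp (t • (-s))) with hf
  set f' := fun t : ℝ => g (NormedSpace.exp (t • s) * (s * X - X * s) * NormedSpace.exp (t • (-s)))
    with hf'
  have hfd : ∀ t, HasDerivAt f (f' t) t := fun t => hasDerivAt_conj_exp hg s X t
  have hfd' := hasDerivAt_conj_exp hg s (s * X - X * s) 0
  simp only [zero_smul, NormedSpace.exp_zero, one_mul, mul_one] at hfd'
  have hf0 : f 0 = g X := by simp [hf]
  have hlm : IsLocalMax f 0 := Filter.Eventually.of_forall fun t => by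
    rw [hf0]; exact hmax t
  have h0 : f' 0 = 0 := hlm.hasDerivAt_eq_zero (hfd 0)
  have hle : g (s * (s * X - X * s) - (s * X - X * s) * s) ≤ 0 := by
    by_contra! hpos
    have hd : deriv f = f' := funext fun t => (hfd t).deriv
    have hmin : IsLocalMin f 0 := by
      refine isLocalMin_of_deriv_deriv_pos ?_ (by rw [hd, h0]) (hfd 0).continuousAt
      rw [hd]
      exact hfd'.deriv.symm ▸ hpos
    have hconst : f =ᶠ[nhds 0] fun _ => f 0 := by
      filter_upwards [hmin, hlm] with t h1 h2 using le_antisymm h2 h1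
    have hc' : f' =ᶠ[nhds 0] fun _ => 0 := by
      have := hconst.deriv
      rw [hd] at this
      simpa using this
    have h3 := hc'.deriv_eq
    rw [deriv_const] at h3
    have h4 : deriv f' 0 = _ := hfd'.deriv
    linarith
  have e : s * (s * X - X * s) - (s * X - X * s) * s =
      (2 : ℝ) • (φ x * X * φ x) - φ (x * x) * X - X * φ (x * x) := by
    simp only [s, smul_mul_assoc, mul_smul_comm, mul_sub, sub_mul, smul_sub, smul_smul,
      Complex.I_mul_I, map_mul, mul_assoc]
    module
  rw [e, hg.map_sub, hg.map_sub, hg.map_smul] at hle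
  linarith

/-- The Lindblad-type inequality at a maximizing functional. -/
theorem lindblad_le {g : B → ℝ} (hg : PosFun g) {X : B} (hX : IsSelfAdjoint X)
    (h : ∀ u ∈ imGroup φ, g ((u : B) * X * star (u : B)) ≤ g X) (w : A) :
    g (star (φ w) * X * φ w) + g (φ w * X * star (φ w)) ≤
      g (X * φ (star w * w)) + g (X * φ (w * star w)) := by
  set x : A := (realPart w : A)
  set y : A := (imaginaryPart w : A)
  have hx : IsSelfAdjoint x := (realPart w).2
  have hy : IsSelfAdjoint y := (imaginaryPart w).2
  have hw : w = x + Complex.I • y := (realPart_add_I_smul_imaginaryPart w).symm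
  have h1 := double_commutator_le hg h hx
  have h2 := double_commutator_le hg h hy
  have hflip : ∀ z : A, IsSelfAdjoint z → g (φ (z * z) * X) = g (X * φ (z * z)) := by
    intro z hz
    rw [← hg.map_star, star_mul, hX.star_eq, ← StarHomClass.map_star, star_mul, hz.star_eq]
  rw [hflip x hx] at h1
  rw [hflip y hy] at h2
  rw [← hg.map_add, ← hg.map_add, ← mul_add, ← map_add]
  have e1 : star (φ w) * X * φ w + φ w * X * star (φ w) =
      (2 : ℝ) • (φ x * X * φ x) + (2 : ℝ) • (φ y * X * φ y) := by
    rw [← StarHomClass.map_star, hw]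
    simp only [star_add, star_smul, hx.star_eq, hy.star_eq, map_add, map_smul, RCLike.star_def,
      Complex.conj_I, smul_mul_assoc, mul_smul_comm, mul_add, add_mul, smul_add, smul_smul,
      neg_smul, smul_neg, mul_neg, neg_mul, Complex.I_mul_I, map_neg]
    module
  have e2 : star w * w + w * star w = (2 : ℝ) • (x * x) + (2 : ℝ) • (y * y) := by
    rw [hw]
    simp only [star_add, star_smul, hx.star_eq, hy.star_eq, RCLike.star_def,
      Complex.conj_I, smul_mul_assoc, mul_smul_comm, mul_add, add_mul, smul_add, smul_smul,
      neg_smul, smul_neg, mul_neg, neg_mul, Complex.I_mul_I]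
    module
  rw [e1, e2]
  simp only [← Complex.coe_smul, map_add, map_smul, mul_add, mul_smul_comm]
  simp only [Complex.coe_smul, hg.map_add, hg.map_smul]
  linarith

theorem lindblad_list_le {g : B → ℝ} (hg : PosFun g) {X : B} (hX : IsSelfAdjoint X)
    (h : ∀ u ∈ imGroup φ, g ((u : B) * X * star (u : B)) ≤ g X) (l : List A) :
    g (l.map fun w => star (φ w) * X * φ w).sum + g (l.map fun w => φ w * X * star (φ w)).sum ≤
      g (X * φ (sqL l)) + g (X * φ (sqR l)) := by
  induction l with
  | nil => simp [hg.map_zero]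
  | cons w l ih =>
    have := lindblad_le hg hX h w
    simp only [List.map_cons, List.sum_cons, hg.map_add, sqL_cons, sqR_cons, map_add, mul_add]
    linarith

end DoubleCommutator

section SmallLists
variable {A : Type*} [CStarAlgebra A] {B : Type*} [CStarAlgebra B] {φ : A →⋆ₐ[ℂ] B}

/-- `γ` is dominated by a multiple of a member of `S` pulled back along `φ`. -/
def DomBy (φ : A →⋆ₐ[ℂ] B) (S : Set (B → ℝ)) (γ : A → ℝ) : Prop :=
  ∃ C : ℝ, 0 < C ∧ ∃ F ∈ S, FunLE γ fun x => C * F (φ x)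

theorem DomBy.add {S : Set (B → ℝ)} (hS : Convex ℝ S) {γ γ' : A → ℝ} (h : DomBy φ S γ)
    (h' : DomBy φ S γ') : DomBy φ S (γ + γ') := by
  obtain ⟨C, hC, F, hF, hle⟩ := h
  obtain ⟨C', hC', F', hF', hle'⟩ := h'
  refine ⟨C + C', by positivity, (C / (C + C')) • F + (C' / (C + C')) • F',
    hS hF hF' (by positivity) (by positivity) (by field_simp), fun X => ?_⟩
  refine (add_le_add (hle X) (hle' X)).trans_eq ?_
  simp only [Pi.add_apply, Pi.smul_apply, smul_eq_mul]
  field_simp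

theorem DomBy.smul {S : Set (B → ℝ)} {γ : A → ℝ} (h : DomBy φ S γ) {c : ℝ} (hc : 0 < c) :
    DomBy φ S (c • γ) := by
  obtain ⟨C, hC, F, hF, hle⟩ := h
  refine ⟨c * C, by positivity, F, hF, fun X => ?_⟩
  simp only [Pi.smul_apply, smul_eq_mul, mul_assoc]
  exact mul_le_mul_of_nonneg_left (hle X) hc.le

theorem DomBy.of_le {S : Set (B → ℝ)} {γ γ' : A → ℝ} (h : DomBy φ S γ) (hle : FunLE γ' γ) :
    DomBy φ S γ' := by
  obtain ⟨C, hC, F, hF, hle'⟩ := h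
  exact ⟨C, hC, F, hF, hle.trans hle'⟩

theorem domBy_conj {S : Set (B → ℝ)} (hS : Convex ℝ S) (hst : UStable (imGroup φ) S)
    (hpos : ∀ F ∈ S, PosFun F) {g : B → ℝ} (hg : g ∈ S) (c : A) :
    DomBy φ S fun y => g (φ (c * y * star c)) := by
  have hp := hpos g hg
  refine Submodule.span_induction (p := fun c _ => DomBy φ S fun y => g (φ (c * y * star c)))
    ?_ ?_ ?_ ?_ (mem_span_expGroup c)
  · rintro _ ⟨u, hu, rfl⟩
    obtain ⟨w, hw, hwu⟩ := mem_imGroup (φ := φ) hu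
    refine ⟨1, one_pos, uact w g, hst w hw g hg, fun X => le_of_eq ?_⟩
    simp [uact_apply, hwu, StarHomClass.map_star]
  · refine ⟨1, one_pos, g, hg, fun X => ?_⟩
    simp [hp.map_zero, StarHomClass.map_star, hp.nonneg']
  · intro x y _ _ hx hy
    refine ((hx.add hS hy).smul (c := 2) two_pos).of_le fun X => ?_
    have h1 := hp.nonneg' (φ (X * star x - X * star y))
    have e : φ ((x + y) * (star X * X) * star (x + y)) + star (φ (X * star x - X * star y)) *
        φ (X * star x - X * star y) = (2 : ℝ) • (φ (x * (star X * X) * star x) +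
          φ (y * (star X * X) * star y)) := by
      rw [← StarHomClass.map_star, ← map_mul, ← map_add, ← map_add, ← Complex.coe_smul, ← map_smul]
      congr 1
      rw [Complex.coe_smul]
      simp only [star_sub, star_mul, star_star, star_add]
      rw [two_smul]
      noncomm_ring
    have h2 := congrArg g e
    rw [hp.map_add, hp.map_smul, hp.map_add] at h2
    simp only [Pi.smul_apply, Pi.add_apply, smul_eq_mul]
    linarith
  · intro z x _ hx
    rcases eq_or_ne z 0 with rfl | hz
    · refine ⟨1, one_pos, g, hg, fun X => ?_⟩
      simp [hp.map_zero, StarHomClass.map_star, hp.nonneg']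
    · refine (hx.smul (c := ‖z‖ ^ 2) (by positivity)).of_le fun X => le_of_eq ?_
      have : (z • x) * (star X * X) * star (z • x) =
          ((‖z‖ ^ 2 : ℝ) : ℂ) • (x * (star X * X) * star x) := by
        simp only [star_smul, smul_mul_assoc, mul_smul_comm, smul_smul, RCLike.star_def]
        rw [mul_comm, Complex.mul_conj, Complex.normSq_eq_norm_sq]
      show g (φ _) = _
      rw [this, _root_.map_smul, Complex.coe_smul, hp.map_smul]
      rfl

variable [PartialOrder A] [StarOrderedRing A]

/-- In the absence of tracial functionals below `S`, the unit is a sum `∑ z* z` with `∑ z z*`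
arbitrarily small for finitely many functionals. -/
theorem exists_small_list {S : Set (B → ℝ)} (hS : Convex ℝ S) (hst : UStable (imGroup φ) S)
    (hpos : ∀ F ∈ S, PosFun F)
    (htr : ∀ F ∈ S, ∀ τ : A → ℝ, PosFun τ → (∀ x y, τ (x * y) = τ (y * x)) →
      FunLE τ (fun x => F (φ x)) → τ = 0) {g : B → ℝ} (hg : g ∈ S) (cs : List A) {ε : ℝ}
    (hε : 0 < ε) : ∃ l : List A, sqL l = 1 ∧ ∀ c ∈ cs, g (φ (c * sqR l * star c)) ≤ ε := by
  have hp := hpos g hg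
  let γ : A → ℝ := (cs.map fun c => fun y => g (φ (c * y * star c))).sum
  have hγc : ∀ c, PosFun fun y => g (φ (c * y * star c)) := fun c => (hp.comp φ).conj' c
  have hγ : PosFun γ ∧ DomBy φ S γ ∧ ∀ c ∈ cs, ∀ y, 0 ≤ y → g (φ (c * y * star c)) ≤ γ y := by
    simp only [γ]
    clear γ
    induction cs with
    | nil => 
      refine ⟨by simpa using PosFun.zero, ⟨1, one_pos, g, hg, fun X => ?_⟩, by simp⟩
      simp [StarHomClass.map_star, hp.nonneg']
    | cons c cs ih =>
      obtain ⟨h1, h2, h3⟩ := ih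
      simp only [List.map_cons, List.sum_cons]
      refine ⟨(hγc c).add h1, (domBy_conj hS hst hpos hg c).add hS h2, ?_⟩
      intro c' hc' y hy
      rcases List.mem_cons.mp hc' with rfl | hc'
      · have := h1.nonneg hy
        simp only [Pi.add_apply]; linarith
      · have := h3 c' hc' y hy
        have := (hγc c).nonneg hy
        simp only [Pi.add_apply]; linarith
  obtain ⟨hγ, ⟨C, hC, F, hF, hdom⟩, hle⟩ := hγ
  obtain ⟨l, hl, hl'⟩ := exists_list_of_no_trace hγ (fun τ hτ ht hτγ => by
    have h0 := htr F hF (C⁻¹ • τ) (hτ.smul (by positivity)) (fun x y => by simp [ht x y])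
      (fun X => by
        have := (hτγ X).trans (hdom X)
        simp only [Pi.smul_apply, smul_eq_mul]
        rwa [inv_mul_le_iff₀ hC])
    exact (smul_eq_zero.mp h0).resolve_left (inv_ne_zero hC.ne')) hε
  exact ⟨l, hl, fun c hc => (hle c hc _ (sqR_nonneg l)).trans hl'⟩

end SmallLists

section Concrete
variable (A : Type*) [CStarAlgebra A] [PartialOrder A] [StarOrderedRing A]

/-- The `2 × 2` matrix algebra over `A`. -/
abbrev MatTwo := CStarMatrix (Fin 2) (Fin 2) A

variable {A}

omit [PartialOrder A] [StarOrderedRing A] in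
theorem MatTwo.mul_apply_two (X Y : MatTwo A) (i j : Fin 2) :
    (X * Y) i j = X i 0 * Y 0 j + X i 1 * Y 1 j := by
  rw [CStarMatrix.mul_apply, Fin.sum_univ_two]

variable (A) in
/-- The diagonal embedding of `A` into its `2 × 2` matrix algebra. -/
def diagHom : A →⋆ₐ[ℂ] MatTwo A where
  toFun a := CStarMatrix.ofMatrix (Matrix.diagonal fun _ => a)
  map_one' := by ext i j; fin_cases i <;> fin_cases j <;> simp
  map_mul' x y := by
    ext i j; fin_cases i <;> fin_cases j <;> simp [MatTwo.mul_apply_two]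
  map_zero' := by ext i j; fin_cases i <;> fin_cases j <;> simp
  map_add' x y := by ext i j; fin_cases i <;> fin_cases j <;> simp
  commutes' r := by ext i j; fin_cases i <;> fin_cases j <;> simp [CStarMatrix.algebraMap_apply]
  map_star' x := by
    ext i j; fin_cases i <;> fin_cases j <;> simp [CStarMatrix.star_apply]

variable (A) in
/-- The off-diagonal matrix unit. -/
def matE : MatTwo A := CStarMatrix.ofMatrix !![0, 1; 0, 0]

theorem diagHom_apply (a : A) (i j : Fin 2) : diagHom A a i j = if i = j then a else 0 := rfl

theorem isMatUnit_matE : IsMatUnit (diagHom A) (matE A) where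
  sq := by ext i j; fin_cases i <;> fin_cases j <;> simp [MatTwo.mul_apply_two, matE]
  one := by
    ext i j; fin_cases i <;> fin_cases j <;>
      simp [MatTwo.mul_apply_two, matE, CStarMatrix.star_apply]
  comm x := by
    ext i j; fin_cases i <;> fin_cases j <;> simp [MatTwo.mul_apply_two, matE, diagHom_apply]

theorem norm_le_norm_hat (y : A) : ‖y‖ ≤ ‖hat (diagHom A) (matE A) y‖ := by
  refine le_trans (le_of_eq ?_) (CStarMatrix.norm_entry_le_norm (i := 0) (j := 1))
  simp [hat, MatTwo.mul_apply_two, matE, diagHom_apply, CStarMatrix.star_apply]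

/-- The sum of the diagonal entries. -/
def diagSum (X : MatTwo A) : A := X 0 0 + X 1 1

/-- The symmetry `diag(1, -1)`. -/
def matP : MatTwo A := matE A * star (matE A) - star (matE A) * matE A

/-- The flip. -/
def matQ : MatTwo A := matE A + star (matE A)

omit [PartialOrder A] [StarOrderedRing A] in
theorem matP_apply (i j : Fin 2) :
    (matP : MatTwo A) i j = if i = j then (if i = 0 then 1 else -1) else 0 := by
  fin_cases i <;> fin_cases j <;>
    simp [matP, MatTwo.mul_apply_two, matE, CStarMatrix.star_apply]

omit [PartialOrder A] [StarOrderedRing A] in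
theorem matQ_apply (i j : Fin 2) : (matQ : MatTwo A) i j = if i = j then 0 else 1 := by
  fin_cases i <;> fin_cases j <;> simp [matQ, matE, CStarMatrix.star_apply]

omit [PartialOrder A] [StarOrderedRing A] in
theorem isSelfAdjoint_matP : IsSelfAdjoint (matP : MatTwo A) := by
  simp [IsSelfAdjoint, matP]

omit [PartialOrder A] [StarOrderedRing A] in
theorem isSelfAdjoint_matQ : IsSelfAdjoint (matQ : MatTwo A) := by
  simp [IsSelfAdjoint, matQ, add_comm]

theorem matP_mul_matP : (matP : MatTwo A) * matP = 1 := by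
  ext i j; fin_cases i <;> fin_cases j <;>
    simp [MatTwo.mul_apply_two, matP_apply]

omit [PartialOrder A] [StarOrderedRing A] in
theorem matQ_mul_matQ : (matQ : MatTwo A) * matQ = 1 := by
  ext i j; fin_cases i <;> fin_cases j <;>
    simp [MatTwo.mul_apply_two, matQ_apply]

theorem matP_hat (y : A) :
    (matP : MatTwo A) * hat (diagHom A) (matE A) y * matP = -hat (diagHom A) (matE A) y := by
  ext i j; fin_cases i <;> fin_cases j <;>
    simp [MatTwo.mul_apply_two, matP_apply, hat, matE, diagHom_apply, CStarMatrix.star_apply]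

theorem norm_le_of_neg_le_hat {y : A} {R : ℝ} (hR : 0 ≤ R)
    (h : 0 ≤ hat (diagHom A) (matE A) y + algebraMap ℝ (MatTwo A) R) : ‖y‖ ≤ R := by
  refine (norm_le_norm_hat y).trans ?_
  have h2 := star_left_conjugate_nonneg h matP
  rw [isSelfAdjoint_matP.star_eq, mul_add, add_mul, matP_hat, ← Algebra.commutes, mul_assoc,
    matP_mul_matP, mul_one] at h2
  refine IsSelfAdjoint.norm_le_of_le (isMatUnit_matE.isSelfAdjoint_hat y) hR ?_ ?_
  · rwa [neg_add_eq_sub, sub_nonneg] at h2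
  · rwa [← sub_neg_eq_add, sub_nonneg, neg_le] at h

/-- The four symmetries whose average is the conditional expectation onto the diagonal copy. -/
def matList : List (MatTwo A) := [1, matP, matQ, matP * matQ]

theorem star_mul_self_of_mem_matList {m : MatTwo A} (hm : m ∈ matList) :
    star m * m = 1 ∧ m * star m = 1 := by
  simp only [matList, List.mem_cons, List.not_mem_nil, or_false] at hm
  have h1 : (matP : MatTwo A) * matQ * (matQ * matP) = 1 := by
    rw [mul_assoc, ← mul_assoc matQ, matQ_mul_matQ, one_mul, matP_mul_matP]
  have h2 : (matQ : MatTwo A) * matP * (matP * matQ) = 1 := by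
    rw [mul_assoc, ← mul_assoc matP, matP_mul_matP, one_mul, matQ_mul_matQ]
  rcases hm with rfl | rfl | rfl | rfl <;>
    simp [isSelfAdjoint_matP.star_eq, isSelfAdjoint_matQ.star_eq, matP_mul_matP, matQ_mul_matQ,
      h1, h2]

theorem sum_matList (X : MatTwo A) :
    (matList.map fun m => m * X * star m).sum =
      diagHom A (diagSum X) + diagHom A (diagSum X) := by
  simp only [matList, List.map_cons, List.map_nil, List.sum_cons, List.sum_nil, star_one, mul_one,
    one_mul, star_mul, isSelfAdjoint_matP.star_eq, isSelfAdjoint_matQ.star_eq, add_zero]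
  ext i j; fin_cases i <;> fin_cases j <;>
    simp [MatTwo.mul_apply_two, matP_apply, matQ_apply, diagHom_apply, diagSum] <;> abel

theorem PosFun.diagSum {τ : A → ℝ} (hτ : PosFun τ) : PosFun fun X : MatTwo A => τ (diagSum X) where
  map_add X Y := by
    rw [← hτ.map_add]; congr 1; simp only [_root_.diagSum, CStarMatrix.add_apply]; abel
  map_smul r X := by
    rw [← hτ.map_smul]
    exact congrArg τ (smul_add r (X 0 0) (X 1 1)).symm
  nonneg' X := by
    simp only [_root_.diagSum, MatTwo.mul_apply_two, CStarMatrix.star_apply, hτ.map_add]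
    have h := fun i j => hτ.nonneg' (X i j)
    linarith [h 0 0, h 0 1, h 1 0, h 1 1]
  map_star X := by
    rw [← hτ.map_star]; congr 1; simp [_root_.diagSum, CStarMatrix.star_apply]

omit [PartialOrder A] [StarOrderedRing A] in
theorem diagSum_tracial {τ : A → ℝ} (hτ : PosFun τ) (ht : ∀ x y, τ (x * y) = τ (y * x))
    (X Y : MatTwo A) : τ (diagSum (X * Y)) = τ (diagSum (Y * X)) := by
  simp only [diagSum, MatTwo.mul_apply_two, hτ.map_add, ht (Y _ _)]
  ring

omit [PartialOrder A] [StarOrderedRing A] in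
theorem diagSum_one : diagSum (1 : MatTwo A) = 1 + 1 := by simp [diagSum]

theorem diagSum_le {τ : A → ℝ} (hτ : PosFun τ) {Ψ : MatTwo A → ℝ} (hΨ : PosFun Ψ)
    (h : FunLE τ fun x => Ψ (diagHom A x)) (X : MatTwo A) :
    2 * τ (diagSum (star X * X)) ≤ (matList.map fun m => Ψ (m * (star X * X) * star m)).sum := by
  have h1 : τ (diagSum (star X * X)) ≤ Ψ (diagHom A (diagSum (star X * X))) := by
    simp only [diagSum, MatTwo.mul_apply_two, CStarMatrix.star_apply, hτ.map_add, map_add,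
      hΨ.map_add]
    have h := fun i j => h (X i j)
    simp only [map_mul] at h
    simp only [map_mul]
    linarith [h 0 0, h 0 1, h 1 0, h 1 1]
  have h2 := congrArg Ψ (sum_matList (star X * X))
  rw [hΨ.map_add] at h2
  have h3 : ∀ l : List (MatTwo A), Ψ (l.map fun m => m * (star X * X) * star m).sum =
      (l.map fun m => Ψ (m * (star X * X) * star m)).sum := by
    intro l
    induction l with
    | nil => simp [hΨ.map_zero]
    | cons m l ih => simp only [List.map_cons, List.sum_cons, hΨ.map_add, ih]
  rw [← h3, h2]
  linarith

end Concrete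

section MatModel
variable {A : Type*} [CStarAlgebra A] {B : Type*} [CStarAlgebra B]
variable [PartialOrder B] [StarOrderedRing B]

/-- The properties of the diagonal embedding of `A` into its `2 × 2` matrix algebra, with `e` the
off-diagonal matrix unit. -/
structure IsMatModel (φ : A →⋆ₐ[ℂ] B) (e : B) : Prop extends IsMatUnit φ e where
  norm_le : ∀ (y : A) (R : ℝ), 0 ≤ R → 0 ≤ hat φ e y + algebraMap ℝ B R → ‖y‖ ≤ R
  exists_trace : ∃ ms : List B, (∀ m ∈ ms, star m * m = 1 ∧ m * star m = 1) ∧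
    ∀ τ : A → ℝ, PosFun τ → (∀ x y, τ (x * y) = τ (y * x)) →
      ∃ T : B → ℝ, PosFun T ∧ (∀ X Y, T (X * Y) = T (Y * X)) ∧ T 1 = τ 1 + τ 1 ∧
        ∀ Ψ : B → ℝ, PosFun Ψ → FunLE τ (fun x => Ψ (φ x)) → ∀ X : B,
          2 * T (star X * X) ≤ (ms.map fun m => Ψ (m * (star X * X) * star m)).sum

theorem isMatModel_diagHom [PartialOrder A] [StarOrderedRing A] :
    IsMatModel (diagHom A) (matE A) where
  toIsMatUnit := isMatUnit_matE
  norm_le _ _ hR h := norm_le_of_neg_le_hat hR h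
  exists_trace := ⟨matList, fun _ hm => star_mul_self_of_mem_matList hm, fun τ hτ ht =>
    ⟨fun X => τ (diagSum X), hτ.diagSum, diagSum_tracial hτ ht, by
      show τ (diagSum 1) = _
      rw [diagSum_one, hτ.map_add],
      fun _ hΨ h X => diagSum_le hτ hΨ h X⟩⟩

end MatModel

section VBound
variable {B : Type*} [CStarAlgebra B]

/-- `F(u x u*) - F(w y w*) ≤ c` for all `u, w` in `G`. -/
def VBound (G : Subgroup (unitary B)) (x y : B) (F : B → ℝ) (c : ℝ) : Prop :=
  ∀ u ∈ G, ∀ w ∈ G, uact u F x - uact w F y ≤ c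

variable {G : Subgroup (unitary B)} {x y : B}

theorem VBound.add {F F' : B → ℝ} {c c' : ℝ} (h : VBound G x y F c) (h' : VBound G x y F' c') :
    VBound G x y (F + F') (c + c') := by
  intro u hu w hw
  have := h u hu w hw
  have := h' u hu w hw
  simp only [uact_apply, Pi.add_apply] at *
  linarith

theorem VBound.smul {F : B → ℝ} {c : ℝ} (h : VBound G x y F c) {r : ℝ} (hr : 0 ≤ r) :
    VBound G x y (r • F) (r * c) := by
  intro u hu w hw
  have := mul_le_mul_of_nonneg_left (h u hu w hw) hr
  simp only [uact_apply, Pi.smul_apply, smul_eq_mul] at *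
  linarith

theorem VBound.uact {F : B → ℝ} {c : ℝ} (h : VBound G x y F c) {v : unitary B} (hv : v ∈ G) :
    VBound G x y (uact v F) c := by
  intro u hu w hw
  have := h (v * u) (mul_mem hv hu) (v * w) (mul_mem hv hw)
  simpa only [uact_mul] using this

theorem VBound.sub_invariant {F f : B → ℝ} {c : ℝ} (h : VBound G x y F c) (hf : UInvariant G f) :
    VBound G x y (F - f) (c - (f x - f y)) := by
  intro u hu w hw
  have h1 := h u hu w hw
  have h2 := congrFun (hf u hu) x
  have h3 := congrFun (hf w hw) y
  simp only [uact_apply, Pi.sub_apply] at *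
  linarith

theorem isClosed_vBound : IsClosed {p : (B → ℝ) × ℝ | VBound G x y p.1 p.2} := by
  simp only [VBound, Set.ofPred_forall, uact_apply]
  exact isClosed_iInter fun u => isClosed_iInter fun _ => isClosed_iInter fun w =>
    isClosed_iInter fun _ => isClosed_le (by fun_prop) (by fun_prop)

/-- Normalized positive functionals satisfying `VBound`. -/
def vStates (G : Subgroup (unitary B)) (x y : B) (c : ℝ) : Set (B → ℝ) :=
  {F | PosFun F ∧ F 1 = 1 ∧ VBound G x y F c}

theorem isClosed_vStates (G : Subgroup (unitary B)) (x y : B) (c : ℝ) :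
    IsClosed (vStates G x y c) :=
  PosFun.isClosed_setOf.inter ((isClosed_eq (continuous_apply _) continuous_const).inter
    (isClosed_vBound.preimage (f := fun F : B → ℝ => (F, c)) (by fun_prop)))

theorem isCompact_vStates (G : Subgroup (unitary B)) (x y : B) (c : ℝ) :
    IsCompact (vStates G x y c) :=
  PosFun.isCompact_of_isClosed (isClosed_vStates G x y c) 1 fun _ hF => ⟨hF.1, hF.2.1.le⟩

theorem convex_vStates (G : Subgroup (unitary B)) (x y : B) (c : ℝ) :
    Convex ℝ (vStates G x y c) := by
  rintro F ⟨a1, a2, a3⟩ F' ⟨b1, b2, b3⟩ p q hp hq hpq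
  refine ⟨(a1.smul hp).add (b1.smul hq), by simp [a2, b2, hpq], ?_⟩
  have := (a3.smul hp).add (b3.smul hq)
  rwa [← add_mul, hpq, one_mul] at this

theorem uStable_vStates (G : Subgroup (unitary B)) (x y : B) (c : ℝ) :
    UStable G (vStates G x y c) := fun v hv F hF =>
  ⟨hF.1.uact v, (uact_apply_one v F).trans hF.2.1, hF.2.2.uact hv⟩

/-- There is an optimal bound, attained by a state. -/
theorem exists_optimal_bound {R : ℝ} (hne : (vStates G x y (-R)).Nonempty) :
    ∃ S, R ≤ S ∧ (vStates G x y (-S)).Nonempty ∧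
      ∀ (F : B → ℝ) (c : ℝ), PosFun F → VBound G x y F c → -(S * F 1) ≤ c := by
  let K : Set ((B → ℝ) × ℝ) :=
    {p | PosFun p.1 ∧ p.1 1 = 1 ∧ VBound G x y p.1 (-p.2)} ∩ (Set.univ ×ˢ Set.Ici R)
  have hbound : ∀ F : B → ℝ, ∀ c, PosFun F → F 1 = 1 → VBound G x y F (-c) → c ≤ ‖x‖ + ‖y‖ := by
    intro F c hF h1 hV
    have h2 := hV 1 (one_mem _) 1 (one_mem _)
    simp only [uact_one] at h2
    have h3 := hF.abs_le x
    have h4 := hF.abs_le y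
    rw [h1, one_mul] at h3 h4
    have := abs_le.mp h3
    have := abs_le.mp h4
    linarith
  have hcl : IsClosed K := by
    refine IsClosed.inter ?_ (isClosed_univ.prod isClosed_Ici)
    refine (PosFun.isClosed_setOf.preimage continuous_fst).inter (IsClosed.inter ?_ ?_)
    · exact isClosed_eq (by fun_prop) continuous_const
    · exact isClosed_vBound.preimage (f := fun p : (B → ℝ) × ℝ => (p.1, -p.2)) (by fun_prop)
  have hS : IsCompact {F : B → ℝ | PosFun F ∧ F 1 = 1} :=
    PosFun.isCompact_of_isClosed (PosFun.isClosed_setOf.inter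
      (isClosed_eq (continuous_apply _) continuous_const)) 1 fun _ hF => ⟨hF.1, hF.2.le⟩
  have hK : IsCompact K := by
    refine (hS.prod (isCompact_Icc (a := R) (b := ‖x‖ + ‖y‖))).of_isClosed_subset hcl ?_
    rintro ⟨F, c⟩ ⟨⟨h1, h2, h3⟩, -, h4⟩
    exact ⟨⟨h1, h2⟩, h4, hbound F c h1 h2 h3⟩
  obtain ⟨F₀, hF₀⟩ := hne
  obtain ⟨⟨Ψ, S⟩, ⟨⟨h1, h2, h3⟩, -, h4⟩, hmax⟩ := hK.exists_isMaxOn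
    ⟨(F₀, R), ⟨hF₀.1, hF₀.2.1, hF₀.2.2⟩, trivial, le_refl R⟩ continuous_snd.continuousOn
  refine ⟨S, h4, ⟨Ψ, h1, h2, h3⟩, fun F c hF hV => ?_⟩
  rcases hF.one_nonneg.eq_or_lt with h0 | h0
  · have := hV 1 (one_mem _) 1 (one_mem _)
    rw [hF.eq_zero h0.symm] at *
    simpa [uact_apply] using this
  · have hV' := hV.smul (inv_nonneg.mpr h0.le)
    by_contra! hlt
    have h5 : S < (F 1)⁻¹ * (-c) := by
      rw [inv_mul_eq_div, lt_div_iff₀ h0]; linarith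
    have := hmax (a := ((F 1)⁻¹ • F, (F 1)⁻¹ * (-c)))
      ⟨⟨hF.smul (by positivity), by simp [inv_mul_cancel₀ h0.ne'], by simpa using hV'⟩, trivial,
        (le_trans (show R ≤ S from h4) h5.le : R ≤ _)⟩
    exact absurd h5 (not_lt.mpr this)

end VBound

section Separation
open scoped Pointwise
variable {A : Type*} [CStarAlgebra A] {B : Type*} [CStarAlgebra B]
variable [PartialOrder B] [StarOrderedRing B] {φ : A →⋆ₐ[ℂ] B} {e : B}

/-- The convex hull of the orbit under conjugation by products of exponentials. -/
def convOrbit (a : A) : Set A :=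
  convexHull ℝ {x | ∃ u ∈ expGroup A, x = (u : A) * a * star (u : A)}

theorem conj_mem_convOrbit (a : A) {u : unitary A} (hu : u ∈ expGroup A) :
    (u : A) * a * star (u : A) ∈ convOrbit a :=
  subset_convexHull ℝ _ ⟨u, hu, rfl⟩

theorem convOrbit_subset_dixmierSet (a : A) : convOrbit a ⊆ dixmierSet a :=
  (convexHull_mono (by rintro _ ⟨u, -, rfl⟩; exact ⟨u, rfl⟩)).trans subset_closure

/-- Separation: if the orbit hulls are far apart, some state separates their dilations. -/
theorem exists_vStates (he : IsMatModel φ e) (a b : A) {R : ℝ} (hR : 0 ≤ R)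
    (h : ∀ x ∈ convOrbit a, ∀ y ∈ convOrbit b, R < ‖x - y‖) :
    (vStates (imGroup φ) (hat φ e a) (hat φ e b) (-R)).Nonempty := by
  set C : Set A := convOrbit a - convOrbit b with hC
  have hconv : Convex ℝ C := (convex_convexHull ℝ _).sub (convex_convexHull ℝ _)
  have hlt : ∀ y ∈ C, R < ‖y‖ := by
    rintro _ ⟨x, hx, y, hy, rfl⟩
    exact h x hx y hy
  have hmem : ∀ u ∈ expGroup A, ∀ w ∈ expGroup A,
      (u : A) * a * star (u : A) - (w : A) * b * star (w : A) ∈ C := fun u hu w hw =>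
    Set.sub_mem_sub (conj_mem_convOrbit a hu) (conj_mem_convOrbit b hw)
  obtain ⟨y₀, hy₀⟩ : C.Nonempty := ⟨_, hmem 1 (one_mem _) 1 (one_mem _)⟩
  have hpos : ∀ y ∈ C, ¬ 0 ≤ hat φ e y + algebraMap ℝ B R := fun y hy h0 =>
    absurd (he.norm_le y R hR h0) (not_le.mpr (hlt y hy))
  let Rel : B → ℝ → Prop := fun x t => ∃ c : ℝ, 0 ≤ c ∧ ∃ y ∈ C,
    x ≤ algebraMap ℝ B t + c • (hat φ e y + algebraMap ℝ B R)
  have hlow : ∀ t, Rel 0 t → 0 ≤ t := by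
    rintro t ⟨c, hc, y, hy, hle⟩
    by_contra! ht
    have h1 : algebraMap ℝ B (-t) ≤ c • (hat φ e y + algebraMap ℝ B R) := by
      rw [map_neg, neg_le_iff_add_nonneg']; exact hle
    have h2 : 0 ≤ algebraMap ℝ B (-t) := by
      rw [← map_zero (algebraMap ℝ B)]; exact algebraMap_mono B (by linarith)
    rcases hc.eq_or_lt with rfl | hc
    · rw [zero_smul] at h1
      have h3 : algebraMap ℝ B (-t) = 0 := le_antisymm h1 h2
      have h4 : (1 : B) = 0 := by
        rw [Algebra.algebraMap_eq_smul_one] at h3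
        exact (smul_eq_zero.mp h3).resolve_left (by linarith)
      refine hpos y hy (le_of_eq ?_)
      rw [← one_mul (hat φ e y + _), h4, zero_mul]
    · refine hpos y hy ?_
      have := smul_nonneg (inv_nonneg.mpr hc.le) (h2.trans h1)
      rwa [smul_smul, inv_mul_cancel₀ hc.ne', one_smul] at this
  refine Exists.elim (exists_posFun_of_rel Rel ?_ ?_ ?_ ?_ hlow 1 (IsSelfAdjoint.one B)) ?_
  · rintro x x' s t ⟨c, hc, y, hy, hle⟩ ⟨c', hc', y', hy', hle'⟩
    rcases (add_nonneg hc hc').eq_or_lt with h0 | h0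
    · obtain ⟨rfl, rfl⟩ : c = 0 ∧ c' = 0 := ⟨by linarith, by linarith⟩
      refine ⟨0, le_rfl, y, hy, ?_⟩
      have := add_le_add hle hle'
      simpa using this
    · refine ⟨c + c', h0.le, (c / (c + c')) • y + (c' / (c + c')) • y',
        hconv hy hy' (by positivity) (by positivity) (by field_simp), ?_⟩
      refine (add_le_add hle hle').trans_eq ?_
      rw [hat_add, hat_smul_real, hat_smul_real]
      simp only [smul_add, smul_smul, map_add, mul_div_cancel₀ _ h0.ne', add_smul]
      abel
  · rintro c x t hc ⟨d, hd, y, hy, hle⟩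
    refine ⟨c * d, by positivity, y, hy, ?_⟩
    have := smul_le_smul_of_nonneg_left hle hc.le
    rwa [smul_add, smul_smul, Algebra.algebraMap_eq_smul_one t, smul_smul,
      ← Algebra.algebraMap_eq_smul_one] at this
  · intro x hx
    exact ⟨0, le_rfl, y₀, hy₀, by simpa using hx⟩
  · intro x hx
    exact ⟨‖x‖, 0, le_rfl, y₀, hy₀, by simpa using hx.le_algebraMap_norm_self⟩
  · rintro F ⟨hF, h1, h2⟩
    have hF1 : F 1 = 1 := by
      refine le_antisymm (h1 1 1 (IsSelfAdjoint.one B) ⟨0, le_rfl, y₀, hy₀, by simp⟩) (h2 1 ?_)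
      rintro t ⟨c, hc, y, hy, hle⟩
      have := hlow (t - 1) ⟨c, hc, y, hy, by
        rw [map_sub, map_one, sub_add_eq_add_sub, sub_nonneg]; exact hle⟩
      linarith
    refine ⟨F, hF, hF1, fun u hu w hw => ?_⟩
    obtain ⟨u', hu', e1⟩ := exists_of_mem_imGroup hu
    obtain ⟨w', hw', e2⟩ := exists_of_mem_imGroup hw
    set y := (u' : A) * a * star (u' : A) - (w' : A) * b * star (w' : A)
    have h3 := h1 (hat φ e y + algebraMap ℝ B R) 0
      ((he.isSelfAdjoint_hat y).add (IsSelfAdjoint.algebraMap B (IsSelfAdjoint.all R)))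
      ⟨1, zero_le_one, y, hmem u' hu' w' hw', by simp⟩
    rw [hF.map_add, hF.smul_one_apply, hF1, mul_one, hat_sub, hF.map_sub, ← he.hat_conj,
      ← he.hat_conj] at h3
    rw [uact_apply, uact_apply, e1, e2]
    linarith

end Separation

section NoCentral
variable {A : Type*} [CStarAlgebra A] {B : Type*} [CStarAlgebra B] {φ : A →⋆ₐ[ℂ] B} {e : B}

/-- Members of an optimal `vStates` dominate no nonzero central functional. -/
theorem eq_zero_of_central_le (he : IsMatUnit φ e) {a b : A} {r S : ℝ} (hrS : r < S)
    (h : ∀ τ : A →L[ℂ] ℂ, IsTracialState τ → ‖τ (a - b)‖ ≤ r)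
    (hopt : ∀ (F : B → ℝ) (c : ℝ), PosFun F →
      VBound (imGroup φ) (hat φ e a) (hat φ e b) F c → -(S * F 1) ≤ c)
    {Ψ : B → ℝ} (hΨ : Ψ ∈ vStates (imGroup φ) (hat φ e a) (hat φ e b) (-S))
    {f : B → ℝ} (hf : PosFun f) (hfi : UInvariant (imGroup φ) f) (hle : FunLE f Ψ) : f = 0 := by
  have h1 := hopt _ _ (hle.posFun_sub hf hΨ.1) (hΨ.2.2.sub_invariant hfi)
  have h2 := central_hat_ge he h hf hfi
  rw [hat_sub, hf.map_sub] at h2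
  simp only [Pi.sub_apply, hΨ.2.1] at h1
  refine hf.eq_zero (le_antisymm ?_ hf.one_nonneg)
  nlinarith [hf.one_nonneg]

end NoCentral

section Resolvent
variable {B : Type*} [CStarAlgebra B] [PartialOrder B] [StarOrderedRing B]

/-- The resolvent `(1 + s)⁻¹`. -/
def res (s : B) : B := Ring.inverse (1 + s)

variable {s : B}

theorem isUnit_one_add (hs : 0 ≤ s) : IsUnit (1 + s) :=
  CStarAlgebra.isUnit_of_le 1 (le_add_of_nonneg_right hs) isStrictlyPositive_one

theorem res_mul (hs : 0 ≤ s) : res s * (1 + s) = 1 := Ring.inverse_mul_cancel _ (isUnit_one_add hs)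

theorem mul_res (hs : 0 ≤ s) : (1 + s) * res s = 1 := Ring.mul_inverse_cancel _ (isUnit_one_add hs)

theorem res_eq_of_mul (hs : 0 ≤ s) {d : B} (h : d * (1 + s) = 1) : d = res s := by
  rw [← mul_one d, ← mul_res hs, ← mul_assoc, h, one_mul]

theorem isSelfAdjoint_res (hs : 0 ≤ s) : IsSelfAdjoint (res s) := by
  refine res_eq_of_mul hs ?_
  have := congrArg star (mul_res hs)
  rwa [star_mul, star_one, star_add, star_one, (IsSelfAdjoint.of_nonneg hs).star_eq] at this

theorem res_mul_self (hs : 0 ≤ s) : res s * s = 1 - res s := by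
  have := res_mul hs
  rw [mul_add, mul_one] at this
  exact eq_sub_of_add_eq' this

theorem self_mul_res (hs : 0 ≤ s) : s * res s = 1 - res s := by
  have := mul_res hs
  rw [add_mul, one_mul] at this
  exact eq_sub_of_add_eq' this

theorem res_nonneg (hs : 0 ≤ s) : 0 ≤ res s := by
  have h := star_left_conjugate_nonneg (add_nonneg zero_le_one hs) (res s)
  rwa [(isSelfAdjoint_res hs).star_eq, res_mul hs, one_mul] at h

theorem res_antitone (hs : 0 ≤ s) {s' : B} (h : s ≤ s') : res s' ≤ res s :=
  CStarAlgebra.ringInverse_le_ringInverse (add_le_add_right h 1)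
    (IsStrictlyPositive.iff_of_unital.mpr ⟨add_nonneg zero_le_one hs, isUnit_one_add hs⟩)

theorem res_le_one (hs : 0 ≤ s) : res s ≤ 1 := by
  have := res_antitone le_rfl hs
  rwa [show res (0 : B) = 1 by simp [res]] at this

theorem one_sub_res_le (hs : 0 ≤ s) : 1 - res s ≤ s := by
  have h := star_left_conjugate_nonneg (res_nonneg hs) s
  rw [(IsSelfAdjoint.of_nonneg hs).star_eq, self_mul_res hs, sub_mul, one_mul, res_mul_self hs,
    sub_nonneg] at h
  exact h

theorem res_conj (hs : 0 ≤ s) {m : B} (h1 : star m * m = 1) (h2 : m * star m = 1) :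
    res (star m * s * m) = star m * res s * m := by
  refine (res_eq_of_mul (star_left_conjugate_nonneg hs m) ?_).symm
  calc star m * res s * m * (1 + star m * s * m)
      = star m * (res s * (m + (m * star m) * s * m)) := by noncomm_ring
    _ = star m * ((res s * (1 + s)) * m) := by rw [h2]; noncomm_ring
    _ = 1 := by rw [res_mul hs, one_mul, h1]

theorem sq_res_le (hs : 0 ≤ s) : res s * res s ≤ res s := by
  have h := star_left_conjugate_nonneg hs (res s)
  rw [(isSelfAdjoint_res hs).star_eq, res_mul_self hs, sub_mul, one_mul, sub_nonneg] at h
  exact h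

end Resolvent

section TraceBelow
variable {B : Type*} [CStarAlgebra B] [PartialOrder B] [StarOrderedRing B]

theorem conj_inv_sq_le {k S T : B} (hk : 0 ≤ k) (hkS : k ≤ S) (hT : IsSelfAdjoint T)
    (hTS : T * S * T = 1) (hTT : T * T ≤ 1) : k * (T * T) * (T * T) * k ≤ k := by
  obtain ⟨p, hp, hpk⟩ := exists_sqrt_of_nonneg hk
  have hks := (IsSelfAdjoint.of_nonneg hk).star_eq
  have h1 : star (p * T) * (p * T) ≤ 1 := by
    have := star_left_conjugate_le_conjugate hkS T
    rw [hT.star_eq, hTS] at this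
    refine le_trans (le_of_eq ?_) this
    rw [star_mul, hT.star_eq, hp.star_eq, ← hpk]
    noncomm_ring
  have h2 : (p * T) * star (p * T) ≤ 1 := by
    have h3 : ‖p * T‖ * ‖p * T‖ ≤ 1 := by
      rw [← CStarRing.norm_star_mul_self]
      exact (CStarAlgebra.norm_le_one_iff_of_nonneg _ (star_mul_self_nonneg _)).mpr h1
    rw [← CStarRing.norm_self_mul_star] at h3
    exact (CStarAlgebra.norm_le_one_iff_of_nonneg _ (mul_star_self_nonneg _)).mp h3
  have h4 := star_left_conjugate_le_conjugate hTT (T * k)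
  have h5 := star_left_conjugate_le_conjugate h2 p
  rw [hp.star_eq, mul_one, hpk] at h5
  rw [star_mul, hT.star_eq, hks, mul_one] at h4
  calc k * (T * T) * (T * T) * k = k * T * (T * T) * (T * k) := by noncomm_ring
    _ ≤ k * T * (T * k) := h4
    _ = p * (p * T * star (p * T)) * p := by
      rw [star_mul, hT.star_eq, hp.star_eq, ← hpk]; noncomm_ring
    _ ≤ k := h5

/-- If the unit is nearly dominated by `k + l` with `F k`, `T l` small, some resolvent is small. -/
theorem exists_res_le {F T : B → ℝ} (hF : PosFun F) (hF1 : F 1 = 1) (hT : PosFun T)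
    (ht : ∀ x y, T (x * y) = T (y * x)) {k l : B} (hk : 0 ≤ k) (hl : 0 ≤ l) (hkl : 1 ≤ k + l)
    {t : ℝ} (ht0 : 0 < t) (h1 : F k ≤ t ^ 4) (h2 : T l ≤ t ^ 4) :
    ∃ s : B, 0 ≤ s ∧ T s ≤ t ^ 2 ∧ F (res s) ≤ t ^ 2 + t := by
  obtain ⟨R, hR, hRS, hRR, hcomm⟩ := exists_inv_sqrt hkl
  set S := k + l
  have hX : R * R * S = 1 := by rw [mul_assoc, hcomm.eq, ← mul_assoc, hRS]
  have hks := (IsSelfAdjoint.of_nonneg hk).star_eq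
  have hls := (IsSelfAdjoint.of_nonneg hl).star_eq
  have hks' := hR.star_eq
  set y := R * R * k
  set c := R * R * l
  have hyc : y + c = 1 := by rw [← mul_add]; exact hX
  have hy : F (star y * y) ≤ t ^ 4 := by
    refine le_trans (hF.mono (le_trans (le_of_eq ?_)
      (conj_inv_sq_le hk (le_add_of_nonneg_right hl) hR hRS hRR))) h1
    simp only [y, star_mul, hks, hks']; noncomm_ring
  have hc : T (c * star c) ≤ t ^ 4 := by
    rw [ht]
    refine le_trans (hT.mono (le_trans (le_of_eq ?_)
      (conj_inv_sq_le hl (le_add_of_nonneg_left hk) hR hRS hRR))) h2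
    simp only [c, star_mul, hls, hks']; noncomm_ring
  set s := (t ^ 2)⁻¹ • (c * star c) with hs
  have hs0 : 0 ≤ s := smul_nonneg (by positivity) (mul_star_self_nonneg c)
  have hcs : c * star c = (t ^ 2) • s := by
    rw [hs, smul_smul, mul_inv_cancel₀ (by positivity), one_smul]
  refine ⟨s, hs0, ?_, ?_⟩
  · rw [hs, hT.map_smul, inv_mul_le_iff₀ (by positivity)]
    calc T (c * star c) ≤ t ^ 4 := hc
      _ = _ := by ring
  set D := res s
  have hD := (isSelfAdjoint_res hs0).star_eq
  have e : F D = F (D * y) + F (D * c) := by rw [← hF.map_add, ← mul_add, hyc, mul_one]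
  have hDD : F (D * D) ≤ 1 := by
    rw [← hF1]; exact hF.mono ((sq_res_le hs0).trans (res_le_one hs0))
  have b1 : F (D * y) ≤ t ^ 2 := by
    have := hF.cauchy_schwarz y D
    rw [hD] at this
    refine abs_le_of_sq_le_sq' ?_ (by positivity) |>.2
    calc F (D * y) ^ 2 ≤ F (D * D) * F (star y * y) := this
      _ ≤ 1 * t ^ 4 := by
        refine mul_le_mul hDD hy (hF.nonneg' y) zero_le_one
      _ = (t ^ 2) ^ 2 := by ring
  have b2 : F (D * c) ≤ t := by
    have := hF.cauchy_schwarz 1 (star (D * c))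
    rw [star_star, mul_one, star_one, mul_one, hF1, mul_one] at this
    refine abs_le_of_sq_le_sq' ?_ ht0.le |>.2
    refine this.trans ?_
    have e2 : D * c * star (D * c) = (t ^ 2) • (D - D * D) := by
      rw [star_mul, hD, show D * c * (star c * D) = D * (c * star c) * D by noncomm_ring, hcs,
        mul_smul_comm, smul_mul_assoc, res_mul_self hs0, sub_mul, one_mul]
    rw [e2, hF.map_smul, hF.map_sub]
    have h3 : F D ≤ 1 := by rw [← hF1]; exact hF.mono (res_le_one hs0)
    have h4 : 0 ≤ F (D * D) := by have := hF.nonneg' D; rwa [hD] at this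
    nlinarith [sq_nonneg t]
  linarith

end TraceBelow

section NoTrace
variable {A : Type*} [CStarAlgebra A] {B : Type*} [CStarAlgebra B]
variable [PartialOrder B] [StarOrderedRing B] {φ : A →⋆ₐ[ℂ] B} {e : B}

omit [PartialOrder B] [StarOrderedRing B] in
theorem PosFun.list_sum_le {F : B → ℝ} (ms : List B) (Y : B) {c : ℝ}
    (h : ∀ m ∈ ms, F (m * Y * star m) ≤ c) :
    (ms.map fun m => F (m * Y * star m)).sum ≤ ms.length * c := by
  refine (List.sum_le_card_nsmul _ c (by simpa using h)).trans_eq ?_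
  simp

theorem list_conj_sum_nonneg {s : B} (hs : 0 ≤ s) (ms : List B) :
    0 ≤ (ms.map fun m => star m * s * m).sum := by
  refine List.sum_nonneg fun x hx => ?_
  obtain ⟨m, -, rfl⟩ := List.mem_map.mp hx
  exact star_left_conjugate_nonneg hs m

theorem le_list_conj_sum {s : B} (hs : 0 ≤ s) {ms : List B} {m : B} (hm : m ∈ ms) :
    star m * s * m ≤ (ms.map fun m => star m * s * m).sum := by
  induction ms with
  | nil => simp at hm
  | cons a ms ih =>
    simp only [List.map_cons, List.sum_cons]
    rcases List.mem_cons.mp hm with rfl | hm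
    · exact le_add_of_nonneg_right (list_conj_sum_nonneg hs ms)
    · exact (ih hm).trans (le_add_of_nonneg_left (star_left_conjugate_nonneg hs a))

omit [PartialOrder B] [StarOrderedRing B] in
theorem PosFun.tracial_list_conj_sum {T : B → ℝ} (hT : PosFun T) (ht : ∀ x y, T (x * y) = T (y * x))
    (s : B) {ms : List B} (hms : ∀ m ∈ ms, star m * m = 1 ∧ m * star m = 1) :
    T (ms.map fun m => star m * s * m).sum = ms.length * T s := by
  induction ms with
  | nil => simp [hT.map_zero]
  | cons a ms ih =>
    simp only [List.map_cons, List.sum_cons, List.length_cons, hT.map_add]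
    rw [ih fun m hm => hms m (List.mem_cons_of_mem _ hm), ht, ← mul_assoc,
      (hms a List.mem_cons_self).2, one_mul]
    push_cast
    ring

omit [PartialOrder B] [StarOrderedRing B] in
theorem uInvariant_of_tracial {T : B → ℝ} (ht : ∀ x y, T (x * y) = T (y * x))
    (G : Subgroup (unitary B)) : UInvariant G T := by
  intro u _
  funext X
  rw [uact_apply, ht, ← mul_assoc, Unitary.coe_star_mul_self, one_mul]

/-- A compact convex invariant set of states without central minorants has no tracial
minorants. -/
theorem tracial_eq_zero (he : IsMatModel φ e) {S : Set (B → ℝ)} (hS : Convex ℝ S)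
    (hcomp : IsCompact S) (hst : UStable (imGroup φ) S) (hpos : ∀ F ∈ S, PosFun F ∧ F 1 = 1)
    (hcen : ∀ F ∈ S, ∀ f : B → ℝ, PosFun f → UInvariant (imGroup φ) f → FunLE f F → f = 0)
    {Ψ : B → ℝ} (hΨ : Ψ ∈ S) {τ : A → ℝ} (hτ : PosFun τ) (ht : ∀ x y, τ (x * y) = τ (y * x))
    (hle : FunLE τ fun x => Ψ (φ x)) : τ = 0 := by
  obtain ⟨ms, hms, hex⟩ := he.exists_trace
  obtain ⟨T, hT, hTt, hT1, hTle⟩ := hex τ hτ ht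
  have hTle := hTle Ψ (hpos Ψ hΨ).1 hle
  have hp := (hpos Ψ hΨ).1
  let Rel : B → ℝ → Prop := fun X t => ∃ k l : B, 0 ≤ k ∧ 0 ≤ l ∧ X ≤ k + l ∧ t = Ψ k + T l
  by_cases hcase : ∃ c > 0, ∀ t, Rel 1 t → c ≤ t
  · exfalso
    obtain ⟨c, hc, hlow⟩ := hcase
    refine Exists.elim (exists_posFun_of_rel Rel ?_ ?_ ?_ ?_ ?_ 1 (IsSelfAdjoint.one B)) ?_
    · rintro x y _ _ ⟨k, l, hk, hl, h, rfl⟩ ⟨k', l', hk', hl', h', rfl⟩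
      refine ⟨k + k', l + l', add_nonneg hk hk', add_nonneg hl hl',
        (add_le_add h h').trans_eq (by abel), ?_⟩
      rw [hp.map_add, hT.map_add]; ring
    · rintro d x _ hd ⟨k, l, hk, hl, h, rfl⟩
      refine ⟨d • k, d • l, smul_nonneg hd.le hk, smul_nonneg hd.le hl, ?_, ?_⟩
      · rw [← smul_add]; exact smul_le_smul_of_nonneg_left h hd.le
      · rw [hp.map_smul, hT.map_smul]; ring
    · intro x hx
      exact ⟨0, 0, le_rfl, le_rfl, by simpa using hx, by simp [hp.map_zero, hT.map_zero]⟩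
    · intro x hx
      refine ⟨_, algebraMap ℝ B ‖x‖, 0, ?_, le_rfl, by simpa using hx.le_algebraMap_norm_self, rfl⟩
      rw [← map_zero (algebraMap ℝ B)]
      exact algebraMap_mono B (norm_nonneg x)
    · rintro _ ⟨k, l, hk, hl, -, rfl⟩
      exact add_nonneg (hp.nonneg hk) (hT.nonneg hl)
    rintro F ⟨hF, h1, h2⟩
    have hFΨ : FunLE F Ψ := fun X => h1 _ _ (IsSelfAdjoint.star_mul_self X)
      ⟨star X * X, 0, star_mul_self_nonneg X, le_rfl, by simp, by simp [hT.map_zero]⟩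
    have hFT : FunLE F T := fun X => h1 _ _ (IsSelfAdjoint.star_mul_self X)
      ⟨0, star X * X, le_rfl, star_mul_self_nonneg X, by simp, by simp [hp.map_zero]⟩
    have hFc := h2 c hlow
    let K : Set (B → ℝ) := {f | PosFun f ∧ FunLE f T ∧ c ≤ f 1 ∧ ∃ Ψ ∈ S, FunLE f Ψ}
    have hTi := uInvariant_of_tracial hTt (imGroup φ)
    have hKcomp : IsCompact K := by
      have h0 : IsCompact {f : B → ℝ | PosFun f ∧ FunLE f T ∧ c ≤ f 1} := by
        refine PosFun.isCompact_of_isClosed (PosFun.isClosed_setOf.inter ((isClosed_funLE T).inter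
          (isClosed_le continuous_const (continuous_apply _)))) (T 1) fun f hf => ⟨hf.1, hf.2.1.one⟩
      have hcl : IsClosed {p : (B → ℝ) × (B → ℝ) | FunLE p.1 p.2} := by
        simp only [FunLE, Set.ofPred_forall]
        exact isClosed_iInter fun X => isClosed_le (by fun_prop) (by fun_prop)
      have h3 := ((h0.prod hcomp).inter_right hcl).image continuous_fst
      convert h3 using 1
      ext f
      constructor
      · rintro ⟨a1, a2, a3, Ψ', a4, a5⟩
        exact ⟨(f, Ψ'), ⟨⟨⟨a1, a2, a3⟩, a4⟩, a5⟩, rfl⟩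
      · rintro ⟨⟨f', Ψ'⟩, ⟨⟨⟨a1, a2, a3⟩, a4⟩, a5⟩, rfl⟩
        exact ⟨a1, a2, a3, Ψ', a4, a5⟩
    have hKne : K.Nonempty := ⟨F, hF, hFT, hFc, Ψ, hΨ, hFΨ⟩
    obtain ⟨f, hfK, hfi⟩ := exists_uInvariant_mem hT hTi hKne hKcomp
      (by
        rintro f ⟨a1, a2, a3, Ψ₁, a4, a5⟩ f' ⟨b1, b2, b3, Ψ₂, b4, b5⟩ p q hp hq hpq
        refine ⟨(a1.smul hp).add (b1.smul hq), fun X => ?_, ?_, p • Ψ₁ + q • Ψ₂,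
          hS a4 b4 hp hq hpq, fun X => ?_⟩
        · calc p * f (star X * X) + q * f' (star X * X)
              ≤ p * T (star X * X) + q * T (star X * X) :=
                add_le_add (mul_le_mul_of_nonneg_left (a2 X) hp)
                  (mul_le_mul_of_nonneg_left (b2 X) hq)
            _ = _ := by rw [← add_mul, hpq, one_mul]
        · calc c = p * c + q * c := by rw [← add_mul, hpq, one_mul]
            _ ≤ p * f 1 + q * f' 1 := add_le_add (mul_le_mul_of_nonneg_left a3 hp)
                  (mul_le_mul_of_nonneg_left b3 hq)
        · exact add_le_add (mul_le_mul_of_nonneg_left (a5 X) hp)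
                  (mul_le_mul_of_nonneg_left (b5 X) hq))
      (by
        rintro w hw f ⟨a1, a2, a3, Ψ', a4, a5⟩
        refine ⟨a1.uact w, ?_, by rwa [uact_apply_one], uact w Ψ', hst w hw _ a4, a5.uact w⟩
        have := a2.uact w
        rwa [hTi w hw] at this)
      (fun f hf => ⟨hf.1, hf.2.1⟩)
    obtain ⟨a1, a2, a3, Ψ', a4, a5⟩ := hfK
    have := hcen Ψ' a4 f a1 hfi a5
    rw [this] at a3
    exact absurd hc (not_lt.mpr a3)
  · push Not at hcase
    have hsmall : ∀ t : ℝ, 0 < t → t ≤ 1 → T 1 ≤ 3 * ms.length * t := by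
      intro t ht0 ht1
      obtain ⟨_, ⟨k, l, hk, hl, hkl, rfl⟩, hlt⟩ := hcase (t ^ 4) (by positivity)
      obtain ⟨s, hs, hTs, hΨs⟩ := exists_res_le hp (hpos Ψ hΨ).2 hT hTt hk hl hkl ht0
        (by linarith [hT.nonneg hl]) (by linarith [hp.nonneg hk])
      set L := (ms.map fun m => star m * s * m).sum
      have hL : 0 ≤ L := list_conj_sum_nonneg hs ms
      have h1 : T (1 - res L) ≤ ms.length * T s :=
        (hT.mono (one_sub_res_le hL)).trans_eq (hT.tracial_list_conj_sum hTt s hms)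
      obtain ⟨X, hX, hXr⟩ := exists_sqrt_of_nonneg (res_nonneg hL)
      have h2 := hTle X
      rw [hX.star_eq, hXr] at h2
      have h3 := PosFun.list_sum_le (F := Ψ) ms (res L) (c := Ψ (res s)) fun m hm => by
        refine hp.mono ?_
        have h4 := star_right_conjugate_le_conjugate (res_antitone
          (star_left_conjugate_nonneg hs m) (le_list_conj_sum hs hm)) m
        rw [res_conj hs (hms m hm).1 (hms m hm).2] at h4
        refine h4.trans_eq ?_
        calc m * (star m * res s * m) * star m = (m * star m) * res s * (m * star m) := by
              noncomm_ring
          _ = res s := by rw [(hms m hm).2, one_mul, mul_one]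
      rw [hT.map_sub] at h1
      have hn : (0 : ℝ) ≤ ms.length := Nat.cast_nonneg _
      have h5 : (ms.length : ℝ) * Ψ (res s) ≤ ms.length * (2 * t) :=
        mul_le_mul_of_nonneg_left (by nlinarith) hn
      have h7 := mul_nonneg hn ht0.le
      have h6 : (ms.length : ℝ) * T s ≤ ms.length * t :=
        mul_le_mul_of_nonneg_left (by nlinarith) hn
      linarith
    have hT0 : T 1 ≤ 0 := by
      refine le_of_forall_pos_le_add fun ε hε => ?_
      rw [zero_add]
      have hn : (0 : ℝ) ≤ ms.length := Nat.cast_nonneg _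
      refine (hsmall (min 1 (ε / (3 * ms.length + 1))) (by positivity) (min_le_left _ _)).trans ?_
      calc 3 * (ms.length : ℝ) * min 1 (ε / (3 * ms.length + 1))
          ≤ (3 * ms.length + 1) * (ε / (3 * ms.length + 1)) :=
            mul_le_mul (by linarith) (min_le_right _ _) (by positivity) (by positivity)
        _ = ε := by field_simp
    refine hτ.eq_zero ?_
    linarith [hτ.one_nonneg]

end NoTrace

section ExpIdeal
variable {A : Type*} [CStarAlgebra A]

theorem IsClosedTwoSidedIdeal.pow_sub_pow_mem {J : Submodule ℂ A} (hJ : IsClosedTwoSidedIdeal J)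
    {a b : A} (h : a - b ∈ J) (n : ℕ) : a ^ n - b ^ n ∈ J := by
  induction n with
  | zero => simp
  | succ n ih =>
    have : a ^ (n + 1) - b ^ (n + 1) = (a ^ n - b ^ n) * a + b ^ n * (a - b) := by
      rw [pow_succ, pow_succ]; noncomm_ring
    rw [this]
    exact add_mem (hJ.2 _ _ ih).2 (hJ.2 _ _ h).1

theorem IsClosedTwoSidedIdeal.exp_sub_exp_mem {J : Submodule ℂ A} (hJ : IsClosedTwoSidedIdeal J)
    {a b : A} (h : a - b ∈ J) : NormedSpace.exp a - NormedSpace.exp b ∈ J := by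
  have h1 := (NormedSpace.exp_series_hasSum_exp' (𝕂 := ℂ) a).sub
    (NormedSpace.exp_series_hasSum_exp' (𝕂 := ℂ) b)
  refine hJ.1.mem_of_tendsto h1 (Filter.Eventually.of_forall fun s => sum_mem fun n _ => ?_)
  rw [← smul_sub]
  exact J.smul_mem _ (hJ.pow_sub_pow_mem h n)

theorem exists_exp_sub_one (x : A) :
    ∃ Z : A, NormedSpace.exp x - 1 = x * Z ∧ ‖Z‖ ≤ Real.exp ‖x‖ := by
  nontriviality A
  have hb : ∀ n : ℕ, ‖(((n + 1).factorial : ℂ))⁻¹ • x ^ n‖ ≤ ‖x‖ ^ n / n.factorial := by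
    intro n
    rw [norm_smul, norm_inv, Complex.norm_natCast, div_eq_inv_mul]
    have h1 : ((n.factorial : ℕ) : ℝ) ≤ ((n + 1).factorial : ℕ) := by
      exact_mod_cast Nat.factorial_le n.le_succ
    have h2 : (0 : ℝ) < n.factorial := by positivity
    gcongr
    exact norm_pow_le x n
  have hs : Summable fun n : ℕ => ((((n + 1).factorial : ℂ))⁻¹ • x ^ n) :=
    Summable.of_norm_bounded (Real.summable_pow_div_factorial ‖x‖) hb
  refine ⟨∑' n : ℕ, ((((n + 1).factorial : ℂ))⁻¹ • x ^ n), ?_, ?_⟩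
  · have h1 := (hasSum_nat_add_iff' 1).mpr (NormedSpace.exp_series_hasSum_exp' (𝕂 := ℂ) x)
    have h2 := hs.hasSum.mul_left x
    simp only [Finset.sum_range_one, Nat.factorial_zero, Nat.cast_one, inv_one, pow_zero,
      one_smul] at h1
    refine h1.unique ?_
    have e : (fun n : ℕ => (((n + 1).factorial : ℂ))⁻¹ • x ^ (n + 1)) =
        fun n : ℕ => x * ((((n + 1).factorial : ℂ))⁻¹ • x ^ n) := by
      ext n
      rw [mul_smul_comm, pow_succ']
    rwa [e]
  · rw [Real.exp_eq_exp_ℝ]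
    have h3 : HasSum (fun n : ℕ => ‖x‖ ^ n / n.factorial) (NormedSpace.exp ‖x‖) := by
      have := NormedSpace.exp_series_hasSum_exp' (𝕂 := ℝ) ‖x‖
      simpa [div_eq_inv_mul] using this
    exact tsum_of_norm_bounded h3 hb

end ExpIdeal

section KerIdeal
variable {A : Type*} [CStarAlgebra A] {B : Type*} [CStarAlgebra B] {φ : A →⋆ₐ[ℂ] B}

/-- The largest two-sided ideal of `A` annihilated by the positive functional `Φ`. -/
def kerIdeal (φ : A →⋆ₐ[ℂ] B) {Φ : B → ℝ} (hΦ : PosFun Φ) : Submodule ℂ A where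
  carrier := {z | ∀ p q : A, Φ (φ (p * z * q)) = 0}
  zero_mem' := by simp [hΦ.map_zero]
  add_mem' := by
    intro x y hx hy p q
    rw [mul_add, add_mul, map_add, hΦ.map_add, hx, hy, add_zero]
  smul_mem' := by
    intro c x hx p q
    have : p * (c • x) * q = p * x * (c • q) := by simp
    rw [this]
    exact hx _ _

variable {Φ : B → ℝ} (hΦ : PosFun Φ)
include hΦ

theorem mem_kerIdeal {z : A} : z ∈ kerIdeal φ hΦ ↔ ∀ p q : A, Φ (φ (p * z * q)) = 0 := Iff.rfl

theorem isClosedTwoSidedIdeal_kerIdeal : IsClosedTwoSidedIdeal (kerIdeal φ hΦ) := by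
  constructor
  · have : ((kerIdeal φ hΦ : Submodule ℂ A) : Set A) =
      ⋂ p : A, ⋂ q : A, (fun z => Φ (φ (p * z * q))) ⁻¹' {0} := by
      ext z; simp [mem_kerIdeal]
    rw [this]
    refine isClosed_iInter fun p => isClosed_iInter fun q => isClosed_singleton.preimage ?_
    exact (hΦ.comp φ).continuous.comp (by fun_prop)
  · intro a b hb
    refine ⟨fun p q => ?_, fun p q => ?_⟩
    · rw [← mul_assoc]; exact hb _ _
    · rw [← mul_assoc, mul_assoc]; exact hb _ _

theorem star_mem_kerIdeal {z : A} (hz : z ∈ kerIdeal φ hΦ) : star z ∈ kerIdeal φ hΦ := by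
  intro p q
  rw [← hΦ.map_star, ← map_star]
  have := hz (star q) (star p)
  simpa [mul_assoc] using this

theorem kerIdeal_mul_left {z : A} (hz : z ∈ kerIdeal φ hΦ) (Y : B) : Φ (φ z * Y) = 0 := by
  have h := hΦ.cauchy_schwarz Y (φ (star z))
  have h2 : Φ (star (φ (star z)) * φ (star z)) = 0 := by
    rw [← map_star, star_star, ← map_mul]
    simpa using hz 1 (star z)
  rw [h2, zero_mul, ← map_star, star_star] at h
  exact pow_eq_zero_iff two_ne_zero |>.mp (le_antisymm h (sq_nonneg _))

theorem kerIdeal_mul_right {z : A} (hz : z ∈ kerIdeal φ hΦ) (Y : B) : Φ (Y * φ z) = 0 := by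
  rw [← hΦ.map_star, star_mul, ← map_star]
  exact kerIdeal_mul_left hΦ (star_mem_kerIdeal hΦ hz) _

theorem kerIdeal_conj_eq {w u : A} (h : w - u ∈ kerIdeal φ hΦ) (X : B) :
    Φ (φ w * X * star (φ w)) = Φ (φ u * X * star (φ u)) := by
  have e : φ w * X * star (φ w) = φ u * X * star (φ u) + (φ (w - u) * (X * star (φ w))
      + φ u * X * φ (star (w - u))) := by
    simp only [map_sub, star_sub, map_star]; noncomm_ring
  rw [e, hΦ.map_add, hΦ.map_add, kerIdeal_mul_left hΦ h,
    kerIdeal_mul_right hΦ (star_mem_kerIdeal hΦ h), add_zero, add_zero]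

theorem kerIdeal_uact {w : unitary B} {u : A} (hw : (w : B) = φ u) :
    kerIdeal φ hΦ ≤ kerIdeal φ (hΦ.uact w) := by
  intro z hz p q
  have := hz (u * p) (q * star u)
  rw [uact_apply, hw, ← map_star, ← map_mul, ← map_mul]
  simpa [mul_assoc] using this

end KerIdeal

section Decouple
variable {A : Type*} [CStarAlgebra A] {B : Type*} [CStarAlgebra B] {φ : A →⋆ₐ[ℂ] B}

theorem PosFun.abs_conj_sub_le {Θ : B → ℝ} (hΘ : PosFun Θ) {w : B}
    (hw : w * star w = 1) (X : B) : |Θ (w * X * star w) - Θ X| ≤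
      2 * ‖X‖ * √(Θ ((w - 1) * star (w - 1)) * Θ 1) := by
  set N := w - 1
  have hwN : w = 1 + N := by simp [N]
  have e : w * X * star w = X + (N * (X * star w) + star (N * star X)) := by
    rw [hwN]; simp only [star_add, star_one, star_mul, star_star]; noncomm_ring
  have key : ∀ Y : B, Θ (star Y * Y) ≤ ‖X‖ ^ 2 * Θ 1 →
      |Θ (N * Y)| ≤ ‖X‖ * √(Θ (N * star N) * Θ 1) := by
    intro Y hY
    have h := hΘ.cauchy_schwarz Y (star N)
    rw [star_star] at h
    have h0 : 0 ≤ Θ (N * star N) := by simpa using hΘ.nonneg' (star N)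
    refine Real.abs_le_sqrt h |>.trans ?_
    refine (Real.sqrt_le_sqrt (mul_le_mul_of_nonneg_left hY h0)).trans_eq ?_
    rw [show Θ (N * star N) * (‖X‖ ^ 2 * Θ 1) = ‖X‖ ^ 2 * (Θ (N * star N) * Θ 1) by ring,
      Real.sqrt_mul (by positivity), Real.sqrt_sq (norm_nonneg _)]
  have h1 := key (X * star w) (by
    have e1 : star (X * star w) * (X * star w) = (w * (star X * X) * star w) := by
      simp [mul_assoc]
    rw [e1]
    have := (hΘ.conj' w).star_mul_le X
    rwa [mul_one, hw] at this)
  have h2 := key (star X) (by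
    have := hΘ.star_mul_le (star X)
    rwa [norm_star] at this)
  rw [e, hΘ.map_add, hΘ.map_add, hΘ.map_star (N * star X)]
  rw [_root_.abs_le] at h1 h2 ⊢
  constructor <;> linarith [h1.1, h1.2, h2.1, h2.2]

variable [PartialOrder A] [StarOrderedRing A]

theorem exists_decoupled_exp {Φ Θ : B → ℝ} (hΦ : PosFun Φ) (hΘ : PosFun Θ)
    (h : ∀ ε > 0, ∃ s, 0 ≤ s ∧ s ∈ kerIdeal φ hΦ ∧ Θ (φ (res s)) ≤ ε)
    (t : selfAdjoint A) {w : unitary B} (hw : (w : B) = φ (selfAdjoint.expUnitary t)) {ε : ℝ}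
    (hε : 0 < ε) : ∃ v ∈ imGroup φ, uact v Φ = uact w Φ ∧
      ∀ X, |uact v Θ X - Θ X| ≤ ‖X‖ * ε := by
  set K : ℝ := 4 * (‖(t : A)‖ * Real.exp ‖(t : A)‖) ^ 2 * (Θ 1) + 1
  have hK : 0 < K := by have := hΘ.one_nonneg; positivity
  obtain ⟨s, hs, hsk, hsΘ⟩ := h (ε ^ 2 / K) (by positivity)
  set d := res s
  have hd : IsSelfAdjoint d := isSelfAdjoint_res hs
  have hd1 : ‖d‖ ≤ 1 := (CStarAlgebra.norm_le_one_iff_of_nonneg _ (res_nonneg hs)).mpr (res_le_one hs)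
  have htd : IsSelfAdjoint (d * t * d) := by
    have := t.2.conjugate d
    rwa [hd.star_eq] at this
  let t' : selfAdjoint A := ⟨d * t * d, htd⟩
  have hJ := isClosedTwoSidedIdeal_kerIdeal (φ := φ) hΦ
  have hsub : (selfAdjoint.expUnitary t' : A) - selfAdjoint.expUnitary t ∈ kerIdeal φ hΦ := by
    rw [selfAdjoint.expUnitary_coe, selfAdjoint.expUnitary_coe]
    apply hJ.exp_sub_exp_mem
    rw [← smul_sub]
    apply Submodule.smul_mem
    have he : (1 - d) ∈ kerIdeal φ hΦ := by
      rw [← res_mul_self hs]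
      exact (hJ.2 _ _ hsk).1
    have : (t' : A) - t = -((1 - d) * (t * d) + t * (1 - d)) := by
      simp only [t']; noncomm_ring
    rw [this]
    exact neg_mem (add_mem (hJ.2 _ _ he).2 (hJ.2 _ _ he).1)
  obtain ⟨v, hv, hvw⟩ := mem_imGroup (φ := φ) (u := selfAdjoint.expUnitary t')
    (Subgroup.subset_closure ⟨_, rfl⟩)
  refine ⟨v, hv, ?_, fun X => ?_⟩
  · ext X
    rw [uact_apply, uact_apply, hvw, hw]
    exact kerIdeal_conj_eq hΦ hsub X
  · rw [uact_apply]
    refine (hΘ.abs_conj_sub_le (Unitary.coe_mul_star_self v) X).trans ?_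
    obtain ⟨Z, hZ, hZn⟩ := exists_exp_sub_one (Complex.I • (t' : A))
    rw [← selfAdjoint.expUnitary_coe] at hZ
    have ht' : ‖Complex.I • (t' : A)‖ ≤ ‖(t : A)‖ := by
      rw [norm_smul, Complex.norm_I, one_mul]
      calc ‖d * t * d‖ ≤ ‖d‖ * ‖(t : A)‖ * ‖d‖ := norm_mul₃_le
        _ ≤ 1 * ‖(t : A)‖ * 1 := by gcongr
        _ = _ := by ring
    set M : A := Complex.I • ((t : A) * d * Z)
    have hM : ‖M‖ ≤ ‖(t : A)‖ * Real.exp ‖(t : A)‖ := by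
      rw [norm_smul, Complex.norm_I, one_mul]
      calc ‖(t : A) * d * Z‖ ≤ ‖(t : A)‖ * ‖d‖ * ‖Z‖ := norm_mul₃_le
        _ ≤ ‖(t : A)‖ * 1 * Real.exp ‖(t : A)‖ := by
          gcongr
          exact hZn.trans (Real.exp_le_exp.mpr ht')
        _ = _ := by ring
    have e : (v : B) - 1 = φ (d * M) := by
      rw [hvw, ← map_one φ, ← map_sub, hZ]
      congr 1
      simp only [t', M, mul_smul_comm, smul_mul_assoc, mul_assoc]
    have hN : Θ (((v : B) - 1) * star ((v : B) - 1)) ≤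
        (‖(t : A)‖ * Real.exp ‖(t : A)‖) ^ 2 * (ε ^ 2 / K) := by
      rw [e, ← map_star, ← map_mul]
      have e2 : d * M * star (d * M) = star d * (M * star M) * d := by
        simp [hd.star_eq, mul_assoc]
      rw [e2]
      refine ((hΘ.comp φ).conj_le _ _).trans ?_
      have h3 : Θ (φ (star d * d)) ≤ ε ^ 2 / K := by
        rw [hd.star_eq]
        exact ((hΘ.comp φ).mono (sq_res_le hs)).trans hsΘ
      have h4 : 0 ≤ Θ (φ (star d * d)) := (hΘ.comp φ).nonneg' d
      have h5 : ‖M * star M‖ ≤ (‖(t : A)‖ * Real.exp ‖(t : A)‖) ^ 2 := by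
        rw [CStarRing.norm_self_mul_star, ← sq]
        gcongr
      exact mul_le_mul h5 h3 h4 (by positivity)
    have h6 : √(Θ (((v : B) - 1) * star ((v : B) - 1)) * Θ 1) ≤ ε / 2 := by
      rw [Real.sqrt_le_left (by positivity)]
      calc _ ≤ ((‖(t : A)‖ * Real.exp ‖(t : A)‖) ^ 2 * (ε ^ 2 / K)) * Θ 1 :=
            mul_le_mul_of_nonneg_right hN hΘ.one_nonneg
        _ = (ε ^ 2 / 4) * ((4 * (‖(t : A)‖ * Real.exp ‖(t : A)‖) ^ 2 * Θ 1) / K) := by ring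
        _ ≤ (ε ^ 2 / 4) * 1 := by
          gcongr
          rw [div_le_one hK]
          simp [K]
        _ = (ε / 2) ^ 2 := by ring
    calc _ ≤ 2 * ‖X‖ * (ε / 2) := by gcongr
      _ = _ := by ring

theorem decoupled_exp_mem {Φ Θ : B → ℝ} (hΦ : PosFun Φ) (hΘ : PosFun Θ)
    (h : ∀ ε > 0, ∃ s, 0 ≤ s ∧ s ∈ kerIdeal φ hΦ ∧ Θ (φ (res s)) ≤ ε)
    {P : Set (B → ℝ)} (hPc : IsClosed P) (hP : UStable (imGroup φ) P) (hm : Φ + Θ ∈ P)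
    (t : selfAdjoint A) {w : unitary B} (hw : (w : B) = φ (selfAdjoint.expUnitary t)) :
    uact w Φ + Θ ∈ P := by
  choose v hv hvΦ hvΘ using fun n : ℕ =>
    exists_decoupled_exp hΦ hΘ h t hw (Nat.one_div_pos_of_nat (α := ℝ) (n := n))
  refine hPc.mem_of_tendsto (f := fun n => uact (v n) (Φ + Θ)) (b := Filter.atTop) ?_
    (Filter.Eventually.of_forall fun n => hP _ (hv n) _ hm)
  rw [tendsto_pi_nhds]
  intro X
  have e : ∀ n, uact (v n) (Φ + Θ) X = uact w Φ X + uact (v n) Θ X := fun n => by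
    rw [uact_add, hvΦ]; rfl
  simp only [e]
  refine Filter.Tendsto.const_add _ ?_
  rw [tendsto_iff_norm_sub_tendsto_zero]
  refine squeeze_zero (fun _ => norm_nonneg _) (fun n => hvΘ n X) ?_
  simpa using (tendsto_one_div_add_atTop_nhds_zero_nat (𝕜 := ℝ)).const_mul ‖X‖

/-- If a positive functional splits as a sum of two parts carried by orthogonal ideals, the parts
may be rotated independently. -/
theorem decoupled_mem {Φ Θ : B → ℝ} (hΦ : PosFun Φ) (hΘ : PosFun Θ)
    (h : ∀ ε > 0, ∃ s, 0 ≤ s ∧ s ∈ kerIdeal φ hΦ ∧ Θ (φ (res s)) ≤ ε)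
    {P : Set (B → ℝ)} (hPc : IsClosed P) (hP : UStable (imGroup φ) P) (hm : Φ + Θ ∈ P)
    {w : unitary B} (hw : w ∈ imGroup φ) : uact w Φ + Θ ∈ P := by
  obtain ⟨u, hu, hwu⟩ := exists_of_mem_imGroup hw
  clear hw
  induction hu using Subgroup.closure_induction'' generalizing w Φ with
  | mem x hx =>
    obtain ⟨t, rfl⟩ := hx
    exact decoupled_exp_mem hΦ hΘ h hPc hP hm t hwu
  | inv_mem x hx =>
    obtain ⟨t, rfl⟩ := hx
    refine decoupled_exp_mem hΦ hΘ h hPc hP hm (-t) ?_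
    have h0 : selfAdjoint.expUnitary t * selfAdjoint.expUnitary (-t) = 1 := by
      rw [← Commute.expUnitary_add (by simp), add_neg_cancel, selfAdjoint.expUnitary_zero]
    rw [hwu, inv_eq_of_mul_eq_one_right h0]
  | one =>
    have : w = 1 := Subtype.ext (by simpa using hwu)
    rw [this, uact_one]
    exact hm
  | mul x y hx hy ihx ihy =>
    obtain ⟨wx, -, hwx⟩ := mem_imGroup (φ := φ) hx
    obtain ⟨wy, -, hwy⟩ := mem_imGroup (φ := φ) hy
    have : w = wx * wy := Subtype.ext (by simp [hwu, hwx, hwy])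
    rw [this, uact_mul]
    refine ihy (hΦ.uact wx) (fun ε hε => ?_) (ihx hΦ h hm hwx) hwy
    obtain ⟨s, hs, hsk, hsΘ⟩ := h ε hε
    exact ⟨s, hs, kerIdeal_uact hΦ hwx hsk, hsΘ⟩

end Decouple

section ResolventDifference
variable {A : Type*} [CStarAlgebra A] [PartialOrder A] [StarOrderedRing A]

theorem one_add_norm_smul_res_le {j : A} (hj : 0 ≤ j) :
    j ≤ (1 + ‖j‖) • (j - j * res j * j) := by
  set k := 1 - res j
  have hk : 0 ≤ k := sub_nonneg.mpr (res_le_one hj)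
  have h1 : j - j * res j * j = k := by
    rw [mul_assoc, res_mul_self hj, mul_sub, mul_one, self_mul_res hj]
    simp [k]
  have h2 : j = k * (1 + j) := by
    simp only [k, sub_mul, one_mul, res_mul hj]; abel
  have hc : Commute k (algebraMap ℝ A ‖j‖ - j) := by
    refine (Algebra.commute_algebraMap_right _ _).sub_right ?_
    refine (Commute.one_left j).sub_left ?_
    show res j * j = j * res j
    rw [res_mul_self hj, self_mul_res hj]
  have h3 : 0 ≤ k * (algebraMap ℝ A ‖j‖ - j) :=
    hc.mul_nonneg hk (sub_nonneg.mpr (IsSelfAdjoint.le_algebraMap_norm_self hj.isSelfAdjoint))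
  rw [h1, ← sub_nonneg]
  have : (1 + ‖j‖) • k - j = k * (algebraMap ℝ A ‖j‖ - j) := by
    have h2' : k * j = j - k := by
      rw [mul_add, mul_one] at h2
      exact (sub_eq_of_eq_add' h2).symm
    rw [add_smul, one_smul, mul_sub, ← Algebra.commutes, ← Algebra.smul_def, h2']
    abel
  rwa [this]

theorem res_mul_mul_res_le {s j : A} (hs : 0 ≤ s) (hj : 0 ≤ j) :
    res s * j * res s ≤ (1 + ‖j‖) • (res s - res (s + j)) := by
  have hsj : 0 ≤ s + j := add_nonneg hs hj
  set d := res s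
  set D := res (s + j)
  have hd : IsSelfAdjoint d := isSelfAdjoint_res hs
  have h1 : d - D = d * j * D := by
    have e1 : d * (1 + (s + j)) * D = d := by rw [mul_assoc, mul_res hsj, mul_one]
    have e2 : d * (1 + (s + j)) = 1 + d * j := by rw [← add_assoc, mul_add, res_mul hs]
    rw [e2, add_mul, one_mul] at e1
    exact sub_eq_of_eq_add' e1.symm
  have h2 : d - D = D * j * d := by
    have e1 : D * (1 + (s + j)) * d = d := by rw [res_mul hsj, one_mul]
    have e2 : D * (1 + (s + j)) * d = D * ((1 + s) * d) + D * j * d := by noncomm_ring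
    rw [e2, mul_res hs, mul_one] at e1
    exact sub_eq_of_eq_add' e1.symm
  have h3 : d - D = d * (j - j * D * j) * d := by
    have : D = d - D * j * d := by rw [← h2]; abel
    calc d - D = d * j * D := h1
      _ = d * j * (d - D * j * d) := by rw [← this]
      _ = _ := by noncomm_ring
  have h4 : j * D * j ≤ j * res j * j := by
    have := res_antitone hj (le_add_of_nonneg_left hs : j ≤ s + j)
    have h := star_left_conjugate_le_conjugate this j
    rwa [hj.isSelfAdjoint.star_eq] at h
  have h5 : j ≤ (1 + ‖j‖) • (j - j * D * j) :=
    (one_add_norm_smul_res_le hj).trans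
      (smul_le_smul_of_nonneg_left (sub_le_sub_left h4 j) (by positivity))
  have h6 := star_left_conjugate_le_conjugate h5 d
  rw [hd.star_eq] at h6
  rw [h3]
  simpa only [mul_smul_comm, smul_mul_assoc] using h6

end ResolventDifference

section SquareSet
variable {A : Type*} [CStarAlgebra A]

/-- Finite sums of elements `y* h* h y`. -/
def sqSet (h : A) : Set A := Set.range fun l : List A => sqL (l.map (h * ·))

variable {h s j : A}

theorem add_mem_sqSet (hs : s ∈ sqSet h) (hj : j ∈ sqSet h) : s + j ∈ sqSet h := by
  obtain ⟨l, rfl⟩ := hs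
  obtain ⟨l', rfl⟩ := hj
  exact ⟨l ++ l', by simp [sqL_append]⟩

theorem conj_mem_sqSet (hs : s ∈ sqSet h) (z : A) : star z * s * z ∈ sqSet h := by
  obtain ⟨l, rfl⟩ := hs
  refine ⟨l.map (· * z), ?_⟩
  simp only [← sqL_map_mul_right, List.map_map]
  congr 2
  ext; simp [mul_assoc]

theorem conj_mem_sqSet' (hs : s ∈ sqSet h) (z : A) : z * s * star z ∈ sqSet h := by
  simpa using conj_mem_sqSet hs (star z)

theorem zero_mem_sqSet (h : A) : 0 ∈ sqSet h := ⟨[], by simp⟩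

theorem mem_sqSet (h q : A) : star (h * q) * (h * q) ∈ sqSet h := ⟨[q], by simp⟩

theorem IsClosedTwoSidedIdeal.sqSet_subset {J : Submodule ℂ A} (hJ : IsClosedTwoSidedIdeal J)
    (hh : h ∈ J) (hs : s ∈ sqSet h) : s ∈ J := by
  obtain ⟨l, rfl⟩ := hs
  induction l with
  | nil => simp
  | cons a l ih =>
    simp only [List.map_cons, sqL_cons]
    exact add_mem (hJ.2 _ _ (hJ.2 _ _ hh).2).1 ih

theorem sqSet_nonneg [PartialOrder A] [StarOrderedRing A] (hs : s ∈ sqSet h) : 0 ≤ s := by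
  obtain ⟨l, rfl⟩ := hs
  exact sqL_nonneg _

end SquareSet

section Split
open Filter Topology
variable {A : Type*} [CStarAlgebra A] {B : Type*} [CStarAlgebra B] {φ : A →⋆ₐ[ℂ] B} {e : B}

/-- Conjugation by `X` maps the image of `sqSet h` below itself. -/
def SqBounded (φ : A →⋆ₐ[ℂ] B) (h : A) (X : B) : Prop :=
  ∀ s ∈ sqSet h, ∃ j ∈ sqSet h, ∀ F : B → ℝ, PosFun F → F (X * φ s * star X) ≤ F (φ j)

theorem sqBounded_map (h z : A) : SqBounded φ h (φ z) := fun s hs =>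
  ⟨_, conj_mem_sqSet' hs z, fun F _ => by simp [map_star]⟩

theorem PosFun.add_conj_le {F : B → ℝ} (hF : PosFun F) (p q : B) :
    F ((p + q) * star (p + q)) ≤ 2 * F (p * star p) + 2 * F (q * star q) := by
  have h := hF.nonneg' (star (p - q))
  have e1 : (p + q) * star (p + q) + star (star (p - q)) * star (p - q) =
      (2 : ℝ) • (p * star p) + (2 : ℝ) • (q * star q) := by
    simp only [star_star, star_add, star_sub, two_smul]; noncomm_ring
  have e2 := congrArg F e1
  simp only [hF.map_add, hF.map_smul] at e2
  linarith

variable [PartialOrder A] [StarOrderedRing A]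

theorem PosFun.hat_conj_le (he : IsMatUnit φ e) (z : A) {s : A} (hs : 0 ≤ s) {F : B → ℝ}
    (hF : PosFun F) : F (hat φ e z * φ s * star (hat φ e z)) ≤
      2 * F (φ (z * s * star z)) + 2 * F (φ (star z * s * z)) := by
  obtain ⟨t, ht, rfl⟩ := exists_sqrt_of_nonneg hs
  have e1 : hat φ e z * φ (t * t) * star (hat φ e z) =
      (e * φ (z * t) + star e * φ (star z * t)) *
        star (e * φ (z * t) + star e * φ (star z * t)) := by
    have : hat φ e z * φ t = e * φ (z * t) + star e * φ (star z * t) := by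
      simp [hat, add_mul, mul_assoc]
    rw [← this, star_mul, ← StarHomClass.map_star, ht.star_eq, map_mul]; noncomm_ring
  have key : ∀ k : A, F (e * φ k * star (e * φ k)) ≤ F (φ (k * star k)) ∧
      F (star e * φ k * star (star e * φ k)) ≤ F (φ (k * star k)) := by
    intro k
    have h1 : φ (k * star k) = e * φ k * star (e * φ k) + star e * φ k * star (star e * φ k) := by
      have : φ (k * star k) = φ (k * star k) * (e * star e + star e * e) := by
        rw [he.one, mul_one]
      rw [this, mul_add, ← mul_assoc, ← mul_assoc, he.comm, he.comm']
      simp only [star_mul, star_star, ← StarHomClass.map_star, map_mul]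
      congr 1
      · rw [mul_assoc, he.comm']; simp only [mul_assoc, he.comm']
      · rw [mul_assoc, he.comm]; simp only [mul_assoc, he.comm]
    have h2 := congrArg F h1
    rw [hF.map_add] at h2
    have h3 : 0 ≤ F (e * φ k * star (e * φ k)) := by simpa using hF.nonneg' (star (e * φ k))
    have h4 : 0 ≤ F (star e * φ k * star (star e * φ k)) := by
      simpa using hF.nonneg' (star (star e * φ k))
    constructor <;> linarith
  rw [e1]
  refine (hF.add_conj_le _ _).trans ?_
  have k1 := (key (z * t)).1
  have k2 := (key (star z * t)).2
  have e2 : z * t * star (z * t) = z * (t * t) * star z := by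
    simp [ht.star_eq, mul_assoc]
  have e3 : star z * t * star (star z * t) = star z * (t * t) * z := by
    simp [ht.star_eq, mul_assoc]
  rw [e2] at k1
  rw [e3] at k2
  linarith

theorem sqBounded_hat (he : IsMatUnit φ e) (h z : A) : SqBounded φ h (hat φ e z) := by
  intro s hs
  have hk := add_mem_sqSet (conj_mem_sqSet' hs z) (conj_mem_sqSet hs z)
  refine ⟨_, add_mem_sqSet hk hk, fun F hF => (hF.hat_conj_le he z (sqSet_nonneg hs)).trans ?_⟩
  simp only [_root_.map_add, hF.map_add]
  linarith

end Split

section Split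
open Filter Topology
variable {A : Type*} [CStarAlgebra A] {B : Type*} [CStarAlgebra B] {φ : A →⋆ₐ[ℂ] B} {e : B}
variable [PartialOrder A] [StarOrderedRing A]

theorem PosFun.mul_self_le {F : A → ℝ} (hF : PosFun F) {k : A} (hk : 0 ≤ k) (hk1 : k ≤ 1) :
    F (k * k) ≤ F k := by
  obtain ⟨t, ht, rfl⟩ := exists_sqrt_of_nonneg hk
  have h := hF.conj_le (t * t) t
  rw [ht.star_eq] at h
  have h1 := (CStarAlgebra.norm_le_one_iff_of_nonneg _ hk).mpr hk1
  have h2 : 0 ≤ F (t * t) := hF.nonneg hk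
  calc _ = F (t * (t * t) * t) := by simp [mul_assoc]
    _ ≤ _ := h
    _ ≤ _ := mul_le_of_le_one_left h2 h1

theorem star_map_res {s : A} (hs : 0 ≤ s) : star (φ (res s)) = φ (res s) := by
  rw [← map_star, (isSelfAdjoint_res hs).star_eq]

theorem PosFun.conj_res {Ψ : B → ℝ} (hΨ : PosFun Ψ) {s : A} (hs : 0 ≤ s) :
    PosFun fun X => Ψ (φ (res s) * X * φ (res s)) := by
  have := hΨ.conj (φ (res s))
  rwa [star_map_res hs] at this

theorem PosFun.conj_one_sub_res {Ψ : B → ℝ} (hΨ : PosFun Ψ) {s : A} (hs : 0 ≤ s) :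
    PosFun fun X => Ψ (φ (1 - res s) * X * φ (1 - res s)) := by
  have := hΨ.conj (φ (1 - res s))
  rwa [← StarHomClass.map_star, ((IsSelfAdjoint.one A).sub (isSelfAdjoint_res hs)).star_eq] at this

variable {Ψ : B → ℝ} (hΨ : PosFun Ψ) (hΨ1 : Ψ 1 = 1)
include hΨ hΨ1

theorem PosFun.map_res_le_one {s : A} (hs : 0 ≤ s) : Ψ (φ (res s)) ≤ 1 := by
  have := (hΨ.comp φ).mono (res_le_one hs)
  simpa [hΨ1] using this

theorem PosFun.conj_res_one_le {s : A} (hs : 0 ≤ s) : Ψ (φ (res s) * 1 * φ (res s)) ≤ 1 := by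
  rw [mul_one, ← map_mul]
  exact ((hΨ.comp φ).mono (sq_res_le hs)).trans (hΨ.map_res_le_one hΨ1 hs)

theorem cross_bound_of_norm {s : A} (hs : 0 ≤ s) (X : B) {k : A} (hk : 0 ≤ k) (hk1 : k ≤ 1) :
    |Ψ (φ (res s) * X * φ k)| ≤ ‖X‖ * √(Ψ (φ k)) := by
  have h := hΨ.cauchy_schwarz (φ k) (star (φ (res s) * X))
  rw [star_star] at h
  have h1 : Ψ (φ (res s) * X * star (φ (res s) * X)) ≤ ‖X‖ ^ 2 := by
    have h2 := (hΨ.conj_res (φ := φ) hs).star_mul_le (star X)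
    simp only [star_star, norm_star] at h2
    have h3 := hΨ.conj_res_one_le (φ := φ) hΨ1 hs
    have e : φ (res s) * X * star (φ (res s) * X) = φ (res s) * (X * star X) * φ (res s) := by
      rw [star_mul, star_map_res hs]; noncomm_ring
    rw [e]
    exact h2.trans (mul_le_of_le_one_right (by positivity) h3)
  have h4 : Ψ (star (φ k) * φ k) ≤ Ψ (φ k) := by
    rw [← map_star, hk.isSelfAdjoint.star_eq, ← map_mul]
    exact (hΨ.comp φ).mul_self_le hk hk1
  have h5 : 0 ≤ Ψ (star (φ k) * φ k) := hΨ.nonneg' _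
  refine (Real.abs_le_sqrt (h.trans (mul_le_mul h1 h4 h5 (by positivity)))).trans_eq ?_
  rw [Real.sqrt_mul (by positivity), Real.sqrt_sq (norm_nonneg _)]

theorem cross_bound_of_sqBounded {h : A} {X : B} (hX : SqBounded φ h X) {ν : ℝ}
    (hν : ∀ s ∈ sqSet h, ν ≤ Ψ (φ (res s))) {s₀ : A} (hs₀ : s₀ ∈ sqSet h) :
    ∃ C : ℝ, 0 ≤ C ∧ ∀ s ∈ sqSet h,
      |Ψ (φ (res s) * X * φ (1 - res s₀))| ≤ √(C * (Ψ (φ (res s)) - ν)) := by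
  obtain ⟨j, hj, hjF⟩ := hX s₀ hs₀
  refine ⟨1 + ‖j‖, by positivity, fun s hs => Real.abs_le_sqrt ?_⟩
  have hsp := sqSet_nonneg hs
  have hs₀p := sqSet_nonneg hs₀
  have he0 : 0 ≤ 1 - res s₀ := sub_nonneg.mpr (res_le_one hs₀p)
  have h1 := hΨ.cauchy_schwarz (1 : B) (star (φ (res s) * X * φ (1 - res s₀)))
  rw [star_star, mul_one, star_one, one_mul, hΨ1, mul_one] at h1
  refine h1.trans ?_
  have e : φ (res s) * X * φ (1 - res s₀) * star (φ (res s) * X * φ (1 - res s₀)) =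
      φ (res s) * (X * φ ((1 - res s₀) * (1 - res s₀)) * star X) * φ (res s) := by
    rw [star_mul, star_mul, star_map_res hsp, ← map_star, he0.isSelfAdjoint.star_eq, map_mul]
    noncomm_ring
  rw [e]
  have hc := hΨ.conj_res (φ := φ) hsp
  have h2 := ((hc.conj' X).comp φ).mul_self_le he0 (sub_le_self _ (res_nonneg hs₀p))
  have h3 := ((hc.conj' X).comp φ).mono (one_sub_res_le hs₀p)
  have h4 := hjF _ hc
  refine (h2.trans (h3.trans h4)).trans ?_
  have h5 := (hΨ.comp φ).mono (res_mul_mul_res_le hsp (sqSet_nonneg hj))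
  simp only [map_mul] at h5
  refine h5.trans ?_
  rw [(hΨ.comp φ).map_smul, (hΨ.comp φ).map_sub]
  have h6 := hν _ (add_mem_sqSet hs hj)
  gcongr

theorem tendsto_cross {h : A} {X : B} (hX : SqBounded φ h X) {ν : ℝ}
    (hν : ∀ s ∈ sqSet h, ν ≤ Ψ (φ (res s))) {F : Filter (sqSet h)} (hF : F ≤ atTop)
    (hlim : Tendsto (fun s : sqSet h => Ψ (φ (res (s : A)))) F (𝓝 ν)) [F.NeBot] :
    Tendsto (fun s : sqSet h => Ψ (φ (res (s : A)) * X * φ (1 - res (s : A)))) F (𝓝 0) := by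
  rw [Metric.tendsto_nhds]
  intro ε hε
  simp only [Real.dist_eq, sub_zero]
  have hl1 : Tendsto (fun s : sqSet h => ‖X‖ * √(Ψ (φ (res (s : A))) - ν)) F (𝓝 0) := by
    have := ((hlim.sub_const ν).sqrt).const_mul ‖X‖
    simpa using this
  obtain ⟨s₀, hs₀⟩ := ((hl1.eventually_lt_const (half_pos hε))).exists
  obtain ⟨C, hC, hb⟩ := cross_bound_of_sqBounded hΨ hΨ1 hX hν s₀.2
  have hl2 : Tendsto (fun s : sqSet h => √(C * (Ψ (φ (res (s : A))) - ν))) F (𝓝 0) := by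
    have := ((hlim.sub_const ν).const_mul C).sqrt
    simpa using this
  filter_upwards [hl2.eventually_lt_const (half_pos hε), hF (eventually_ge_atTop s₀)] with s hs1 hs2
  have hsp := sqSet_nonneg s.2
  have hs0p := sqSet_nonneg s₀.2
  have hle : res (s : A) ≤ res (s₀ : A) := res_antitone hs0p hs2
  have b1 := hb s s.2
  have b2 := cross_bound_of_norm hΨ hΨ1 (φ := φ) hsp X (sub_nonneg.mpr hle)
    ((sub_le_self _ (res_nonneg hsp)).trans (res_le_one hs0p))
  have b3 : Ψ (φ (res (s₀ : A) - res (s : A))) ≤ Ψ (φ (res (s₀ : A))) - ν := by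
    rw [map_sub, hΨ.map_sub]
    linarith [hν s s.2]
  have b4 : ‖X‖ * √(Ψ (φ (res (s₀ : A) - res (s : A)))) < ε / 2 :=
    (mul_le_mul_of_nonneg_left (Real.sqrt_le_sqrt b3) (norm_nonneg _)).trans_lt hs₀
  have e1 : φ (res (s : A)) * X * φ (1 - res (s : A)) =
      φ (res (s : A)) * X * φ (1 - res (s₀ : A)) +
      φ (res (s : A)) * X * φ (res (s₀ : A) - res (s : A)) := by
    rw [← mul_add, ← map_add]; congr 2; abel
  rw [e1, hΨ.map_add]
  refine (abs_add_le _ _).trans_lt ?_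
  linarith

/-- If the resolvents of `sqSet h` stay away from zero, a positive functional splits into a part
vanishing on the ideal generated by `h` and a part carried by it. -/
theorem exists_split (he : IsMatUnit φ e) (h : A) {ε : ℝ} (hε : 0 < ε)
    (hlow : ∀ s ∈ sqSet h, ε < Ψ (φ (res s))) :
    ∃ Φ Θ : B → ℝ, ∃ hΦ : PosFun Φ, PosFun Θ ∧ 0 < Φ 1 ∧
      (∀ y, Φ (hat φ e y) + Θ (hat φ e y) = Ψ (hat φ e y)) ∧ Φ 1 + Θ 1 = 1 ∧
      h ∈ kerIdeal φ hΦ ∧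
      (∀ I : Submodule ℂ A, IsClosedTwoSidedIdeal I → (∀ z ∈ I, Ψ (φ z) = 0) →
        I ≤ kerIdeal φ hΦ) ∧
      ∀ δ > 0, ∃ s, 0 ≤ s ∧ s ∈ kerIdeal φ hΦ ∧ Θ (φ (res s)) ≤ δ := by
  set f : sqSet h → ℝ := fun s => Ψ (φ (res (s : A))) with hf
  have hne : Nonempty (sqSet h) := ⟨⟨0, zero_mem_sqSet h⟩⟩
  have hdir : IsDirectedOrder (sqSet h) := ⟨fun s t =>
    ⟨⟨s + t, add_mem_sqSet s.2 t.2⟩, le_add_of_nonneg_right (sqSet_nonneg t.2),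
      le_add_of_nonneg_left (sqSet_nonneg s.2)⟩⟩
  have hanti : Antitone f := fun s t hst =>
    (hΨ.comp φ).mono (res_antitone (sqSet_nonneg s.2) hst)
  have hbdd : BddBelow (Set.range f) := ⟨ε, by rintro _ ⟨s, rfl⟩; exact (hlow s s.2).le⟩
  set ν : ℝ := ⨅ s, f s
  have hνpos : 0 < ν := hε.trans_le (le_ciInf fun s => (hlow s s.2).le)
  have hν : ∀ s ∈ sqSet h, ν ≤ Ψ (φ (res s)) := fun s hs => ciInf_le hbdd ⟨s, hs⟩
  set U : Ultrafilter (sqSet h) := Ultrafilter.of atTop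
  have hU : (U : Filter (sqSet h)) ≤ atTop := Ultrafilter.of_le _
  have hlim : Tendsto f U (𝓝 ν) := (tendsto_atTop_ciInf hanti hbdd).mono_left hU
  have hK : IsCompact {F : B → ℝ | PosFun F ∧ F 1 ≤ 1} :=
    PosFun.isCompact_of_isClosed (PosFun.isClosed_setOf.inter
      (isClosed_le (continuous_apply _) continuous_const)) 1 fun _ hF => hF
  have hex : ∀ g : sqSet h → B → ℝ, (∀ s, PosFun (g s) ∧ g s 1 ≤ 1) →
      ∃ Φ : B → ℝ, PosFun Φ ∧ ∀ X, Tendsto (fun s => g s X) U (𝓝 (Φ X)) := by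
    intro g hg
    obtain ⟨Φ, hΦ, hle⟩ := hK.ultrafilter_le_nhds (U.map g)
      (by
        rw [le_principal_iff]
        exact Filter.mem_map.mpr (Filter.univ_mem' hg))
    exact ⟨Φ, hΦ.1, fun X => (tendsto_pi_nhds.mp (show Tendsto g U (𝓝 Φ) from hle)) X⟩
  obtain ⟨Φ, hΦ, hΦl⟩ := hex (fun s X => Ψ (φ (res (s : A)) * X * φ (res (s : A))))
    fun s => ⟨hΨ.conj_res (sqSet_nonneg s.2), hΨ.conj_res_one_le hΨ1 (sqSet_nonneg s.2)⟩
  obtain ⟨Θ, hΘ, hΘl⟩ := hex (fun s X => Ψ (φ (1 - res (s : A)) * X * φ (1 - res (s : A))))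
    fun s => ⟨hΨ.conj_one_sub_res (sqSet_nonneg s.2), by
      have hsp := sqSet_nonneg s.2
      rw [mul_one, ← map_mul]
      refine ((hΨ.comp φ).mul_self_le (sub_nonneg.mpr (res_le_one hsp))
        (sub_le_self _ (res_nonneg hsp))).trans ?_
      have h0 : 0 ≤ Ψ (φ (res (s : A))) := (hΨ.comp φ).nonneg (res_nonneg hsp)
      rw [map_sub, hΨ.map_sub, map_one, hΨ1]
      linarith⟩
  have hsum : ∀ X, SqBounded φ h X → SqBounded φ h (star X) → Φ X + Θ X = Ψ X := by
    intro X h1 h2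
    have t1 := tendsto_cross hΨ hΨ1 h1 hν hU hlim
    have t2 := tendsto_cross hΨ hΨ1 h2 hν hU hlim
    have t3 := (((hΦl X).add (hΘl X)).add (t1.add t2))
    rw [add_zero, add_zero] at t3
    refine tendsto_nhds_unique t3 (tendsto_const_nhds.congr fun s => ?_)
    have hsp := sqSet_nonneg s.2
    have e1 : Ψ (φ (res (s : A)) * star X * φ (1 - res (s : A))) =
        Ψ (φ (1 - res (s : A)) * X * φ (res (s : A))) := by
      rw [← hΨ.map_star, star_mul, star_mul, star_star, star_map_res hsp, ← map_star,
        ((IsSelfAdjoint.one A).sub (isSelfAdjoint_res hsp)).star_eq, mul_assoc]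
    rw [e1, ← hΨ.map_add, ← hΨ.map_add, ← hΨ.map_add]
    congr 1
    simp only [map_sub, map_one]
    noncomm_ring
  have hsumφ : ∀ z, Φ (φ z) + Θ (φ z) = Ψ (φ z) := fun z =>
    hsum _ (sqBounded_map h z) (by rw [← map_star]; exact sqBounded_map h _)
  have hΦs : ∀ s ∈ sqSet h, Φ (φ s) = 0 := by
    intro j hj
    refine tendsto_nhds_unique (hΦl (φ j)) ?_
    have t := (hlim.sub_const ν).const_mul (1 + ‖j‖)
    rw [sub_self, mul_zero] at t
    refine squeeze_zero (fun s => ?_) (fun s => ?_) t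
    · exact ((hΨ.conj_res (sqSet_nonneg s.2)).comp φ).nonneg (sqSet_nonneg hj)
    · have h5 := (hΨ.comp φ).mono (res_mul_mul_res_le (sqSet_nonneg s.2) (sqSet_nonneg hj))
      simp only [map_mul] at h5
      refine h5.trans ?_
      rw [(hΨ.comp φ).map_smul, (hΨ.comp φ).map_sub]
      have h6 := hν _ (add_mem_sqSet s.2 hj)
      gcongr
  have hker : h ∈ kerIdeal φ hΦ := by
    intro p q
    have h1 := hΦ.cauchy_schwarz (φ (h * q)) (star (φ p))
    have h2 : Φ (star (φ (h * q)) * φ (h * q)) = 0 := by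
      rw [← map_star, ← map_mul]; exact hΦs _ (mem_sqSet h q)
    rw [h2, mul_zero, star_star, ← map_mul, ← mul_assoc] at h1
    exact pow_eq_zero_iff two_ne_zero |>.mp (le_antisymm h1 (sq_nonneg _))
  have hJ := isClosedTwoSidedIdeal_kerIdeal (φ := φ) hΦ
  have hΦd : ∀ s ∈ sqSet h, Φ (φ (res s)) = Φ 1 := by
    intro s hs
    have h1 : 1 - res s ∈ kerIdeal φ hΦ := by
      rw [← res_mul_self (sqSet_nonneg hs)]
      exact (hJ.2 _ _ (hJ.sqSet_subset hker hs)).1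
    have h2 := h1 1 1
    rw [one_mul, mul_one, map_sub, hΦ.map_sub, map_one] at h2
    linarith
  have hΦ1 : Φ 1 = ν := by
    have t1 := tendsto_cross hΨ hΨ1 (X := 1) (by simpa using sqBounded_map (φ := φ) h 1) hν hU hlim
    have t2 := (hΦl 1).add t1
    rw [add_zero] at t2
    refine tendsto_nhds_unique t2 (hlim.congr fun s => ?_)
    rw [← hΨ.map_add, ← mul_add, ← map_add]
    simp [hf]
  refine ⟨Φ, Θ, hΦ, hΘ, hΦ1 ▸ hνpos, fun y => hsum _ (sqBounded_hat he h y) ?_, ?_, hker, ?_, ?_⟩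
  · rw [(he.isSelfAdjoint_hat y).star_eq]
    exact sqBounded_hat he h y
  · simpa [hΨ1] using hsumφ 1
  · intro I hI hI0 z hz p q
    refine tendsto_nhds_unique (hΦl _) (tendsto_const_nhds.congr fun s => ?_)
    rw [← map_mul, ← map_mul]
    exact (hI0 _ (hI.2 _ _ (hI.2 _ _ (hI.2 _ _ (hI.2 _ _ hz).1).2).1).2).symm
  · intro δ hδ
    obtain ⟨s, hs⟩ := (hlim.eventually_lt_const (lt_add_of_pos_right ν hδ)).exists
    refine ⟨s, sqSet_nonneg s.2, hJ.sqSet_subset hker s.2, ?_⟩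
    have h1 := hsumφ (res (s : A))
    rw [hΦd s s.2, hΦ1] at h1
    have h2 : Ψ (φ (res (s : A))) < ν + δ := hs
    linarith

end Split

section SmallResolvent
variable {A : Type*} [CStarAlgebra A] {B : Type*} [CStarAlgebra B] {φ : A →⋆ₐ[ℂ] B} {e : B}

/-- Elements of `vStates` annihilating the image of an ideal. -/
def vStatesOn (φ : A →⋆ₐ[ℂ] B) (X Y : B) (c : ℝ) (I : Submodule ℂ A) : Set (B → ℝ) :=
  {F | F ∈ vStates (imGroup φ) X Y c ∧ ∀ z ∈ I, F (φ z) = 0}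

theorem isClosed_vStatesOn (φ : A →⋆ₐ[ℂ] B) (X Y : B) (c : ℝ) (I : Submodule ℂ A) :
    IsClosed (vStatesOn φ X Y c I) := by
  refine (isClosed_vStates _ X Y c).inter (s₂ := {F | ∀ z ∈ I, F (φ z) = 0}) ?_
  simp only [Set.ofPred_forall]
  exact isClosed_iInter fun z => isClosed_iInter fun _ =>
    isClosed_eq (continuous_apply _) continuous_const

theorem isCompact_vStatesOn (φ : A →⋆ₐ[ℂ] B) (X Y : B) (c : ℝ) (I : Submodule ℂ A) :
    IsCompact (vStatesOn φ X Y c I) :=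
  (isCompact_vStates _ X Y c).of_isClosed_subset (isClosed_vStatesOn φ X Y c I) fun _ hF => hF.1

theorem uStable_vStatesOn (φ : A →⋆ₐ[ℂ] B) (X Y : B) (c : ℝ) {I : Submodule ℂ A}
    (hI : IsClosedTwoSidedIdeal I) : UStable (imGroup φ) (vStatesOn φ X Y c I) := by
  intro v hv F hF
  refine ⟨uStable_vStates _ X Y c v hv F hF.1, fun z hz => ?_⟩
  obtain ⟨u, -, hu⟩ := exists_of_mem_imGroup hv
  rw [uact_apply, hu, ← map_star, ← map_mul, ← map_mul]
  exact hF.2 _ (hI.2 _ _ (hI.2 _ _ hz).1).2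

variable [PartialOrder A] [StarOrderedRing A]

theorem exists_res_small (he : IsMatUnit φ e) {x y : A} {S : ℝ}
    (hopt : ∀ F c, PosFun F → VBound (imGroup φ) (hat φ e x) (hat φ e y) F c → -(S * F 1) ≤ c)
    {I : Submodule ℂ A} (hI : IsClosedTwoSidedIdeal I)
    (hmax : ∀ J : Submodule ℂ A, IsClosedTwoSidedIdeal J → I ≤ J →
      (vStatesOn φ (hat φ e x) (hat φ e y) (-S) J).Nonempty → J = I)
    {h : A} (hh : h ∉ I) {Ψ : B → ℝ} (hΨ : Ψ ∈ vStatesOn φ (hat φ e x) (hat φ e y) (-S) I)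
    {ε : ℝ} (hε : 0 < ε) : ∃ s ∈ sqSet h, Ψ (φ (res s)) ≤ ε := by
  by_contra! hlow
  obtain ⟨⟨hΨp, hΨ1, hΨV⟩, hΨI⟩ := hΨ
  obtain ⟨Φ, Θ, hΦ, hΘ, hΦpos, hsum, hsum1, hker, hIker, hsmall⟩ :=
    exists_split hΨp hΨ1 he h hε hlow
  set X := hat φ e x
  set Y := hat φ e y
  have hconj : ∀ u ∈ imGroup φ, ∀ z : A,
      uact u (Φ + Θ) (hat φ e z) = uact u Ψ (hat φ e z) := by
    intro u hu z
    obtain ⟨v, -, hv⟩ := exists_of_mem_imGroup hu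
    simp only [uact_apply, hv, he.hat_conj, Pi.add_apply]
    exact hsum _
  have hV : VBound (imGroup φ) X Y Φ (-(S * Φ 1)) := by
    intro u₁ hu₁ w₁ hw₁
    by_contra! hlt
    set δ : ℝ := uact u₁ Φ X - uact w₁ Φ Y + S * Φ 1
    have hδ : 0 < δ := by simp only [δ]; linarith
    have hnot : ¬ VBound (imGroup φ) X Y Θ (-(S * Θ 1) - δ) := by
      intro hcon
      have := hopt Θ _ hΘ hcon
      linarith
    simp only [VBound] at hnot
    push Not at hnot
    obtain ⟨u₂, hu₂, w₂, hw₂, hlt₂⟩ := hnot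
    have key : ∀ u ∈ imGroup φ, ∀ w ∈ imGroup φ,
        uact u (Φ + Θ) X - uact w (Φ + Θ) Y ≤ -S := by
      intro u hu w hw
      rw [hconj u hu, hconj w hw]
      exact hΨV u hu w hw
    have hstep1 : ∀ w ∈ imGroup φ, uact u₁ Φ X + uact u₂ Θ X - uact w (Φ + Θ) Y ≤ -S := by
      set P : Set (B → ℝ) := {F | ∀ u ∈ imGroup φ, ∀ w ∈ imGroup φ,
        uact u F X - uact w (Φ + Θ) Y ≤ -S}
      have hPc : IsClosed P := by
        simp only [P, Set.ofPred_forall, uact_apply]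
        exact isClosed_iInter fun u => isClosed_iInter fun _ => isClosed_iInter fun w =>
          isClosed_iInter fun _ => isClosed_le (by fun_prop) (by fun_prop)
      have hPs : UStable (imGroup φ) P := by
        intro v hv F hF u hu w hw
        rw [← uact_mul]
        exact hF _ (mul_mem hv hu) w hw
      have hm := decoupled_mem hΦ hΘ hsmall hPc hPs (show Φ + Θ ∈ P from key)
        (mul_mem hu₁ (inv_mem hu₂))
      intro w hw
      have := hm u₂ hu₂ w hw
      rw [uact_add, ← uact_mul, inv_mul_cancel_right] at this
      exact this
    set P : Set (B → ℝ) := {F | ∀ w ∈ imGroup φ, uact u₁ Φ X + uact u₂ Θ X - uact w F Y ≤ -S}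
    have hPc : IsClosed P := by
      simp only [P, Set.ofPred_forall]
      exact isClosed_iInter fun w => isClosed_iInter fun _ =>
        isClosed_le (continuous_const.sub (continuous_apply _)) continuous_const
    have hPs : UStable (imGroup φ) P := by
      intro v hv F hF w hw
      rw [← uact_mul]
      exact hF _ (mul_mem hv hw)
    have hm := decoupled_mem hΦ hΘ hsmall hPc hPs (show Φ + Θ ∈ P from hstep1)
      (mul_mem hw₁ (inv_mem hw₂))
    have h3 := hm w₂ hw₂
    rw [uact_add, ← uact_mul, inv_mul_cancel_right, Pi.add_apply] at h3
    have h4 : S * Φ 1 + S * Θ 1 = S := by rw [← mul_add, hsum1, mul_one]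
    simp only [δ] at hlt₂
    linarith
  have hmem : (Φ 1)⁻¹ • Φ ∈ vStatesOn φ X Y (-S) (kerIdeal φ hΦ) := by
    refine ⟨⟨hΦ.smul (by positivity), by simp [inv_mul_cancel₀ hΦpos.ne'], ?_⟩, fun z hz => ?_⟩
    · have := hV.smul (inv_nonneg.mpr hΦpos.le)
      convert this using 1
      field_simp
    · have := hz 1 1
      rw [one_mul, mul_one] at this
      simp [this]
  have := hmax _ (isClosedTwoSidedIdeal_kerIdeal hΦ) (hIker I hI hΨI) ⟨_, hmem⟩
  exact hh (this ▸ hker)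

/-- Uniform version of `exists_res_small`. -/
theorem exists_res_small_uniform (he : IsMatUnit φ e) {x y : A} {S : ℝ}
    (hopt : ∀ F c, PosFun F → VBound (imGroup φ) (hat φ e x) (hat φ e y) F c → -(S * F 1) ≤ c)
    {I : Submodule ℂ A} (hI : IsClosedTwoSidedIdeal I)
    (hmax : ∀ J : Submodule ℂ A, IsClosedTwoSidedIdeal J → I ≤ J →
      (vStatesOn φ (hat φ e x) (hat φ e y) (-S) J).Nonempty → J = I)
    {h : A} (hh : h ∉ I) {ε : ℝ} (hε : 0 < ε) :
    ∃ s ∈ sqSet h, ∀ Ψ ∈ vStatesOn φ (hat φ e x) (hat φ e y) (-S) I, Ψ (φ (res s)) < ε := by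
  have hne : Nonempty (sqSet h) := ⟨⟨0, zero_mem_sqSet h⟩⟩
  by_contra! hcon
  set V := vStatesOn φ (hat φ e x) (hat φ e y) (-S) I
  have hcl : ∀ s : sqSet h, IsClosed (V ∩ {F | ε ≤ F (φ (res (s : A)))}) := fun s =>
    (isClosed_vStatesOn _ _ _ _ I).inter (isClosed_le continuous_const (continuous_apply _))
  have hmono : ∀ s t : sqSet h, (s : A) ≤ t →
      V ∩ {F | ε ≤ F (φ (res (t : A)))} ⊆ V ∩ {F | ε ≤ F (φ (res (s : A)))} := fun s t hst F hF =>
    ⟨hF.1, le_trans hF.2 ((hF.1.1.1.comp φ).mono (res_antitone (sqSet_nonneg s.2) hst))⟩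
  obtain ⟨Ψ, hΨ⟩ := IsCompact.nonempty_iInter_of_directed_nonempty_isCompact_isClosed
    (fun s : sqSet h => V ∩ {F | ε ≤ F (φ (res (s : A)))})
    (fun s t => ⟨⟨s + t, add_mem_sqSet s.2 t.2⟩,
      hmono _ _ (le_add_of_nonneg_right (sqSet_nonneg t.2)),
      hmono _ _ (le_add_of_nonneg_left (sqSet_nonneg s.2))⟩)
    (fun s => hcon s s.2)
    (fun s => (isCompact_vStatesOn _ _ _ _ I).of_isClosed_subset (hcl s) Set.inter_subset_left) hcl
  rw [Set.mem_iInter] at hΨ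
  obtain ⟨s, hs, hle⟩ := exists_res_small he hopt hI hmax hh (hΨ ⟨0, zero_mem_sqSet h⟩).1
    (half_pos hε)
  have : ε ≤ Ψ (φ (res s)) := (hΨ ⟨s, hs⟩).2
  linarith

end SmallResolvent

section MaximalIdeal
variable {A : Type*} [CStarAlgebra A]

theorem IsClosedTwoSidedIdeal.closure_iSup {c : Set (Submodule ℂ A)}
    (hc : ∀ J ∈ c, IsClosedTwoSidedIdeal J) (hch : IsChain (· ≤ ·) c) (hne : c.Nonempty) :
    IsClosedTwoSidedIdeal (sSup c).topologicalClosure := by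
  refine ⟨Submodule.isClosed_topologicalClosure _, fun a b hb => ?_⟩
  have hU : ∀ z, z ∈ sSup c ↔ ∃ J ∈ c, z ∈ J := fun z =>
    Submodule.mem_sSup_of_directed hne hch.directedOn
  constructor
  · refine map_mem_closure (f := fun b => a * b) (by fun_prop) hb fun z hz => ?_
    obtain ⟨J, hJ, hzJ⟩ := (hU z).mp hz
    exact (hU _).mpr ⟨J, hJ, ((hc J hJ).2 _ _ hzJ).1⟩
  · refine map_mem_closure (f := fun b => b * a) (by fun_prop) hb fun z hz => ?_
    obtain ⟨J, hJ, hzJ⟩ := (hU z).mp hz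
    exact (hU _).mpr ⟨J, hJ, ((hc J hJ).2 _ _ hzJ).2⟩

theorem IsClosedTwoSidedIdeal.closure_iSup_ne_top {c : Set (Submodule ℂ A)}
    (hc : ∀ J ∈ c, IsClosedTwoSidedIdeal J ∧ J ≠ ⊤) (hch : IsChain (· ≤ ·) c) (hne : c.Nonempty) :
    (sSup c).topologicalClosure ≠ ⊤ := by
  intro htop
  have h1 : (1 : A) ∈ closure ((sSup c : Submodule ℂ A) : Set A) := by
    rw [← Submodule.topologicalClosure_coe, htop]; trivial
  obtain ⟨u, hu⟩ := (mem_closure_iff.mp h1) {x : A | IsUnit x} Units.isOpen isUnit_one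
  obtain ⟨J, hJ, huJ⟩ := (Submodule.mem_sSup_of_directed hne hch.directedOn).mp hu.2
  exact (hc J hJ).2 ((hc J hJ).1.eq_top_of_isUnit huJ hu.1)

theorem exists_isMaximalClosedIdeal {I : Submodule ℂ A} (hI : IsClosedTwoSidedIdeal I)
    (hI1 : I ≠ ⊤) : ∃ M, IsMaximalClosedIdeal M ∧ I ≤ M := by
  obtain ⟨M, hIM, hM⟩ := zorn_le_nonempty₀
    {J : Submodule ℂ A | IsClosedTwoSidedIdeal J ∧ J ≠ ⊤} (fun c hc hch J hJ =>
      ⟨(sSup c).topologicalClosure,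
        ⟨IsClosedTwoSidedIdeal.closure_iSup (fun J hJ => (hc hJ).1) hch ⟨J, hJ⟩,
          IsClosedTwoSidedIdeal.closure_iSup_ne_top (fun J hJ => hc hJ) hch ⟨J, hJ⟩⟩,
        fun z hz => (le_sSup hz).trans (Submodule.le_topologicalClosure _)⟩) I ⟨hI, hI1⟩
  exact ⟨M, ⟨hM.prop.1, hM.prop.2, fun J h1 h2 h3 => (hM.eq_of_le ⟨h1, h2⟩ h3).symm⟩, hIM⟩

theorem isClosedTwoSidedIdeal_bot : IsClosedTwoSidedIdeal (⊥ : Submodule ℂ A) := by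
  refine ⟨by simp, fun a b hb => ?_⟩
  rw [Submodule.mem_bot] at hb
  simp [hb]

theorem vStatesOn_antitone {B : Type*} [CStarAlgebra B] {φ : A →⋆ₐ[ℂ] B} {X Y : B} {c : ℝ}
    {I J : Submodule ℂ A} (h : I ≤ J) : vStatesOn φ X Y c J ⊆ vStatesOn φ X Y c I :=
  fun _ hF => ⟨hF.1, fun z hz => hF.2 z (h hz)⟩

theorem exists_maximal_vStatesOn {B : Type*} [CStarAlgebra B] {φ : A →⋆ₐ[ℂ] B} {X Y : B} {c : ℝ}
    (hne : (vStates (imGroup φ) X Y c).Nonempty) :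
    ∃ I : Submodule ℂ A, IsClosedTwoSidedIdeal I ∧ (vStatesOn φ X Y c I).Nonempty ∧
      ∀ J : Submodule ℂ A, IsClosedTwoSidedIdeal J → I ≤ J →
        (vStatesOn φ X Y c J).Nonempty → J = I := by
  obtain ⟨F₀, hF₀⟩ := hne
  refine Exists.elim (zorn_le_nonempty₀
    {J : Submodule ℂ A | IsClosedTwoSidedIdeal J ∧ (vStatesOn φ X Y c J).Nonempty}
    (fun c' hc hch J hJ => ?_) ⊥ ⟨isClosedTwoSidedIdeal_bot, F₀, hF₀, fun z hz => ?_⟩) ?_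
  · have hne' : Nonempty c' := ⟨⟨J, hJ⟩⟩
    obtain ⟨F, hF⟩ := IsCompact.nonempty_iInter_of_directed_nonempty_isCompact_isClosed
      (fun J : c' => vStatesOn φ X Y c J)
      (fun J J' => by
        rcases hch.total J.2 J'.2 with h | h
        · exact ⟨J', vStatesOn_antitone h, subset_rfl⟩
        · exact ⟨J, subset_rfl, vStatesOn_antitone h⟩)
      (fun J => (hc J.2).2) (fun J => isCompact_vStatesOn _ _ _ _ _)
      (fun J => isClosed_vStatesOn _ _ _ _ _)
    rw [Set.mem_iInter] at hF
    refine ⟨(sSup c').topologicalClosure,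
      ⟨IsClosedTwoSidedIdeal.closure_iSup (fun J hJ => (hc hJ).1) hch ⟨J, hJ⟩, F,
        (hF ⟨J, hJ⟩).1, fun z hz => ?_⟩,
      fun z hz => (le_sSup hz).trans (Submodule.le_topologicalClosure _)⟩
    have hcl : IsClosed {z : A | F (φ z) = 0} :=
      isClosed_eq ((hF ⟨J, hJ⟩).1.1.comp φ).continuous continuous_const
    refine closure_minimal (fun z hz => ?_) hcl hz
    obtain ⟨J', hJ', hz'⟩ := (Submodule.mem_sSup_of_directed ⟨J, hJ⟩ hch.directedOn).mp hz
    exact (hF ⟨J', hJ'⟩).2 z hz'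
  · rw [Submodule.mem_bot] at hz
    rw [hz, map_zero, hF₀.1.map_zero]
  · rintro I ⟨-, hI⟩
    exact ⟨I, hI.prop.1, hI.prop.2, fun J h1 h2 h3 => (hI.eq_of_le ⟨h1, h3⟩ h2).symm⟩

end MaximalIdeal

section LindbladHat
variable {A : Type*} [CStarAlgebra A] {B : Type*} [CStarAlgebra B] {φ : A →⋆ₐ[ℂ] B} {e : B}

theorem hat_zero (φ : A →⋆ₐ[ℂ] B) (e : B) : hat φ e 0 = 0 := by simp [hat]

theorem norm_hat_le (φ : A →⋆ₐ[ℂ] B) (e : B) (z : A) : ‖hat φ e z‖ ≤ 2 * ‖e‖ * ‖z‖ := by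
  have h1 : ‖φ z‖ ≤ ‖z‖ := NonUnitalStarAlgHom.norm_apply_le φ z
  have h2 : ‖φ (star z)‖ ≤ ‖z‖ := (NonUnitalStarAlgHom.norm_apply_le φ (star z)).trans (by simp)
  calc ‖hat φ e z‖ ≤ ‖e‖ * ‖φ z‖ + ‖star e‖ * ‖φ (star z)‖ :=
        (norm_add_le _ _).trans (add_le_add (norm_mul_le _ _) (norm_mul_le _ _))
    _ ≤ ‖e‖ * ‖z‖ + ‖e‖ * ‖z‖ := by rw [norm_star]; gcongr
    _ = _ := by ring

theorem PosFun.list_star_conj_le {F : B → ℝ} (hF : PosFun F) (X : B) (l : List A) :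
    F (l.map fun w => star (φ w) * X * φ w).sum ≤ ‖X‖ * F (φ (sqL l)) := by
  induction l with
  | nil => simp [hF.map_zero]
  | cons w l ih =>
    simp only [List.map_cons, List.sum_cons, sqL_cons, _root_.map_add, hF.map_add, mul_add]
    have := hF.conj_le X (φ w)
    rw [← StarHomClass.map_star, ← map_mul] at this
    rw [← StarHomClass.map_star]
    linarith

theorem PosFun.list_conj_star_le {F : B → ℝ} (hF : PosFun F) (X : B) (l : List A) :
    F (l.map fun w => φ w * X * star (φ w)).sum ≤ ‖X‖ * F (φ (sqR l)) := by
  induction l with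
  | nil => simp [hF.map_zero]
  | cons w l ih =>
    simp only [List.map_cons, List.sum_cons, sqR_cons, _root_.map_add, hF.map_add, mul_add]
    have := hF.conj_le X (star (φ w))
    rw [star_star, ← StarHomClass.map_star, ← map_mul] at this
    rw [← StarHomClass.map_star]
    linarith

theorem list_sum_neg_conj (X : B) (l : List A) :
    (l.map fun w => φ w * -X * star (φ w)).sum = -(l.map fun w => φ w * X * star (φ w)).sum := by
  induction l with
  | nil => simp
  | cons w l ih => simp only [List.map_cons, List.sum_cons, ih]; noncomm_ring

theorem list_star_conj_hat (he : IsMatUnit φ e) (a d : A) (N : ℝ) (l : List A) :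
    (l.map fun w => star (φ w) * (hat φ e a + N • φ d) * φ w).sum =
      hat φ e (l.map fun w => star w * a * w).sum + N • φ (l.map fun w => star w * d * w).sum := by
  induction l with
  | nil => simp [hat_zero]
  | cons w l ih =>
    have h := he.hat_conj (star w) a
    rw [star_star, StarHomClass.map_star, star_star] at h
    rw [List.map_cons, List.sum_cons, ih]
    simp only [List.map_cons, List.sum_cons, hat_add, map_add, smul_add, mul_add, add_mul, h]
    rw [mul_smul_comm, smul_mul_assoc, map_mul, map_mul, StarHomClass.map_star]
    abel

theorem list_conj_star_hat (a d : A) (N : ℝ) (l : List A) :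
    (l.map fun w => φ w * (hat φ e a + N • φ d) * star (φ w)).sum =
      (l.map fun w => φ w * hat φ e a * star (φ w)).sum +
        N • φ (l.map fun w => w * d * star w).sum := by
  induction l with
  | nil => simp
  | cons w l ih =>
    rw [List.map_cons, List.sum_cons, ih]
    simp only [List.map_cons, List.sum_cons, map_add, smul_add, mul_add, add_mul]
    rw [mul_smul_comm, smul_mul_assoc, map_mul, map_mul, StarHomClass.map_star]
    abel

variable [PartialOrder A] [StarOrderedRing A]

theorem list_star_conj_nonneg {d : A} (hd : 0 ≤ d) (l : List A) :
    0 ≤ (l.map fun w => star w * d * w).sum :=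
  List.sum_nonneg fun x hx => by
    obtain ⟨m, -, rfl⟩ := List.mem_map.mp hx
    exact star_left_conjugate_nonneg hd m

theorem list_conj_star_nonneg {d : A} (hd : 0 ≤ d) (l : List A) :
    0 ≤ (l.map fun w => w * d * star w).sum :=
  List.sum_nonneg fun x hx => by
    obtain ⟨m, -, rfl⟩ := List.mem_map.mp hx
    exact star_right_conjugate_nonneg hd m

theorem lindblad_hat_le (he : IsMatUnit φ e) {g : B → ℝ} (hg : PosFun g) {a d : A} (hd : 0 ≤ d)
    {N : ℝ} (hN : 0 ≤ N)
    (hmax : ∀ u ∈ imGroup φ,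
      g ((u : B) * (hat φ e a + N • φ d) * star (u : B)) ≤ g (hat φ e a + N • φ d))
    (l : List A) :
    g (hat φ e (l.map fun w => star w * a * w).sum) +
        N * g (φ (l.map fun w => star w * d * w).sum) ≤
      g ((hat φ e a + N • φ d) * φ (sqL l)) + g ((hat φ e a + N • φ d) * φ (sqR l)) +
        ‖hat φ e a‖ * g (φ (sqR l)) := by
  have hsa : IsSelfAdjoint (hat φ e a + N • φ d) :=
    (he.isSelfAdjoint_hat a).add (IsSelfAdjoint.smul (.all N) ((IsSelfAdjoint.of_nonneg hd).map φ))
  have h := lindblad_list_le hg hsa hmax l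
  rw [list_star_conj_hat he, list_conj_star_hat, hg.map_add, hg.map_add, hg.map_smul,
    hg.map_smul] at h
  have h1 : 0 ≤ N * g (φ (l.map fun w => w * d * star w).sum) :=
    mul_nonneg hN ((hg.comp φ).nonneg (list_conj_star_nonneg hd l))
  have h2 := hg.list_conj_star_le (φ := φ) (-hat φ e a) l
  rw [list_sum_neg_conj, hg.map_neg, norm_neg] at h2
  linarith

theorem PosFun.mul_map_le (he : IsMatUnit φ e) {g : B → ℝ} (hg : PosFun g) {a d p : A}
    (hp : 0 ≤ p) {N κ : ℝ} (h1 : g (φ p) ≤ κ) (ha : g (φ (a * p * star a)) ≤ κ)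
    (ha' : g (φ (star a * p * a)) ≤ κ) (hd' : g (φ (d * p * star d)) ≤ κ) :
    g ((hat φ e a + N • φ d) * φ p) ≤ (8 + 2 * N ^ 2) * κ := by
  obtain ⟨s, hs, hsp⟩ := exists_sqrt_of_nonneg hp
  set X := hat φ e a + N • φ d
  have hκ : 0 ≤ κ := ((hg.comp φ).nonneg hp).trans h1
  have hφs : star (φ s) = φ s := by rw [← StarHomClass.map_star, hs.star_eq]
  have hφp : φ p = φ s * φ s := by rw [← hsp, map_mul]
  have hX : g (X * φ p * star X) ≤ (8 + 2 * N ^ 2) * κ := by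
    have e1 : X * φ p * star X =
        (hat φ e a * φ s + N • φ (d * s)) * star (hat φ e a * φ s + N • φ (d * s)) := by
      have : X * φ s = hat φ e a * φ s + N • φ (d * s) := by
        simp only [X, add_mul, smul_mul_assoc, map_mul]
      rw [← this, star_mul, hφs, hφp]; simp only [mul_assoc]
    have e2 := hg.add_conj_le (hat φ e a * φ s) (N • φ (d * s))
    have e3 : hat φ e a * φ s * star (hat φ e a * φ s) = hat φ e a * φ p * star (hat φ e a) := by
      rw [star_mul, hφs, hφp]; simp only [mul_assoc]
    have e4 : N • φ (d * s) * star (N • φ (d * s)) = N ^ 2 • φ (d * p * star d) := by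
      rw [star_smul, star_trivial, smul_mul_smul_comm, ← StarHomClass.map_star, ← map_mul,
        star_mul, hs.star_eq, ← hsp, pow_two]
      simp only [mul_assoc]
    rw [← e1, e3, e4, hg.map_smul] at e2
    have e5 := hg.hat_conj_le he a hp
    nlinarith [sq_nonneg N]
  have hcs := hg.cauchy_schwarz (φ s) (star (X * φ s))
  rw [star_star, mul_assoc, ← hφp, hφs, ← hφp, star_mul, hφs, ← mul_assoc, mul_assoc X,
    ← hφp] at hcs
  refine abs_le_of_sq_le_sq' ?_ (by positivity) |>.2
  have h0 : 0 ≤ g (φ p) := (hg.comp φ).nonneg hp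
  nlinarith [mul_le_mul hX h1 h0 (by positivity), mul_nonneg hκ hκ, sq_nonneg N,
    mul_nonneg (sq_nonneg N) (mul_nonneg hκ hκ),
    mul_nonneg (sq_nonneg N) (mul_nonneg (sq_nonneg N) (mul_nonneg hκ hκ))]

/-- The part of the maximality argument that only uses lists of small right squares. -/
theorem lindblad_small_le (he : IsMatUnit φ e) {g : B → ℝ} (hg : PosFun g) {a d : A} (hd : 0 ≤ d)
    {N κ : ℝ} (hN : 0 ≤ N)
    (hmax : ∀ u ∈ imGroup φ,
      g ((u : B) * (hat φ e a + N • φ d) * star (u : B)) ≤ g (hat φ e a + N • φ d))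
    (l : List A) (hl : ∀ c, c = 1 ∨ c = a ∨ c = star a ∨ c = d →
      g (φ (c * sqR l * star c)) ≤ κ) :
    g (hat φ e (l.map fun w => star w * a * w).sum) +
        N * g (φ (l.map fun w => star w * d * w).sum) ≤
      g ((hat φ e a + N • φ d) * φ (sqL l)) + (8 + 2 * N ^ 2 + ‖hat φ e a‖) * κ := by
  have h1 : g (φ (sqR l)) ≤ κ := by simpa using hl 1 (by simp)
  have h2 := hg.mul_map_le he (sqR_nonneg l) (N := N) h1 (hl a (by simp))
    (by simpa using hl (star a) (by simp)) (hl d (by simp))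
  have h3 := lindblad_hat_le he hg hd hN hmax l
  have h4 := mul_le_mul_of_nonneg_left h1 (norm_nonneg (hat φ e a))
  linarith

end LindbladHat

section ListProduct
variable {A : Type*} [CStarAlgebra A]

theorem sqL_flatMap (ys xs : List A) :
    sqL (xs.flatMap fun x => ys.map fun y => y * x) =
      (xs.map fun x => star x * sqL ys * x).sum := by
  induction xs with
  | nil => simp
  | cons x xs ih => rw [List.flatMap_cons, sqL_append, ih, sqL_map_mul_right]; simp

theorem sqR_flatMap (ys xs : List A) :
    sqR (xs.flatMap fun x => ys.map fun y => y * x) =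
      (ys.map fun y => y * sqR xs * star y).sum := by
  induction xs with
  | nil => simp
  | cons x xs ih =>
    rw [List.flatMap_cons, sqR_append, ih, sqR_map_mul_right, ← List.sum_map_add]
    simp only [sqR_cons, mul_add, add_mul]

theorem list_sum_star_conj_neg (a : A) (l : List A) :
    (l.map fun w => star w * -a * w).sum = -(l.map fun w => star w * a * w).sum := by
  induction l with
  | nil => simp
  | cons w l ih => simp only [List.map_cons, List.sum_cons, ih]; noncomm_ring

theorem list_sum_star_conj_sub_smul_one (a : A) (μ : ℂ) (l : List A) :
    (l.map fun w => star w * (a - μ • 1) * w).sum =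
      (l.map fun w => star w * a * w).sum - μ • sqL l := by
  induction l with
  | nil => simp
  | cons w l ih =>
    rw [List.map_cons, List.sum_cons, ih]
    simp only [List.map_cons, List.sum_cons, sqL_cons, smul_add, mul_sub, sub_mul,
      mul_smul_comm, smul_mul_assoc, mul_one]
    abel

theorem list_sum_star_conj_add (x y : A) (l : List A) :
    (l.map fun w => star w * x * w).sum + (l.map fun w => star w * y * w).sum =
      (l.map fun w => star w * (x + y) * w).sum := by
  rw [← List.sum_map_add]
  simp only [mul_add, add_mul]

theorem list_sum_star_conj_one (l : List A) :
    (l.map fun w => star w * 1 * w).sum = sqL l := by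
  induction l with
  | nil => simp
  | cons w l ih => rw [List.map_cons, List.sum_cons, ih, sqL_cons, mul_one]

end ListProduct

section ExcisionCore
variable {A : Type*} [CStarAlgebra A] {B : Type*} [CStarAlgebra B] {φ : A →⋆ₐ[ℂ] B} {e : B}
  [PartialOrder A] [StarOrderedRing A]

theorem PosFun.abs_mul_map_le {g : B → ℝ} (hg : PosFun g) (hg1 : g 1 = 1) (Y : B) {q : A}
    (hq : 0 ≤ q) (hq1 : q ≤ 1) {ξ : ℝ} (hξ : 0 ≤ ξ) (h : g (φ q) ≤ ξ ^ 2) :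
    |g (Y * φ q)| ≤ ‖Y‖ * ξ := by
  have hs : star (φ q) = φ q := by
    rw [← StarHomClass.map_star, (IsSelfAdjoint.of_nonneg hq).star_eq]
  have h1 := hg.cauchy_schwarz (φ q) (star Y)
  have h2 := hg.conj_le 1 (star Y)
  have h3 : g (star (star Y) * star Y) ≤ ‖Y‖ ^ 2 := by
    have := hg.star_mul_le (star Y)
    rwa [hg1, mul_one, norm_star] at this
  have h4 : g (star (φ q) * φ q) ≤ ξ ^ 2 := by
    rw [hs, ← map_mul]
    exact ((hg.comp φ).mul_self_le hq hq1).trans h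
  rw [star_star] at h1
  refine abs_le_of_sq_le_sq ?_ (by positivity)
  rw [mul_pow]
  refine h1.trans (mul_le_mul (by simpa using h3) h4 (hg.nonneg' _) (by positivity))

omit [PartialOrder A] [StarOrderedRing A] in
theorem hat_smul_mul (μ : ℂ) {q : A} (hq : IsSelfAdjoint q) :
    hat φ e (μ • q) = hat φ e (μ • 1) * φ q := by
  simp only [hat, add_mul, mul_assoc, ← map_mul, star_smul, star_one, hq.star_eq, smul_mul_assoc,
    one_mul]

/-- If `h` excises `a` at `μ` and `d` is small at a functional that maximizes a penalized
`hat a` over its orbit, then `hat μ` is almost bounded by `hat a` at that functional. -/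
theorem excision_core (he : IsMatUnit φ e) {a d h : A} {μ : ℂ} {N ξ κ ε : ℝ} (hd : 0 ≤ d)
    (hd1 : d ≤ 1) (hN : 1 ≤ N) (hξ : 0 < ξ) (hξ1 : ξ ≤ 1)
    (hNξ : 2 * ‖hat φ e a‖ + 2 ≤ N * ξ ^ 2) (hκ : (8 + 2 * N ^ 2 + ‖hat φ e a‖) * κ ≤ ξ)
    (hε : 0 ≤ ε)
    (hh : ∀ θ : ℂ, θ = 1 ∨ θ = -1 ∨ θ = Complex.I ∨ θ = -Complex.I →
        star h * (θ • (a - μ • 1) + star (θ • (a - μ • 1))) * h ≤ ε • (star h * h))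
    {ys : List A} (hys : sqL (ys.map fun y => h * y) = 1 - d)
    {g : B → ℝ} (hg : PosFun g) (hg1 : g 1 = 1)
    (hmax : ∀ u ∈ imGroup φ,
      g ((u : B) * (hat φ e a + N • φ d) * star (u : B)) ≤ g (hat φ e a + N • φ d))
    (hgd : g (φ d) ≤ (ξ / N) ^ 2) {xs : List A} (hxs : sqL xs = 1)
    (hsmall : ∀ c, c = 1 ∨ c = a ∨ c = star a ∨ c = d →
      g (φ (c * sqR xs * star c)) ≤ κ ∧
      g (φ (c * ((ys.map fun y => h * y).map fun y => y * sqR xs * star y).sum * star c)) ≤ κ) :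
    g (hat φ e (μ • 1)) ≤ g (hat φ e a) +
      (‖hat φ e a‖ + ‖hat φ e (μ • 1)‖ + 3) * ξ + 2 * ‖e‖ * ε := by
  have hN0 : 0 < N := by linarith
  set K := ‖hat φ e a‖
  have hK : 0 ≤ K := norm_nonneg _
  set Q := (xs.map fun x => star x * d * x).sum
  have hQ0 : 0 ≤ Q := list_star_conj_nonneg hd xs
  have hQsum : (xs.map fun x => star x * (1 - d) * x).sum = 1 - Q := by
    rw [eq_sub_iff_add_eq, list_sum_star_conj_add, sub_add_cancel, list_sum_star_conj_one, hxs]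
  have hQ1 : Q ≤ 1 := by
    rw [← sub_nonneg, ← hQsum]
    exact list_star_conj_nonneg (sub_nonneg.mpr hd1) xs
  have hga : |g (hat φ e a)| ≤ K := by simpa [hg1] using hg.abs_le (hat φ e a)
  have hNd : N * g (φ d) ≤ ξ := by
    calc N * g (φ d) ≤ N * (ξ / N) ^ 2 := by gcongr
      _ = ξ * (ξ / N) := by field_simp
      _ ≤ ξ * 1 := by gcongr; rw [div_le_one hN0]; linarith
      _ = ξ := mul_one _
  have hgX : g (hat φ e a + N • φ d) = g (hat φ e a) + N * g (φ d) := by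
    rw [hg.map_add, hg.map_smul]
  have hQ : g (φ Q) ≤ ξ ^ 2 := by
    have h1 := lindblad_small_le he hg hd hN0.le hmax xs fun c hc => (hsmall c hc).1
    have h2 := hg.list_star_conj_le (φ := φ) (-hat φ e a) xs
    have h3 := list_star_conj_hat he (-a) 0 0 xs
    rw [zero_smul, zero_smul, add_zero, add_zero, hat_neg, list_sum_star_conj_neg, hat_neg] at h3
    rw [h3, hg.map_neg, norm_neg, hxs, map_one, hg1] at h2
    rw [hxs, map_one, mul_one, hgX] at h1
    have := (abs_le.mp hga).2
    nlinarith
  set W := (xs.flatMap fun x => ys.map fun y => y * x).map fun y => h * y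
  have hW : W = xs.flatMap fun x => (ys.map fun y => h * y).map fun y => y * x := by
    simp only [W, List.map_flatMap, List.map_map]
    congr 1; funext x; congr 1; funext y; simp [mul_assoc]
  have hWL : sqL W = 1 - Q := by rw [hW, sqL_flatMap, hys, hQsum]
  have hWR : sqR W = ((ys.map fun y => h * y).map fun y => y * sqR xs * star y).sum := by
    rw [hW, sqR_flatMap]
  have h1 := lindblad_small_le he hg hd hN0.le hmax W fun c hc => by
    rw [hWR]; exact (hsmall c hc).2
  have hE := norm_excision_le hε hh (xs.flatMap fun x => ys.map fun y => y * x)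
    (show sqL W ≤ 1 by rw [hWL]; exact sub_le_self _ hQ0)
  have hmm : ((xs.flatMap fun x => ys.map fun y => y * x).map fun y =>
      star (h * y) * (a - μ • 1) * (h * y)) = W.map fun w => star w * (a - μ • 1) * w := by
    simp [W]
  rw [hmm, list_sum_star_conj_sub_smul_one, hWL, smul_sub] at hE
  set T := (W.map fun w => star w * a * w).sum
  have hT : hat φ e T = hat φ e (T - (μ • 1 - μ • Q)) + hat φ e (μ • 1) -
      hat φ e (μ • 1) * φ Q := by
    rw [← hat_smul_mul μ (IsSelfAdjoint.of_nonneg hQ0), hat_sub, hat_sub]; abel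
  have h2 : |g (hat φ e (T - (μ • 1 - μ • Q)))| ≤ 2 * ‖e‖ * ε := by
    refine (hg.abs_le _).trans ?_
    rw [hg1, one_mul]
    exact (norm_hat_le φ e _).trans (by gcongr)
  have h3 := hg.abs_mul_map_le hg1 (hat φ e (μ • 1)) hQ0 hQ1 hξ.le hQ
  have h4 := hg.abs_mul_map_le hg1 (hat φ e a) hQ0 hQ1 hξ.le hQ
  have h5 : |g (φ d * φ Q)| ≤ ξ / N := by
    have h6 := hg.cauchy_schwarz (φ Q) (star (φ d))
    have hs : ∀ z : A, 0 ≤ z → star (φ z) = φ z := fun z hz => by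
      rw [← StarHomClass.map_star, (IsSelfAdjoint.of_nonneg hz).star_eq]
    rw [star_star, hs d hd, hs Q hQ0, ← map_mul φ d d, ← map_mul φ Q Q] at h6
    refine abs_le_of_sq_le_sq ?_ (by positivity)
    have h7 := ((hg.comp φ).mul_self_le hd hd1).trans hgd
    have h8 : g (φ (Q * Q)) ≤ 1 :=
      ((hg.comp φ).mul_self_le hQ0 hQ1).trans (hQ.trans (by nlinarith))
    have h9 : 0 ≤ g (φ (Q * Q)) := by
      have := hg.nonneg' (φ Q)
      rwa [hs Q hQ0, ← map_mul] at this
    nlinarith [sq_nonneg (ξ / N)]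
  have h6 : N * |g (φ d * φ Q)| ≤ ξ := by
    calc N * |g (φ d * φ Q)| ≤ N * (ξ / N) := by gcongr
      _ = ξ := by field_simp
  have h7 : 0 ≤ N * g (φ (W.map fun w => star w * d * w).sum) :=
    mul_nonneg hN0.le ((hg.comp φ).nonneg (list_star_conj_nonneg hd W))
  have h8 : g ((hat φ e a + N • φ d) * φ (1 - Q)) =
      g (hat φ e a) + N * g (φ d) - g (hat φ e a * φ Q) - N * g (φ d * φ Q) := by
    rw [map_sub, map_one, mul_sub, mul_one, add_mul, smul_mul_assoc, hg.map_sub, hg.map_add,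
      hg.map_add, hg.map_smul, hg.map_smul]
    ring
  rw [hWL, h8, hT, hg.map_sub, hg.map_add] at h1
  have h9 := neg_abs_le (g (φ d * φ Q))
  have h10 := neg_abs_le (g (hat φ e a * φ Q))
  have h11 := le_abs_self (g (hat φ e (μ • 1) * φ Q))
  have h12 := neg_abs_le (g (hat φ e (T - (μ • 1 - μ • Q))))
  have h13 := mul_le_mul_of_nonneg_left h9 hN0.le
  linarith

end ExcisionCore

section OrbitClosure
variable {B : Type*} [CStarAlgebra B]

/-- The closed orbit of a functional under a group of unitaries. -/
def orbitClosure (G : Subgroup (unitary B)) (Ψ : B → ℝ) : Set (B → ℝ) :=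
  closure {F | ∃ u ∈ G, F = uact u Ψ}

variable {G : Subgroup (unitary B)} {Ψ : B → ℝ}

theorem mem_orbitClosure_self : Ψ ∈ orbitClosure G Ψ :=
  subset_closure ⟨1, one_mem G, (uact_one Ψ).symm⟩

theorem uStable_orbitClosure : UStable G (orbitClosure G Ψ) := fun v hv F hF =>
  map_mem_closure (continuous_uact v) hF fun _ ⟨u, hu, h⟩ =>
    ⟨u * v, mul_mem hu hv, by rw [h, uact_mul]⟩

theorem orbitClosure_subset {S : Set (B → ℝ)} (hS : IsClosed S) (hst : UStable G S)
    (hΨ : Ψ ∈ S) : orbitClosure G Ψ ⊆ S :=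
  closure_minimal (by rintro _ ⟨u, hu, rfl⟩; exact hst u hu Ψ hΨ) hS

theorem VBound.sub_le {x y : B} {c : ℝ} (h : VBound G x y Ψ c) {g g' : B → ℝ}
    (hg : g ∈ orbitClosure G Ψ) (hg' : g' ∈ orbitClosure G Ψ) : g x - g' y ≤ c := by
  have h1 : ∀ w ∈ G, g x - _root_.uact w Ψ y ≤ c := fun w hw =>
    (closure_minimal (by rintro _ ⟨u, hu, rfl⟩; exact h u hu w hw)
      (isClosed_le ((continuous_apply x).sub continuous_const) continuous_const) :
      orbitClosure G Ψ ⊆ {F | F x - _root_.uact w Ψ y ≤ c}) hg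
  exact (closure_minimal (by rintro _ ⟨u, hu, rfl⟩; exact h1 u hu)
      (isClosed_le (continuous_const.sub (continuous_apply y)) continuous_const) :
      orbitClosure G Ψ ⊆ {F | g x - F y ≤ c}) hg'

end OrbitClosure

section OrbitBound
variable {A : Type*} [CStarAlgebra A] {B : Type*} [CStarAlgebra B] {φ : A →⋆ₐ[ℂ] B} {e : B}

theorem IsMatUnit.apply_hat_smul_one (he : IsMatUnit φ e) {Ψ g : B → ℝ}
    (hg : g ∈ orbitClosure (imGroup φ) Ψ) (z : ℂ) :
    g (hat φ e (z • 1)) = Ψ (hat φ e (z • 1)) := by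
  refine (closure_minimal ?_ (isClosed_eq (continuous_apply _) continuous_const) :
    orbitClosure (imGroup φ) Ψ ⊆ {F | F (hat φ e (z • 1)) = Ψ (hat φ e (z • 1))}) hg
  rintro _ ⟨u, hu, rfl⟩
  obtain ⟨v, -, hv⟩ := exists_of_mem_imGroup hu
  rw [Set.mem_ofPred_eq, uact_apply, hv, he.hat_conj]
  congr 2
  simp

theorem PosFun.hat_smul_one {Ψ : B → ℝ} (hΨ : PosFun Ψ) (φ : A →⋆ₐ[ℂ] B) (e : B) (z : ℂ) :
    Ψ (hat φ e (z • 1)) = (2 * cval Ψ e * z).re := by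
  have h : hat φ e (z • 1) = z • e + star (z • e) := by simp [hat]
  rw [h, hΨ.map_add, hΨ.map_star, hΨ.smul_complex]
  simp only [Complex.mul_re, Complex.mul_im, Complex.re_ofNat, Complex.im_ofNat]
  ring

theorem IsMatUnit.abs_hat_smul_one_le (he : IsMatUnit φ e) {Ψ : B → ℝ} (hΨ : PosFun Ψ)
    (h1 : Ψ 1 = 1) (z : ℂ) : |Ψ (hat φ e (z • 1))| ≤ ‖z‖ := by
  have hsq : star (hat φ e (z • 1)) * hat φ e (z • 1) = (‖z‖ ^ 2 : ℝ) • (1 : B) := by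
    have h : hat φ e (z • 1) = z • e + star z • star e := by simp [hat]
    rw [(he.isSelfAdjoint_hat _).star_eq, h]
    simp only [add_mul, mul_add, smul_mul_smul_comm, he.sq, he.sq', smul_zero, zero_add, add_zero]
    rw [mul_comm (star z), ← smul_add, add_comm, he.one, Complex.star_def, Complex.mul_conj,
      Complex.normSq_eq_norm_sq, Complex.coe_smul]
  have h2 := hΨ.cauchy_schwarz (hat φ e (z • 1)) 1
  rw [hsq, hΨ.map_smul, star_one, one_mul, one_mul, h1, one_mul, mul_one] at h2
  exact abs_le_of_sq_le_sq h2 (norm_nonneg z)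

variable [PartialOrder A] [StarOrderedRing A]

theorem one_sub_res_mem_sqSet {h s : A} (hs : s ∈ sqSet h) : 1 - res s ∈ sqSet h := by
  have hs0 := sqSet_nonneg hs
  obtain ⟨T, hT, hTS, -, hc⟩ := exists_inv_sqrt (le_add_of_nonneg_right hs0 : (1 : A) ≤ 1 + s)
  have h1 : T * T = res s := res_eq_of_mul hs0 (by rw [mul_assoc, hc.eq, ← mul_assoc, hTS])
  have h2 : T * s * T = 1 - res s := by rw [← h1, ← hTS]; noncomm_ring
  rw [← h2]
  simpa [hT.star_eq] using conj_mem_sqSet hs T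

omit [PartialOrder A] [StarOrderedRing A] in
theorem PosFun.list_conj_mul_le {g : A → ℝ} (hg : PosFun g) (c k : A) (ys : List A) {η : ℝ}
    (h : ∀ y ∈ ys, g (c * y * k * star (c * y)) ≤ η) :
    g (c * (ys.map fun y => y * k * star y).sum * star c) ≤ ys.length * η := by
  induction ys with
  | nil => simp [hg.map_zero]
  | cons y ys ih =>
    have h1 := h y List.mem_cons_self
    have h2 := ih fun z hz => h z (List.mem_cons_of_mem _ hz)
    have h3 : c * (y * k * star y) * star c = c * y * k * star (c * y) := by
      simp only [star_mul, mul_assoc]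
    simp only [List.map_cons, List.sum_cons, mul_add, add_mul, hg.map_add, List.length_cons, h3]
    push_cast
    linarith

/-- On the closed orbit of a functional annihilating a maximal ideal, `hat a` reaches all values
given by the numerical range of `a` in a further quotient. -/
theorem exists_orbit_hat_ge (he : IsMatUnit φ e) {x y : A} {S : ℝ}
    (hopt : ∀ F c, PosFun F → VBound (imGroup φ) (hat φ e x) (hat φ e y) F c → -(S * F 1) ≤ c)
    {I : Submodule ℂ A} (hI : IsClosedTwoSidedIdeal I)
    (hmax : ∀ J : Submodule ℂ A, IsClosedTwoSidedIdeal J → I ≤ J →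
      (vStatesOn φ (hat φ e x) (hat φ e y) (-S) J).Nonempty → J = I)
    (htr : ∀ F ∈ vStates (imGroup φ) (hat φ e x) (hat φ e y) (-S), ∀ τ : A → ℝ, PosFun τ →
      (∀ x y, τ (x * y) = τ (y * x)) → FunLE τ (fun x => F (φ x)) → τ = 0)
    {Ψ : B → ℝ} (hΨ : Ψ ∈ vStatesOn φ (hat φ e x) (hat φ e y) (-S) I)
    {M : Submodule ℂ A} (hM : IsClosedTwoSidedIdeal M) (hMt : M ≠ ⊤) (hIM : I ≤ M) (a : A)
    {F₀ : A → ℝ} (hF₀ : F₀ ∈ quotStates M) {δ : ℝ} (hδ : 0 < δ) :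
    ∃ g ∈ orbitClosure (imGroup φ) Ψ, Ψ (hat φ e (cval F₀ a • 1)) ≤ g (hat φ e a) + δ := by
  set V := vStatesOn φ (hat φ e x) (hat φ e y) (-S) I
  have hsub : orbitClosure (imGroup φ) Ψ ⊆ V :=
    orbitClosure_subset (isClosed_vStatesOn _ _ _ _ I) (uStable_vStatesOn φ _ _ _ hI) hΨ
  set ε : ℝ := δ / (2 * (6 * ‖e‖ + 1))
  have hε : 0 < ε := by positivity
  obtain ⟨μ, -, hμ, h, hhM, hh⟩ := exists_excision hM hMt hF₀ a (2 * cval Ψ e) hε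
  rw [← hΨ.1.1.hat_smul_one φ e, ← hΨ.1.1.hat_smul_one φ e] at hμ
  set K := ‖hat φ e a‖
  have hK : 0 ≤ K := norm_nonneg _
  set L := ‖hat φ e (μ • 1)‖
  have hL : 0 ≤ L := norm_nonneg _
  set ξ : ℝ := min 1 (δ / (2 * (K + L + 3)))
  have hξ : 0 < ξ := lt_min one_pos (by positivity)
  have hξδ : (K + L + 3) * ξ ≤ δ / 2 := by
    calc (K + L + 3) * ξ ≤ (K + L + 3) * (δ / (2 * (K + L + 3))) := by
          gcongr; exact min_le_right _ _
      _ = δ / 2 := by field_simp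
  set N : ℝ := max 1 ((2 * K + 2) / ξ ^ 2)
  have hN : 1 ≤ N := le_max_left _ _
  have hNξ : 2 * K + 2 ≤ N * ξ ^ 2 := (div_le_iff₀ (by positivity)).mp (le_max_right _ _)
  have hN0 : 0 < N := by linarith
  obtain ⟨s, hs, hres⟩ := exists_res_small_uniform he hopt hI hmax (fun hc => hhM (hIM hc))
    (show 0 < (ξ / N) ^ 2 by positivity)
  have hs0 := sqSet_nonneg hs
  obtain ⟨ys, hys⟩ := one_sub_res_mem_sqSet hs
  set d := res s
  obtain ⟨g, hgW, hgmax⟩ := ((isCompact_vStatesOn _ _ _ _ I).of_isClosed_subset isClosed_closure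
    hsub).exists_isMaxOn ⟨Ψ, mem_orbitClosure_self⟩
      (continuous_apply (hat φ e a + N • φ d)).continuousOn
  have hgV := hsub hgW
  set D : ℝ := 8 + 2 * N ^ 2 + K
  have hD : 0 < D := by positivity
  set η : ℝ := ξ / D / (ys.length + 1)
  have hη : 0 < η := by positivity
  have hηκ : (ys.length + 1) * η = ξ / D := by simp only [η]; field_simp
  obtain ⟨xs, hxs, hsmall⟩ := exists_small_list (convex_vStates _ _ _ _)
    (uStable_vStates _ _ _ _) (fun F hF => hF.1) htr hgV.1
    ([1, a, star a, d] ++ [1, a, star a, d].flatMap fun c => ys.map fun y => c * (h * y)) hη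
  refine ⟨g, hgW, ?_⟩
  have hcore := excision_core he (ε := 3 * ε) (κ := ξ / D) (res_nonneg hs0) (res_le_one hs0) hN hξ
    (min_le_left _ _) hNξ (by field_simp; exact le_rfl) (by positivity) hh hys hgV.1.1 hgV.1.2.1
    (fun u hu => hgmax (uStable_orbitClosure u hu g hgW)) (hres g hgV).le hxs fun c hc => by
      have hc' : c ∈ [1, a, star a, d] := by simpa using hc
      constructor
      · have := hsmall c (List.mem_append_left _ hc')
        have h0 : (0 : ℝ) ≤ ys.length * η := by positivity
        linarith
      · have := (hgV.1.1.comp φ).list_conj_mul_le c (sqR xs) (ys.map fun y => h * y) (η := η)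
          fun z hz => by
            obtain ⟨w, hw, rfl⟩ := List.mem_map.mp hz
            exact hsmall _ (List.mem_append_right _
              (List.mem_flatMap.mpr ⟨c, hc', List.mem_map.mpr ⟨w, hw, rfl⟩⟩))
        rw [List.length_map] at this
        linarith
  rw [he.apply_hat_smul_one hgW] at hcore
  have h1 : 2 * ‖e‖ * (3 * ε) + ε = δ / 2 := by simp only [ε]; field_simp; ring
  linarith

end OrbitBound

section Contradiction
variable {A : Type*} [CStarAlgebra A] [PartialOrder A] [StarOrderedRing A]
  {B : Type*} [CStarAlgebra B] [PartialOrder B] [StarOrderedRing B] {φ : A →⋆ₐ[ℂ] B} {e : B}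

theorem exists_quotStates_dist_lt {M : Submodule ℂ A} (hM : IsMaximalClosedIdeal M) {a b : A}
    {S : ℝ} (h : setDist (quotNumericalRange M a) (quotNumericalRange M b) < S) :
    ∃ F ∈ quotStates M, ∃ F' ∈ quotStates M, ‖cval F a - cval F' b‖ < S := by
  obtain ⟨F₀, hF₀⟩ := quotStates_nonempty hM.1 hM.2.1
  have hne : {t : ℝ | ∃ x ∈ quotNumericalRange M a, ∃ y ∈ quotNumericalRange M b,
      t = dist x y}.Nonempty :=
    ⟨_, cval F₀ a, mem_quotNumericalRange.mpr ⟨F₀, hF₀, rfl⟩, cval F₀ b,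
      mem_quotNumericalRange.mpr ⟨F₀, hF₀, rfl⟩, rfl⟩
  obtain ⟨_, ⟨c, hc, c', hc', rfl⟩, hlt⟩ := exists_lt_of_csInf_lt hne h
  obtain ⟨F, hF, rfl⟩ := mem_quotNumericalRange.mp hc
  obtain ⟨F', hF', rfl⟩ := mem_quotNumericalRange.mp hc'
  exact ⟨F, hF, F', hF', by rwa [dist_eq_norm] at hlt⟩

theorem vStates_eq_empty (he : IsMatModel φ e) {a b : A} {r R : ℝ} (hrR : r < R)
    (hτ : ∀ τ : A →L[ℂ] ℂ, IsTracialState τ → ‖τ (a - b)‖ ≤ r)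
    (hW : ∀ M : Submodule ℂ A, IsMaximalClosedIdeal M →
      setDist (quotNumericalRange M a) (quotNumericalRange M b) ≤ r) :
    vStates (imGroup φ) (hat φ e a) (hat φ e b) (-R) = ∅ := by
  rw [← Set.not_nonempty_iff_eq_empty]
  intro hne
  obtain ⟨S, hRS, hneS, hopt⟩ := exists_optimal_bound hne
  have hrS : r < S := hrR.trans_le hRS
  have htr : ∀ F ∈ vStates (imGroup φ) (hat φ e a) (hat φ e b) (-S), ∀ τ : A → ℝ, PosFun τ →
      (∀ x y, τ (x * y) = τ (y * x)) → FunLE τ (fun x => F (φ x)) → τ = 0 :=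
    fun F hF τ hp ht hle => tracial_eq_zero he (convex_vStates _ _ _ _) (isCompact_vStates _ _ _ _)
      (uStable_vStates _ _ _ _) (fun F hF => ⟨hF.1, hF.2.1⟩)
      (fun F hF f hf hfi hle => eq_zero_of_central_le he.toIsMatUnit hrS hτ hopt hF hf hfi hle)
      hF hp ht hle
  obtain ⟨I, hI, ⟨Ψ, hΨ⟩, hmax⟩ := exists_maximal_vStatesOn hneS
  have hIt : I ≠ ⊤ := by
    intro h
    have h1 := hΨ.2 1 (h ▸ Submodule.mem_top)
    rw [map_one, hΨ.1.2.1] at h1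
    exact one_ne_zero h1
  obtain ⟨M, hM, hIM⟩ := exists_isMaximalClosedIdeal hI hIt
  obtain ⟨F, hF, F', hF', hlt⟩ := exists_quotStates_dist_lt hM ((hW M hM).trans_lt hrS)
  set δ : ℝ := (S - ‖cval F a - cval F' b‖) / 3
  have hδ : 0 < δ := by simp only [δ]; linarith
  obtain ⟨g, hg, h1⟩ := exists_orbit_hat_ge he.toIsMatUnit hopt hI hmax htr hΨ hM.1 hM.2.1 hIM a
    hF hδ
  obtain ⟨g', hg', h2⟩ := exists_orbit_hat_ge he.toIsMatUnit hopt hI hmax htr hΨ hM.1 hM.2.1 hIM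
    (-b) hF' hδ
  have hgp : PosFun g' := (orbitClosure_subset (isClosed_vStates _ _ _ _)
    (uStable_vStates _ _ _ _) hΨ.1 hg').1
  have h3 : cval F' (-b) = -cval F' b := by
    have := hF'.1.cval_smul (-1) b
    rwa [neg_one_smul, neg_one_mul] at this
  rw [h3, hat_neg, hgp.map_neg] at h2
  have h4 := hΨ.1.2.2.sub_le hg hg'
  have h5 := he.toIsMatUnit.abs_hat_smul_one_le hΨ.1.1 hΨ.1.2.1 (cval F a - cval F' b)
  rw [sub_eq_add_neg, add_smul, hat_add, hΨ.1.1.map_add, ← sub_eq_add_neg] at h5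
  have h6 := neg_abs_le (Ψ (hat φ e (cval F a • 1)) + Ψ (hat φ e (-cval F' b • 1)))
  simp only [δ] at *
  linarith

end Contradiction

section DixmierSet
variable {A : Type*} [CStarAlgebra A]

theorem self_mem_dixmierSet (a : A) : a ∈ dixmierSet a :=
  subset_closure (subset_convexHull ℝ _ ⟨1, by simp⟩)

theorem setDist_nonneg {E : Type*} [PseudoMetricSpace E] (s t : Set E) : 0 ≤ setDist s t :=
  Real.sInf_nonneg (by rintro _ ⟨x, -, y, -, rfl⟩; exact dist_nonneg)

theorem setDist_le_dist {E : Type*} [PseudoMetricSpace E] {s t : Set E} {x y : E} (hx : x ∈ s)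
    (hy : y ∈ t) : setDist s t ≤ dist x y :=
  csInf_le ⟨0, by rintro _ ⟨x, -, y, -, rfl⟩; exact dist_nonneg⟩ ⟨x, hx, y, hy, rfl⟩

theorem le_setDist {E : Type*} [PseudoMetricSpace E] {s t : Set E} (hs : s.Nonempty)
    (ht : t.Nonempty) {c : ℝ} (h : ∀ x ∈ s, ∀ y ∈ t, c ≤ dist x y) : c ≤ setDist s t := by
  obtain ⟨x, hx⟩ := hs
  obtain ⟨y, hy⟩ := ht
  exact le_csInf ⟨_, x, hx, y, hy, rfl⟩ (by rintro _ ⟨x, hx, y, hy, rfl⟩; exact h x hx y hy)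

theorem dixmierSet_subset {C : Set A} {a : A} (hC : IsClosed C) (hconv : Convex ℝ C)
    (h : ∀ u : unitary A, (u : A) * a * star (u : A) ∈ C) : dixmierSet a ⊆ C :=
  closure_minimal (convexHull_min (by rintro _ ⟨u, rfl⟩; exact h u) hconv) hC

theorem IsTracialState.apply_eq_of_mem_dixmierSet {τ : A →L[ℂ] ℂ} (hτ : IsTracialState τ)
    {a x : A} (hx : x ∈ dixmierSet a) : τ x = τ a := by
  refine dixmierSet_subset (C := {x | τ x = τ a}) (isClosed_eq τ.continuous continuous_const)
    ?_ (fun u => ?_) hx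
  · intro x hx y hy s t _ _ hst
    rw [Set.mem_ofPred_eq] at *
    rw [map_add, map_real_smul τ τ.continuous, map_real_smul τ τ.continuous, hx, hy, ← add_smul,
      hst, one_smul]
  · rw [Set.mem_ofPred_eq, hτ.2.2, ← mul_assoc, Unitary.coe_star_mul_self, one_mul]

theorem convex_quotStates (M : Submodule ℂ A) : Convex ℝ (quotStates M) := by
  rintro F ⟨h1, h2, h3⟩ F' ⟨k1, k2, k3⟩ s t hs ht hst
  refine ⟨(h1.smul hs).add (k1.smul ht), by simp [h2, k2, hst], fun x hx => ?_⟩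
  simp [h3 x hx, k3 x hx]

theorem quotStates_uact {M : Submodule ℂ A} (hM : IsClosedTwoSidedIdeal M) {F : A → ℝ}
    (hF : F ∈ quotStates M) (u : unitary A) : uact u F ∈ quotStates M :=
  ⟨hF.1.uact u, (uact_apply_one u F).trans hF.2.1, fun _ hx =>
    hF.2.2 _ (hM.2 _ _ (hM.2 _ _ hx).1).2⟩

theorem quotNumericalRange_eq_image (M : Submodule ℂ A) (a : A) :
    quotNumericalRange M a = (fun F => cval F a) '' quotStates M := by
  ext c
  simp only [mem_quotNumericalRange, Set.mem_image, eq_comm]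

theorem isCompact_quotNumericalRange (M : Submodule ℂ A) (a : A) :
    IsCompact (quotNumericalRange M a) := by
  rw [quotNumericalRange_eq_image]
  exact (isCompact_quotStates M).image (continuous_cval a)

theorem convex_quotNumericalRange (M : Submodule ℂ A) (a : A) :
    Convex ℝ (quotNumericalRange M a) := by
  rw [quotNumericalRange_eq_image]
  rintro _ ⟨F, hF, rfl⟩ _ ⟨F', hF', rfl⟩ s t hs ht hst
  refine ⟨_, convex_quotStates M hF hF' hs ht hst, ?_⟩
  apply Complex.ext <;> simp [cval] <;> ring

theorem cval_mem_quotNumericalRange {M : Submodule ℂ A} (hM : IsClosedTwoSidedIdeal M)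
    {F : A → ℝ} (hF : F ∈ quotStates M) {a x : A} (hx : x ∈ dixmierSet a) :
    cval F x ∈ quotNumericalRange M a := by
  have hc : Continuous fun x => cval F x := by
    have h := hF.1.continuous
    have : (fun x => cval F x) = fun x => (F x : ℂ) + ((-F (Complex.I • x) : ℝ) : ℂ) * Complex.I := by
      funext x; apply Complex.ext <;> simp [cval]
    rw [this]
    fun_prop
  refine dixmierSet_subset (C := {x | cval F x ∈ quotNumericalRange M a})
    ((isCompact_quotNumericalRange M a).isClosed.preimage hc) ?_ (fun u => ?_) hx
  · intro x hx y hy s t hs ht hst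
    have := convex_quotNumericalRange M a hx hy hs ht hst
    rw [Set.mem_ofPred_eq]
    convert this using 1
    apply Complex.ext <;>
      simp [cval, hF.1.map_add, hF.1.map_smul, smul_comm Complex.I] <;> ring
  · refine mem_quotNumericalRange.mpr ⟨_, quotStates_uact hM hF u, ?_⟩
    simp [cval, uact_apply]

end DixmierSet

/-- **Theorem 5.10.**  For `a, b` in a unital C*-algebra `A`, the distance between `D_A(a)`
and `D_A(b)` is the minimum `r ≥ 0` such that (a) `|τ(a − b)| ≤ r` for every tracial state
`τ`, and (b) `d(W_{A/M}(q_M(a)), W_{A/M}(q_M(b))) ≤ r` for every maximal closed two-sided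
ideal `M`. -/
theorem dixmierSet_distance_formula (A : Type*) [CStarAlgebra A] (a b : A) :
    0 ≤ setDist (dixmierSet a) (dixmierSet b) ∧
    (∀ τ : A →L[ℂ] ℂ, IsTracialState τ →
      ‖τ (a - b)‖ ≤ setDist (dixmierSet a) (dixmierSet b)) ∧
    (∀ M : Submodule ℂ A, IsMaximalClosedIdeal M →
      setDist (quotNumericalRange M a) (quotNumericalRange M b) ≤
        setDist (dixmierSet a) (dixmierSet b)) ∧
    ∀ r : ℝ, 0 ≤ r →
      (∀ τ : A →L[ℂ] ℂ, IsTracialState τ → ‖τ (a - b)‖ ≤ r) →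
      (∀ M : Submodule ℂ A, IsMaximalClosedIdeal M →
        setDist (quotNumericalRange M a) (quotNumericalRange M b) ≤ r) →
      setDist (dixmierSet a) (dixmierSet b) ≤ r := by
  let : PartialOrder A := CStarAlgebra.spectralOrder A
  have : StarOrderedRing A := CStarAlgebra.spectralOrderedRing A
  have ha : (dixmierSet a).Nonempty := ⟨a, self_mem_dixmierSet a⟩
  have hb : (dixmierSet b).Nonempty := ⟨b, self_mem_dixmierSet b⟩
  refine ⟨setDist_nonneg _ _, fun τ hτ => ?_, fun M hM => ?_, fun r hr hτ hW => ?_⟩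
  · refine le_setDist ha hb fun x hx y hy => ?_
    rw [map_sub, ← hτ.apply_eq_of_mem_dixmierSet hx, ← hτ.apply_eq_of_mem_dixmierSet hy, ← map_sub,
      dist_eq_norm]
    simpa [hτ.1] using τ.le_opNorm (x - y)
  · refine le_setDist ha hb fun x hx y hy => ?_
    obtain ⟨F, hF⟩ := quotStates_nonempty hM.1 hM.2.1
    refine (setDist_le_dist (cval_mem_quotNumericalRange hM.1 hF hx)
      (cval_mem_quotNumericalRange hM.1 hF hy)).trans ?_
    rw [dist_eq_norm, dist_eq_norm, ← hF.1.cval_sub]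
    simpa [hF.2.1] using hF.1.norm_cval_le (x - y)
  · by_contra! hlt
    obtain ⟨R, hrR, hR⟩ := exists_between hlt
    have hmodel := isMatModel_diagHom (A := A)
    have hne := exists_vStates hmodel a b (hr.trans hrR.le) fun x hx y hy => by
      rw [← dist_eq_norm]
      exact hR.trans_le
        (setDist_le_dist (convOrbit_subset_dixmierSet _ hx) (convOrbit_subset_dixmierSet _ hy))
    rw [vStates_eq_empty hmodel hrR hτ hW] at hne
    exact Set.not_nonempty_empty hne

end
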